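/- Let r ≥ 3 and k ≥ 1 be integers. There exist an integer m_0 = m_0(r,k) and an absolute constant c > 0 such that for all m ≥ m_0, the daisy Ramsey number satisfies D_r(m,k) ≥ t_{r-2}(c · k^{-2} · m^{2^{4-r}}), where t_i is the i-fold iterated exponential (t_0(x) = x, t_{i+1}(x) = 2^{t_i(x)}). -/

import Mathlib

/-- The coloring `c` is monochromatic on the `r`-subsets of `S`. -/
def IsMonoOn (c : Finset ℕ → Bool) (r : ℕ) (S : Finset ℕ) : Prop :=
  ∃ col : Bool, ∀ P ⊆ S, P.card = r → c P = col

/-- `R_r(m)`: the least `N` such that every 2-coloring of the `r`-subsets of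
`{1,…,N}` admits a monochromatic set of size `m`. -/
noncomputable def ramseyNumber (r m : ℕ) : ℕ :=
  sInf {N : ℕ | ∀ c : Finset ℕ → Bool,
    ∃ S ⊆ Finset.Icc 1 N, S.card = m ∧ IsMonoOn c r S}

/-- The coloring `c` admits a monochromatic `(r,m,k)`-daisy inside `{1,…,N}`. -/
def HasMonoDaisy (r m k N : ℕ) (c : Finset ℕ → Bool) : Prop :=
  ∃ K M : Finset ℕ, K ∪ M ⊆ Finset.Icc 1 N ∧ Disjoint K M ∧
    K.card = k ∧ M.card = m ∧
    ∃ col : Bool, ∀ P ⊆ M, P.card = r → c (K ∪ P) = col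

/-- `D_r(m,k)`: the daisy Ramsey number. -/
noncomputable def daisyRamsey (r m k : ℕ) : ℕ :=
  sInf {N : ℕ | ∀ c : Finset ℕ → Bool, HasMonoDaisy r m k N c}

/-- The coloring `c` admits a monochromatic simple `(r,m,k)`-daisy inside `{1,…,N}`:
the kernel splits as `K₀ ∪ K₁` with `K₀ < M < K₁`. -/
def HasMonoSimpleDaisy (r m k N : ℕ) (c : Finset ℕ → Bool) : Prop :=
  ∃ K₀ M K₁ : Finset ℕ, K₀ ∪ M ∪ K₁ ⊆ Finset.Icc 1 N ∧
    (∀ x ∈ K₀, ∀ y ∈ M, x < y) ∧ (∀ y ∈ M, ∀ z ∈ K₁, y < z) ∧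
    (∀ x ∈ K₀, ∀ z ∈ K₁, x < z) ∧
    (K₀ ∪ K₁).card = k ∧ M.card = m ∧
    ∃ col : Bool, ∀ P ⊆ M, P.card = r → c (K₀ ∪ P ∪ K₁) = col

/-- `D_r^{smp}(m,k)`: the simple-daisy Ramsey number. -/
noncomputable def simpleDaisyRamsey (r m k : ℕ) : ℕ :=
  sInf {N : ℕ | ∀ c : Finset ℕ → Bool, HasMonoSimpleDaisy r m k N c}

/-- The tower function: `t_0(x) = x`, `t_{i+1}(x) = 2^{t_i(x)}`. -/
noncomputable def tower : ℕ → ℝ → ℝ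
  | 0, x => x
  | i + 1, x => 2 ^ tower i x

/-- The increasing enumeration of a finite set of naturals. -/
noncomputable def enumNat (S : Finset ℕ) : ℕ → ℕ := Nat.nth (· ∈ S)

theorem strictMonoOn_enumNat (S : Finset ℕ) : StrictMonoOn (enumNat S) (Set.Iio S.card) := by
  have h := Nat.nth_strictMonoOn (p := (· ∈ S)) S.finite_toSet
  have e : S.finite_toSet.toFinset = S := by ext; simp
  simpa [enumNat, e] using h

theorem image_enumNat (S : Finset ℕ) : (Finset.range S.card).image (enumNat S) = S := by
  have h := Nat.image_nth_Iio_card (p := (· ∈ S)) S.finite_toSet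
  have e : S.finite_toSet.toFinset = S := by ext; simp
  apply Finset.coe_injective
  rw [Finset.coe_image, Finset.coe_range]
  simp only [enumNat]
  rw [e] at h
  rw [h]
  rfl

theorem enumNat_mem {S : Finset ℕ} {i : ℕ} (hi : i < S.card) : enumNat S i ∈ S := by
  have h := Finset.mem_image_of_mem (enumNat S) (Finset.mem_range.2 hi)
  rwa [image_enumNat] at h

theorem card_image_of_strictMonoOn {y : ℕ → ℕ} {n : ℕ} (hy : StrictMonoOn y (Set.Iio n)) :
    ((Finset.range n).image y).card = n := by
  rw [Finset.card_image_of_injOn, Finset.card_range]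
  simpa using hy.injOn

theorem enumNat_image {y : ℕ → ℕ} {n : ℕ} (hy : StrictMonoOn y (Set.Iio n)) {j : ℕ}
    (hj : j < n) : enumNat ((Finset.range n).image y) j = y j := by
  have hy' : y j ∈ (Finset.range n).image y :=
    Finset.mem_image_of_mem _ (Finset.mem_range.2 hj)
  have hc : Nat.count (· ∈ (Finset.range n).image y) (y j) = j := by
    rw [Nat.count_eq_card_filter_range]
    have : {x ∈ Finset.range (y j) | x ∈ (Finset.range n).image y} = (Finset.range j).image y := by
      ext x
      simp only [Finset.mem_filter, Finset.mem_range, Finset.mem_image]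
      constructor
      · rintro ⟨h1, i, hi, rfl⟩
        exact ⟨i, (hy.lt_iff_lt hi hj).1 h1, rfl⟩
      · rintro ⟨i, hi, rfl⟩
        exact ⟨hy (hi.trans hj) hj hi, i, hi.trans hj, rfl⟩
    rw [this, card_image_of_strictMonoOn (hy.mono (Set.Iio_subset_Iio hj.le))]
  have := Nat.nth_count (p := (· ∈ (Finset.range n).image y)) hy'
  rw [hc] at this
  exact this

theorem exists_endHomogeneous (r : ℕ)
    (ih : ∀ m, ∃ N, ∀ (c : Finset ℕ → Bool) (S : Finset ℕ), N ≤ S.card →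
      ∃ T ⊆ S, T.card = m ∧ IsMonoOn c r T) (n : ℕ) :
    ∃ N, ∀ (c : Finset ℕ → Bool) (S : Finset ℕ), N ≤ S.card →
      ∃ T ⊆ S, T.card = n ∧ ∃ g : ℕ → Bool, ∀ x ∈ T, ∀ P ⊆ T, P.card = r →
        (∀ y ∈ P, x < y) → c (insert x P) = g x := by
  induction n with
  | zero => exact ⟨0, fun c S _ => ⟨∅, by simp, by simp, fun _ => true, by simp⟩⟩
  | succ n ihn =>
    obtain ⟨N₁, h₁⟩ := ihn
    obtain ⟨N₂, h₂⟩ := ih N₁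
    refine ⟨N₂ + 1, fun c S hS => ?_⟩
    have hne : S.Nonempty := Finset.card_pos.1 (by omega)
    set x := S.min' hne
    have hx : x ∈ S := S.min'_mem hne
    obtain ⟨T₀, hT₀, hc₀, col, hcol⟩ := h₂ (fun P => c (insert x P)) (S.erase x)
      (by rw [Finset.card_erase_of_mem hx]; omega)
    obtain ⟨T₁, hT₁, hc₁, g, hg⟩ := h₁ c T₀ hc₀.ge
    have hxT : ∀ y ∈ T₁, x < y := fun y hy => by
      have := hT₀ (hT₁ hy)
      exact lt_of_le_of_ne (S.min'_le y (Finset.mem_of_mem_erase this))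
        (Finset.ne_of_mem_erase this).symm
    have hxn : x ∉ T₁ := fun h => lt_irrefl _ (hxT x h)
    refine ⟨insert x T₁, ?_, by rw [Finset.card_insert_of_notMem hxn, hc₁],
      Function.update g x col, ?_⟩
    · exact Finset.insert_subset hx ((hT₁.trans hT₀).trans (Finset.erase_subset _ _))
    · intro z hz P hP hPr hPz
      have hPT : P ⊆ T₁ := fun y hy => by
        rcases Finset.mem_insert.1 (hP hy) with rfl | h
        · rcases Finset.mem_insert.1 hz with rfl | h'
          · exact absurd (hPz _ hy) (lt_irrefl _)
          · exact absurd (hPz _ hy) (not_lt.2 (hxT z h').le)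
        · exact h
      rcases Finset.mem_insert.1 hz with rfl | hz'
      · rw [Function.update_self]
        exact hcol P (hPT.trans hT₁) hPr
      · rw [Function.update_of_ne (hxT z hz').ne']
        exact hg z hz' P hPT hPr hPz

/-- Finite hypergraph Ramsey theorem for two colors. -/
theorem exists_isMonoOn (r m : ℕ) :
    ∃ N, ∀ (c : Finset ℕ → Bool) (S : Finset ℕ), N ≤ S.card →
      ∃ T ⊆ S, T.card = m ∧ IsMonoOn c r T := by
  induction r generalizing m with
  | zero =>
    refine ⟨m, fun c S hS => ?_⟩
    obtain ⟨T, hT, hc⟩ := Finset.exists_subset_card_eq hS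
    exact ⟨T, hT, hc, c ∅, fun P _ hP => by rw [Finset.card_eq_zero.1 hP]⟩
  | succ r ih =>
    obtain ⟨N, hN⟩ := exists_endHomogeneous r ih (2 * m)
    refine ⟨N, fun c S hS => ?_⟩
    obtain ⟨T, hT, hc, g, hg⟩ := hN c S hS
    obtain ⟨col, -, hcol⟩ := Finset.exists_le_card_fiber_of_mul_le_card_of_maps_to
      (s := T) (t := (Finset.univ : Finset Bool)) (f := g) (n := m) (fun _ _ => Finset.mem_univ _)
      Finset.univ_nonempty (by simp [hc])
    obtain ⟨T', hT', hc'⟩ := Finset.exists_subset_card_eq hcol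
    have hT'' : T' ⊆ T := hT'.trans (Finset.filter_subset _ _)
    refine ⟨T', hT''.trans hT, hc', col, fun P hP hPr => ?_⟩
    have hne : P.Nonempty := Finset.card_pos.1 (by omega)
    have hmem := P.min'_mem hne
    have := hg (P.min' hne) (hT'' (hP hmem)) (P.erase (P.min' hne))
      ((Finset.erase_subset _ _).trans (hP.trans hT''))
      (by rw [Finset.card_erase_of_mem hmem]; omega)
      (fun y hy => lt_of_le_of_ne (P.min'_le y (Finset.mem_of_mem_erase hy))
        (Finset.ne_of_mem_erase hy).symm)
    rw [Finset.insert_erase hmem] at this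
    rw [this]
    exact (Finset.mem_filter.1 (hT' (hP hmem))).2

theorem exists_hasMonoDaisy (r m k : ℕ) :
    ∃ N, ∀ c : Finset ℕ → Bool, HasMonoDaisy r m k N c := by
  obtain ⟨N, hN⟩ := exists_isMonoOn r m
  refine ⟨k + N, fun c => ?_⟩
  obtain ⟨T, hT, hc, col, hcol⟩ := hN (fun P => c (Finset.Icc 1 k ∪ P))
    (Finset.Icc (k + 1) (k + N)) (by simp)
  refine ⟨Finset.Icc 1 k, T, ?_, ?_, by simp, hc, col, hcol⟩
  · refine Finset.union_subset (Finset.Icc_subset_Icc le_rfl (by omega))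
      (hT.trans (Finset.Icc_subset_Icc (by omega) le_rfl))
  · rw [Finset.disjoint_left]
    intro x hx hx'
    have := hT hx'
    simp only [Finset.mem_Icc] at hx this
    omega

/-- `x` embeds `{0,…,m-1}` into `{0,…,N-1}` increasingly, `L < x < R`, and `L ∪ R` has
at most `k` elements. -/
structure IsSimpleKernel (m k N : ℕ) (L R : Finset ℕ) (x : ℕ → ℕ) : Prop where
  card_le : L.card + R.card ≤ k
  strictMonoOn : StrictMonoOn x (Set.Iio m)
  lt_bound : ∀ i < m, x i < N
  left_lt : ∀ a ∈ L, ∀ i < m, a < x i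
  lt_right : ∀ b ∈ R, ∀ i < m, x i < b
  left_lt_right : ∀ a ∈ L, ∀ b ∈ R, a < b
  left_bound : ∀ a ∈ L, a < N
  right_bound : ∀ b ∈ R, b < N

/-- `φ` is an increasing choice of `r` indices below `m`. -/
def IsSel (r m : ℕ) (φ : ℕ → ℕ) : Prop :=
  StrictMonoOn φ (Set.Iio r) ∧ ∀ i < r, φ i < m

/-- On no simple daisy with kernel of size at most `k` does the coloring `C` of the petals
`P` have the form `A (min P) + B (max P)`. -/
def IsDaisyGood (C : Finset ℕ → ZMod 2) (r m k N : ℕ) : Prop :=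
  ∀ (L R : Finset ℕ) (x : ℕ → ℕ), IsSimpleKernel m k N L R x → ∀ A B : ℕ → ZMod 2,
    ∃ φ, IsSel r m φ ∧
      C (L ∪ (Finset.range r).image (x ∘ φ) ∪ R) ≠ A (φ 0) + B (φ (r - 1))

theorem IsDaisyGood.le_daisyRamsey {C : Finset ℕ → ZMod 2} {r m m' k N : ℕ}
    (hC : IsDaisyGood C r m' k N) (hm' : 0 < m') (hm : (k + 1) * m' ≤ m) :
    N ≤ daisyRamsey r m k := by
  apply le_csInf (exists_hasMonoDaisy r m k)
  intro N' hN'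
  by_contra! hlt
  obtain ⟨K, M, hKM, hdis, hK, hM, col, hcol⟩ := hN' (fun X => decide (C X = 1))
  obtain ⟨v, -, hv⟩ := Finset.exists_le_card_fiber_of_mul_le_card_of_maps_to
      (s := M) (t := Finset.range (k + 1)) (f := fun y => (K.filter (· < y)).card) (n := m')
      (fun y _ => Finset.mem_range.2 (by
        have := Finset.card_filter_le K (· < y); omega))
      (by simp) (by simpa [hM] using hm)
  obtain ⟨M', hM', hc'⟩ := Finset.exists_subset_card_eq hv
  have hMM : M' ⊆ M := hM'.trans (Finset.filter_subset _ _)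
  have hv' : ∀ y ∈ M', (K.filter (· < y)).card = v := fun y hy =>
    (Finset.mem_filter.1 (hM' hy)).2
  have hlt' : ∀ a ∈ K ∪ M, a < N := fun a ha => by
    have := Finset.mem_Icc.1 (hKM ha); omega
  set L := K.filter (fun a => ∀ y ∈ M', a < y) with hL
  set R := K.filter (fun a => ∀ y ∈ M', y < a) with hR
  have hLR : K = L ∪ R := by
    ext a
    simp only [hL, hR, Finset.mem_union, Finset.mem_filter, ← and_or_left, iff_self_and]
    intro ha
    by_contra! hcon
    obtain ⟨⟨y, hy, hya⟩, ⟨z, hz, haz⟩⟩ := hcon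
    have hne : ∀ y ∈ M', a ≠ y := fun y hy h =>
      Finset.disjoint_left.1 hdis ha (h ▸ hMM hy)
    have h1 : y < a := lt_of_le_of_ne hya (hne y hy).symm
    have h2 : a < z := lt_of_le_of_ne haz (hne z hz)
    have : (K.filter (· < y)).card < (K.filter (· < z)).card := by
      apply Finset.card_lt_card
      rw [Finset.ssubset_iff_of_subset]
      · exact ⟨a, by simp [ha, h2], by simp [h1.le]⟩
      · intro b hb
        simp only [Finset.mem_filter] at hb ⊢
        exact ⟨hb.1, by omega⟩
    rw [hv' y hy, hv' z hz] at this
    exact lt_irrefl _ this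
  have hdLR : Disjoint L R := by
    rw [Finset.disjoint_left]
    intro a ha ha'
    obtain ⟨y, hy⟩ : M'.Nonempty := Finset.card_pos.1 (by omega)
    exact lt_asymm ((Finset.mem_filter.1 ha).2 y hy) ((Finset.mem_filter.1 ha').2 y hy)
  have hmem : ∀ i < m', enumNat M' i ∈ M' := fun i hi => enumNat_mem (hc'.symm ▸ hi)
  have hker : IsSimpleKernel m' k N L R (enumNat M') :=
    { card_le := by rw [← Finset.card_union_of_disjoint hdLR, ← hLR, hK]
      strictMonoOn := hc' ▸ strictMonoOn_enumNat M'
      lt_bound := fun i hi => hlt' _ (Finset.mem_union_right _ (hMM (hmem i hi)))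
      left_lt := fun a ha i hi => (Finset.mem_filter.1 ha).2 _ (hmem i hi)
      lt_right := fun a ha i hi => (Finset.mem_filter.1 ha).2 _ (hmem i hi)
      left_lt_right := fun a ha b hb =>
        ((Finset.mem_filter.1 ha).2 _ (hmem 0 hm')).trans
          ((Finset.mem_filter.1 hb).2 _ (hmem 0 hm'))
      left_bound := fun a ha => hlt' _ (Finset.mem_union_left _ (Finset.mem_filter.1 ha).1)
      right_bound := fun a ha => hlt' _ (Finset.mem_union_left _ (Finset.mem_filter.1 ha).1) }
  obtain ⟨φ, ⟨hφ, hφm⟩, hne⟩ := hC L R _ hker (fun _ => if col then 1 else 0) (fun _ => 0)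
  apply hne
  have hx : StrictMonoOn (enumNat M' ∘ φ) (Set.Iio r) :=
    hker.strictMonoOn.comp hφ (fun i hi => hφm i hi)
  have := hcol ((Finset.range r).image (enumNat M' ∘ φ))
    (by
      intro a ha
      obtain ⟨i, hi, rfl⟩ := Finset.mem_image.1 ha
      exact hMM (hmem _ (hφm i (Finset.mem_range.1 hi))))
    (card_image_of_strictMonoOn hx)
  rw [hLR, Finset.union_right_comm] at this
  rw [add_zero]
  have key : ∀ (b : Bool) (z : ZMod 2), decide (z = 1) = b → z = if b then 1 else 0 := by decide
  exact key _ _ this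

theorem card_prescribed_mul {Ω : Type*} [Fintype Ω] [DecidableEq Ω] (S : Finset Ω)
    (y : Ω → ZMod 2) :
    (Finset.univ.filter fun ω : Ω → ZMod 2 => ∀ p ∈ S, ω p = y p).card * 2 ^ S.card
      = 2 ^ Fintype.card Ω := by
  have h : (Finset.univ.filter fun ω : Ω → ZMod 2 => ∀ p ∈ S, ω p = y p)
      = Fintype.piFinset (fun p => if p ∈ S then {y p} else (Finset.univ : Finset (ZMod 2))) := by
    ext ω
    simp only [Finset.mem_filter, Finset.mem_univ, true_and, Fintype.mem_piFinset]
    refine forall_congr' fun p => ?_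
    by_cases hp : p ∈ S <;> simp [hp]
  rw [h, Fintype.card_piFinset]
  have h2 : ∀ p, (if p ∈ S then {y p} else (Finset.univ : Finset (ZMod 2))).card
      = if p ∈ S then 1 else 2 := fun p => by
    by_cases hp : p ∈ S <;> simp [hp, ZMod.card]
  simp only [h2]
  rw [Finset.prod_ite, Finset.prod_const_one, one_mul, Finset.prod_const, ← pow_add,
    ← Finset.card_univ (α := Ω)]
  congr 1
  rw [add_comm, ← Finset.card_filter_add_card_filter_not (s := Finset.univ) (p := (· ∈ S))]
  simp

/-- The union bound: fewer than `2 ^ T` tests, each prescribing at least `T` coordinates of a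
`0/1`-vector, are all failed by some vector. -/
theorem exists_forall_exists_ne {Ω τ ι : Type*} [Fintype Ω] [DecidableEq Ω] [Fintype τ] [Nonempty ι]
    {T : ℕ} (hT : Fintype.card τ < 2 ^ T) (S : τ → Finset ι) (x : τ → ι → Ω)
    (y : τ → ι → ZMod 2) :
    ∃ ω : Ω → ZMod 2, ∀ κ, T ≤ (S κ).card → Set.InjOn (x κ) (S κ) →
      ∃ e ∈ S κ, ω (x κ e) ≠ y κ e := by
  classical
  by_contra! hcon
  let V : Finset τ := Finset.univ.filter fun κ => T ≤ (S κ).card ∧ Set.InjOn (x κ) (S κ)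
  let y' : τ → Ω → ZMod 2 := fun κ p => y κ (Function.invFunOn (x κ) (S κ) p)
  let B : τ → Finset (Ω → ZMod 2) := fun κ =>
    Finset.univ.filter fun ω : Ω → ZMod 2 => ∀ p ∈ (S κ).image (x κ), ω p = y' κ p
  have hcov : (Finset.univ : Finset (Ω → ZMod 2)) ⊆ V.biUnion B := by
    intro ω _
    obtain ⟨κ, h1, h2, h3⟩ := hcon ω
    refine Finset.mem_biUnion.2 ⟨κ, by simp [V, h1, h2], ?_⟩
    simp only [B, Finset.mem_filter, Finset.mem_univ, true_and, Finset.mem_image]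
    rintro p ⟨e, he, rfl⟩
    rw [h3 e he]
    simp only [y']
    rw [h2.leftInvOn_invFunOn he]
  have hB : ∀ κ ∈ V, (B κ).card * 2 ^ T ≤ 2 ^ Fintype.card Ω := fun κ hκ => by
    obtain ⟨h1, h2⟩ := (Finset.mem_filter.1 hκ).2
    rw [← card_prescribed_mul ((S κ).image (x κ)) (y' κ)]
    apply Nat.mul_le_mul_left
    apply Nat.pow_le_pow_right (by norm_num)
    rwa [Finset.card_image_of_injOn h2]
  have h1 : 2 ^ Fintype.card Ω ≤ ∑ κ ∈ V, (B κ).card := by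
    have := (Finset.card_le_card hcov).trans Finset.card_biUnion_le
    simpa [Finset.card_univ, ZMod.card] using this
  have h2 : (∑ κ ∈ V, (B κ).card) * 2 ^ T ≤ Fintype.card τ * 2 ^ Fintype.card Ω := by
    rw [Finset.sum_mul]
    refine (Finset.sum_le_card_nsmul _ _ _ hB).trans ?_
    rw [smul_eq_mul]
    exact Nat.mul_le_mul_right _ (Finset.card_le_univ V)
  have h3 := (Nat.mul_le_mul_right (2 ^ T) h1).trans h2
  have h4 := Nat.mul_lt_mul_of_pos_right hT (Nat.two_pow_pos (Fintype.card Ω))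
  rw [mul_comm] at h3
  omega

/-- Extension by a default value of a function on `Fin n` to all naturals. -/
def extendFin {α : Type*} (a : α) {n : ℕ} (f : Fin n → α) (i : ℕ) : α :=
  if h : i < n then f ⟨i, h⟩ else a

theorem extendFin_of_lt {α : Type*} (a : α) {n : ℕ} (f : Fin n → α) {i : ℕ} (h : i < n) :
    extendFin a f i = f ⟨i, h⟩ := dif_pos h

/-- The finite set of naturals below `N` listed by `u`, the value `N` being a blank. -/
def listedSet {k N : ℕ} (u : Fin k → Fin (N + 1)) : Finset ℕ :=
  (Finset.univ.image fun i => (u i : ℕ)).filter (· < N)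

theorem exists_listedSet_eq {k N : ℕ} {U : Finset ℕ} (hU : U.card ≤ k) (hN : ∀ a ∈ U, a < N) :
    ∃ u : Fin k → Fin (N + 1), listedSet u = U := by
  refine ⟨fun i => if h : (i : ℕ) < U.card then
    ⟨enumNat U i, (hN _ (enumNat_mem h)).trans (Nat.lt_succ_self N)⟩ else Fin.last N, ?_⟩
  ext a
  simp only [listedSet, Finset.mem_filter, Finset.mem_image, Finset.mem_univ, true_and]
  constructor
  · rintro ⟨⟨i, rfl⟩, h⟩
    by_cases hi : (i : ℕ) < U.card
    · simpa [hi] using enumNat_mem hi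
    · simp [hi] at h
  · intro ha
    refine ⟨?_, hN a ha⟩
    have ha' := ha
    rw [← image_enumNat U] at ha'
    obtain ⟨i, hi, rfl⟩ := Finset.mem_image.1 ha'
    have hi := Finset.mem_range.1 hi
    exact ⟨⟨i, hi.trans_le hU⟩, by simp [hi]⟩

/-- A set of naturals as a set of elements of `Fin N`. -/
def toFinSet (N : ℕ) (X : Finset ℕ) : Finset (Fin N) := Finset.univ.filter fun i => (i : ℕ) ∈ X

theorem toFinSet_inj {N : ℕ} {X Y : Finset ℕ} (hX : ∀ a ∈ X, a < N) (hY : ∀ a ∈ Y, a < N)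
    (h : toFinSet N X = toFinSet N Y) : X = Y := by
  ext a
  constructor
  · intro ha
    have : (⟨a, hX a ha⟩ : Fin N) ∈ toFinSet N X := by simp [toFinSet, ha]
    rw [h] at this
    simpa [toFinSet] using this
  · intro ha
    have : (⟨a, hY a ha⟩ : Fin N) ∈ toFinSet N Y := by simp [toFinSet, ha]
    rw [← h] at this
    simpa [toFinSet] using this

theorem isSel_enumNat {e : Finset ℕ} {m : ℕ} (he : ∀ i ∈ e, i < m) : IsSel e.card m (enumNat e) :=
  ⟨strictMonoOn_enumNat e, fun _ hi => he _ (enumNat_mem hi)⟩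

theorem choose_three_mul (q : ℕ) : q.choose 3 * 6 = q * (q - 1) * (q - 2) := by
  have := Nat.descFactorial_eq_factorial_mul_choose q 3
  simp [Nat.descFactorial_succ, Nat.factorial] at this
  rw [mul_comm, ← this]
  ring

theorem exists_isDaisyGood_three {q k t : ℕ} (hkq : k ≤ q) (h : 12 * (t + 2) < (q - 1) * (q - 2)) :
    ∃ C : Finset ℕ → ZMod 2, (∀ Y : Finset ℕ, Y.card < 3 → C Y = 0) ∧
      IsDaisyGood C 3 q k (2 ^ t) := by
  set N := 2 ^ t with hN
  have hq : 3 ≤ q := by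
    by_contra! hq
    interval_cases q <;> simp at h
  have hcard : Fintype.card ((Fin k → Fin (N + 1)) × (Fin q → Fin N) ×
      (Fin q → ZMod 2) × (Fin q → ZMod 2)) < 2 ^ (q.choose 3) := by
    simp only [Fintype.card_prod, Fintype.card_fun, Fintype.card_fin, ZMod.card]
    have h1 : (N + 1) ^ k ≤ 2 ^ ((t + 1) * k) := by
      rw [pow_mul]
      apply Nat.pow_le_pow_left
      have := Nat.one_le_two_pow (n := t)
      rw [pow_succ]; omega
    have h2 : N ^ q = 2 ^ (t * q) := by rw [hN, pow_mul]
    calc (N + 1) ^ k * (N ^ q * (2 ^ q * 2 ^ q))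
        ≤ 2 ^ ((t + 1) * k) * (2 ^ (t * q) * (2 ^ q * 2 ^ q)) := by
          rw [h2]; exact Nat.mul_le_mul_right _ h1
      _ = 2 ^ ((t + 1) * k + (t * q + (q + q))) := by simp only [pow_add]
      _ < 2 ^ q.choose 3 := by
          apply Nat.pow_lt_pow_right (by norm_num)
          have h3 := choose_three_mul q
          have h4 : q * (12 * (t + 2)) < q * ((q - 1) * (q - 2)) :=
            Nat.mul_lt_mul_of_pos_left h (by omega)
          rw [← mul_assoc q (q - 1), ← h3] at h4
          have h5 : (t + 1) * k ≤ (t + 1) * q := Nat.mul_le_mul_left _ hkq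
          nlinarith
  let X : ((Fin k → Fin (N + 1)) × (Fin q → Fin N) × (Fin q → ZMod 2) × (Fin q → ZMod 2)) →
      Finset ℕ → Finset ℕ := fun κ e =>
    listedSet κ.1 ∪ e.image (extendFin 0 (fun i => (κ.2.1 i : ℕ)))
  obtain ⟨ω, hω⟩ := exists_forall_exists_ne (ι := Finset ℕ) hcard
    (fun _ => (Finset.range q).powersetCard 3) (fun κ e => toFinSet N (X κ e))
    (fun κ e => extendFin 0 κ.2.2.1 (enumNat e 0) + extendFin 0 κ.2.2.2 (enumNat e 2))
  refine ⟨fun Y => if Y.card < 3 then 0 else ω (toFinSet N Y), fun Y hY => if_pos hY, ?_⟩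
  intro L R x hx A B
  obtain ⟨u, hu⟩ := exists_listedSet_eq (k := k) (N := N) (U := L ∪ R)
    ((Finset.card_union_le _ _).trans hx.card_le)
    (fun a ha => (Finset.mem_union.1 ha).elim (hx.left_bound a) (hx.right_bound a))
  let κ : (Fin k → Fin (N + 1)) × (Fin q → Fin N) × (Fin q → ZMod 2) × (Fin q → ZMod 2) :=
    ⟨u, fun i => ⟨x i, hx.lt_bound i i.2⟩, fun i => A i, fun i => B i⟩
  have hext : ∀ i < q, extendFin 0 (fun i => (κ.2.1 i : ℕ)) i = x i := fun i hi =>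
    extendFin_of_lt _ _ hi
  have hX : ∀ e ∈ (Finset.range q).powersetCard 3, X κ e = L ∪ R ∪ e.image x := by
    intro e he
    have he' := (Finset.mem_powersetCard.1 he).1
    simp only [X]
    congr 1
    exact Finset.image_congr fun i hi => hext i (Finset.mem_range.1 (he' hi))
  have hbd : ∀ e ∈ (Finset.range q).powersetCard 3, ∀ a ∈ X κ e, a < N := by
    intro e he a ha
    rw [hX e he] at ha
    have he' := (Finset.mem_powersetCard.1 he).1
    simp only [Finset.mem_union, Finset.mem_image] at ha
    rcases ha with (ha | ha) | ⟨i, hi, rfl⟩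
    · exact hx.left_bound a ha
    · exact hx.right_bound a ha
    · exact hx.lt_bound i (Finset.mem_range.1 (he' hi))
  have hdisj : ∀ i < q, x i ∉ L ∪ R := by
    intro i hi hmem
    rcases Finset.mem_union.1 hmem with h | h
    · exact lt_irrefl _ (hx.left_lt _ h i hi)
    · exact lt_irrefl _ (hx.lt_right _ h i hi)
  have hinj : Set.InjOn (fun e => toFinSet N (X κ e)) ((Finset.range q).powersetCard 3) := by
    intro e he e' he' hee
    have h1 := toFinSet_inj (hbd e he) (hbd e' he') hee
    rw [hX e he, hX e' he'] at h1
    have key : ∀ e e' : Finset ℕ, e ⊆ Finset.range q → e' ⊆ Finset.range q →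
        L ∪ R ∪ e.image x = L ∪ R ∪ e'.image x → e ⊆ e' := by
      intro e e' he he' h i hi
      have hiq := Finset.mem_range.1 (he hi)
      have : x i ∈ L ∪ R ∪ e'.image x := by
        rw [← h]; exact Finset.mem_union_right _ (Finset.mem_image_of_mem _ hi)
      rcases Finset.mem_union.1 this with h | h
      · exact absurd h (hdisj i hiq)
      · obtain ⟨j, hj, hji⟩ := Finset.mem_image.1 h
        rwa [← hx.strictMonoOn.injOn (Finset.mem_range.1 (he' hj)) hiq hji]
    have h2 := (Finset.mem_powersetCard.1 he).1
    have h3 := (Finset.mem_powersetCard.1 he').1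
    exact (key e e' h2 h3 h1).antisymm (key e' e h3 h2 h1.symm)
  obtain ⟨e, he, hne⟩ := hω κ (by simp) hinj
  obtain ⟨he1, he2⟩ := Finset.mem_powersetCard.1 he
  have hsel : IsSel 3 q (enumNat e) := he2 ▸ isSel_enumNat fun i hi => Finset.mem_range.1 (he1 hi)
  refine ⟨enumNat e, hsel, ?_⟩
  have himg : L ∪ (Finset.range 3).image (x ∘ enumNat e) ∪ R = X κ e := by
    rw [hX e he, Finset.union_right_comm, ← Finset.image_image, ← he2, image_enumNat]
  rw [himg]
  beta_reduce
  rw [if_neg]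
  · have h0 : enumNat e 0 < q := hsel.2 0 (by norm_num)
    have h2 : enumNat e 2 < q := hsel.2 2 (by norm_num)
    rw [extendFin_of_lt _ _ h0, extendFin_of_lt _ _ h2] at hne
    exact hne
  · rw [hX e he, not_lt, ← he2, ← Finset.card_image_of_injOn (f := x) (s := e)]
    · exact Finset.card_le_card Finset.subset_union_right
    · exact hx.strictMonoOn.injOn.mono fun i hi => Finset.mem_range.1 (he1 hi)

theorem exists_div_eq_div (x y : ℕ) : ∃ e, x / 2 ^ (e + 1) = y / 2 ^ (e + 1) := by
  refine ⟨max x y, ?_⟩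
  have h : max x y < 2 ^ (max x y + 1) :=
    Nat.lt_two_pow_self.trans (Nat.pow_lt_pow_right (by norm_num) (Nat.lt_succ_self _))
  rw [Nat.div_eq_of_lt ((le_max_left _ _).trans_lt h),
    Nat.div_eq_of_lt ((le_max_right _ _).trans_lt h)]

/-- The highest binary digit where `x` and `y` differ. -/
def lev (x y : ℕ) : ℕ := Nat.find (exists_div_eq_div x y)

theorem lev_le_iff {x y e : ℕ} : lev x y ≤ e ↔ x / 2 ^ (e + 1) = y / 2 ^ (e + 1) := by
  constructor
  · intro h
    have h1 := Nat.find_spec (exists_div_eq_div x y)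
    change x / 2 ^ (lev x y + 1) = y / 2 ^ (lev x y + 1) at h1
    obtain ⟨d, rfl⟩ := Nat.exists_eq_add_of_le h
    have : 2 ^ (lev x y + d + 1) = 2 ^ (lev x y + 1) * 2 ^ d := by
      rw [← pow_add]; congr 1; omega
    rw [this, ← Nat.div_div_eq_div_mul, ← Nat.div_div_eq_div_mul, h1]
  · exact fun h => Nat.find_min' _ h

theorem lev_lt {x y N : ℕ} (hN : 0 < N) (hx : x < 2 ^ N) (hy : y < 2 ^ N) : lev x y < N := by
  have : lev x y ≤ N - 1 := lev_le_iff.2 (by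
    rw [Nat.sub_add_cancel hN, Nat.div_eq_of_lt hx, Nat.div_eq_of_lt hy])
  omega

theorem lev_eq_max {x y z : ℕ} (hxy : x ≤ y) (hyz : y ≤ z) :
    lev x z = max (lev x y) (lev y z) := by
  refine eq_of_forall_ge_iff fun e => ?_
  rw [max_le_iff, lev_le_iff, lev_le_iff, lev_le_iff]
  have h1 : x / 2 ^ (e + 1) ≤ y / 2 ^ (e + 1) := Nat.div_le_div_right hxy
  have h2 : y / 2 ^ (e + 1) ≤ z / 2 ^ (e + 1) := Nat.div_le_div_right hyz
  omega

theorem div_lt_div_lev {x y : ℕ} (h : x < y) : x / 2 ^ lev x y < y / 2 ^ lev x y := by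
  refine lt_of_le_of_ne (Nat.div_le_div_right h.le) fun he => ?_
  rcases Nat.eq_zero_or_pos (lev x y) with h0 | h0
  · rw [h0] at he
    simp at he
    omega
  · have : lev x y ≤ lev x y - 1 := lev_le_iff.2 (by rwa [Nat.sub_add_cancel h0])
    omega

theorem lev_ne {x y z : ℕ} (hxy : x < y) (hyz : y < z) : lev x y ≠ lev y z := by
  intro h
  have h1 := div_lt_div_lev hxy
  have h2 := div_lt_div_lev hyz
  have h3 := lev_le_iff.1 (le_refl (lev x y))
  have h4 := lev_le_iff.1 (le_refl (lev y z))
  rw [← h] at h2 h4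
  rw [pow_succ, ← Nat.div_div_eq_div_mul, ← Nat.div_div_eq_div_mul] at h3 h4
  omega

/-- Position `j` of the sequence `D 0, …, D (n-1)` is an end or a local extremum. -/
def IsTurn (n : ℕ) (D : ℕ → ℕ) (j : ℕ) : Prop :=
  j = 0 ∨ j + 1 = n ∨
    ¬ ((D (j - 1) < D j ∧ D j < D (j + 1)) ∨ (D j < D (j - 1) ∧ D (j + 1) < D j))

/-- `D a, …, D b` is a maximal monotone stretch of `D 0, …, D (n-1)`. -/
def IsRun (n : ℕ) (D : ℕ → ℕ) (a b : ℕ) : Prop :=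
  a < b ∧ b < n ∧ IsTurn n D a ∧ IsTurn n D b ∧ ∀ t, a < t → t < b → ¬ IsTurn n D t

/-- Position `j` is an interior local maximum of `D 0, …, D (n-1)`. -/
def IsPeak (n : ℕ) (D : ℕ → ℕ) (j : ℕ) : Prop :=
  0 < j ∧ j + 1 < n ∧ D (j - 1) < D j ∧ D (j + 1) < D j

theorem IsPeak.isTurn {n : ℕ} {D : ℕ → ℕ} {j : ℕ} (h : IsPeak n D j) : IsTurn n D j := by
  obtain ⟨h1, h2, h3, h4⟩ := h
  right; right; omega

open Classical in
/-- The color of a sequence of levels: the sum of the colors of its runs plus a correction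
`γ` read off at each peak. -/
noncomputable def runColor (C : Finset ℕ → ZMod 2) (γ : ℕ → ℕ → ℕ → ZMod 2) (n : ℕ)
    (D : ℕ → ℕ) : ZMod 2 :=
  (∑ p ∈ (Finset.range n ×ˢ Finset.range n).filter (fun p => IsRun n D p.1 p.2),
    C ((Finset.Icc p.1 p.2).image D)) +
  ∑ j ∈ (Finset.range n).filter (fun j => IsPeak n D j), γ j (D (j - 1)) (D (j + 1))

theorem isTurn_congr {n : ℕ} {D D' : ℕ → ℕ} (h : ∀ j < n, D j = D' j) {j : ℕ} (hj : j < n) :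
    IsTurn n D j ↔ IsTurn n D' j := by
  unfold IsTurn
  by_cases h1 : j + 1 = n
  · simp [h1]
  · rw [h j hj, h (j - 1) (by omega), h (j + 1) (by omega)]

theorem runColor_congr {C : Finset ℕ → ZMod 2} {γ : ℕ → ℕ → ℕ → ZMod 2} {n : ℕ}
    {D D' : ℕ → ℕ} (h : ∀ j < n, D j = D' j) : runColor C γ n D = runColor C γ n D' := by
  classical
  unfold runColor
  congr 1
  · refine Finset.sum_congr ?_ ?_
    · refine Finset.filter_congr fun p hp => ?_
      have hp1 := Finset.mem_range.1 (Finset.mem_product.1 hp).1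
      have hp2 := Finset.mem_range.1 (Finset.mem_product.1 hp).2
      unfold IsRun
      rw [isTurn_congr h hp1, isTurn_congr h hp2]
      refine and_congr_right fun _ => and_congr_right fun _ => and_congr_right fun _ =>
        and_congr_right fun _ => forall_congr' fun t => forall_congr' fun _ =>
        forall_congr' fun h2 => ?_
      rw [isTurn_congr h (h2.trans hp2)]
    · intro p hp
      have hp2 := Finset.mem_range.1 (Finset.mem_product.1 (Finset.mem_filter.1 hp).1).2
      congr 1
      refine Finset.image_congr fun i hi => h i ?_
      exact (Finset.mem_Icc.1 hi).2.trans_lt hp2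
  · refine Finset.sum_congr ?_ ?_
    · refine Finset.filter_congr fun j hj => ?_
      unfold IsPeak
      refine and_congr_right fun _ => and_congr_right fun h2 => ?_
      rw [h j (by omega), h (j - 1) (by omega), h (j + 1) (by omega)]
    · intro j hj
      have := (Finset.mem_filter.1 hj).2
      rw [h (j - 1) (by have := this.2.1; omega), h (j + 1) this.2.1]

theorem isTurn_prefix {n : ℕ} {D : ℕ → ℕ} {t : ℕ} (ht : t < n) (hturn : IsTurn n D t) {j : ℕ}
    (hj : j ≤ t) : IsTurn (t + 1) D j ↔ IsTurn n D j := by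
  rcases hj.eq_or_lt with rfl | hj
  · exact ⟨fun _ => hturn, fun _ => Or.inr (Or.inl rfl)⟩
  · unfold IsTurn
    have h1 : ¬ (j + 1 = t + 1) := by omega
    have h2 : ¬ (j + 1 = n) := by omega
    simp only [h1, h2]

theorem isTurn_suffix {n : ℕ} {D : ℕ → ℕ} {t : ℕ} (ht : t < n) (hturn : IsTurn n D t) (j : ℕ) :
    IsTurn (n - t) (fun i => D (i + t)) j ↔ IsTurn n D (j + t) := by
  rcases Nat.eq_zero_or_pos j with rfl | hj
  · rw [zero_add]
    exact ⟨fun _ => hturn, fun _ => Or.inl rfl⟩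
  · unfold IsTurn
    have h1 : j - 1 + t = j + t - 1 := by omega
    have h2 : j + 1 + t = j + t + 1 := by omega
    have h3 : (j + 1 = n - t) ↔ (j + t + 1 = n) := by omega
    have h4 : ¬ j = 0 := by omega
    have h5 : ¬ j + t = 0 := by omega
    simp only [h1, h2, h3, h4, h5]

open Classical in
theorem runColor_split (C : Finset ℕ → ZMod 2) (γ : ℕ → ℕ → ℕ → ZMod 2) {n : ℕ}
    {D : ℕ → ℕ} {t : ℕ} (ht : t < n) (hturn : IsTurn n D t) :
    runColor C γ n D = runColor C γ (t + 1) D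
      + runColor C (fun j => γ (j + t)) (n - t) (fun i => D (i + t))
      + if IsPeak n D t then γ t (D (t - 1)) (D (t + 1)) else 0 := by
  unfold runColor
  have hruns : ∑ p ∈ (Finset.range n ×ˢ Finset.range n).filter (fun p => IsRun n D p.1 p.2),
      C ((Finset.Icc p.1 p.2).image D) =
      ∑ p ∈ (Finset.range (t + 1) ×ˢ Finset.range (t + 1)).filter
        (fun p => IsRun (t + 1) D p.1 p.2), C ((Finset.Icc p.1 p.2).image D) +
      ∑ p ∈ (Finset.range (n - t) ×ˢ Finset.range (n - t)).filter
        (fun p => IsRun (n - t) (fun i => D (i + t)) p.1 p.2),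
        C ((Finset.Icc p.1 p.2).image (fun i => D (i + t))) := by
    rw [← Finset.sum_filter_add_sum_filter_not _ (fun p : ℕ × ℕ => p.2 ≤ t)]
    congr 1
    · refine Finset.sum_congr ?_ fun _ _ => rfl
      ext ⟨a, b⟩
      simp only [Finset.mem_filter, Finset.mem_product, Finset.mem_range]
      simp only [IsRun]
      constructor
      · rintro ⟨⟨-, h1, h2, h3, h4, h5⟩, h6⟩
        exact ⟨by omega, h1, by omega, (isTurn_prefix ht hturn (by omega)).2 h3,
          (isTurn_prefix ht hturn h6).2 h4,
          fun u hu1 hu2 hu => h5 u hu1 hu2 ((isTurn_prefix ht hturn (by omega)).1 hu)⟩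
      · rintro ⟨-, h1, h2, h3, h4, h5⟩
        exact ⟨⟨by omega, h1, by omega, (isTurn_prefix ht hturn (by omega)).1 h3,
          (isTurn_prefix ht hturn (by omega)).1 h4,
          fun u hu1 hu2 hu => h5 u hu1 hu2 ((isTurn_prefix ht hturn (by omega)).2 hu)⟩,
          by omega⟩
    · symm
      refine Finset.sum_bij (fun p _ => (p.1 + t, p.2 + t)) ?_ ?_ ?_ ?_
      · rintro ⟨a, b⟩ h
        simp only [Finset.mem_filter, Finset.mem_product, Finset.mem_range] at h ⊢
        simp only [IsRun, isTurn_suffix ht hturn] at h ⊢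
        obtain ⟨-, h1, h2, h3, h4, h5⟩ := h
        refine ⟨⟨by omega, by omega, by omega, h3, h4, fun u hu1 hu2 hu => ?_⟩, by omega⟩
        exact h5 (u - t) (by omega) (by omega) (by rwa [Nat.sub_add_cancel (by omega)])
      · rintro ⟨a, b⟩ _ ⟨a', b'⟩ _ h
        simp only [Prod.mk.injEq] at h ⊢
        omega
      · rintro ⟨a, b⟩ h
        simp only [Finset.mem_filter, Finset.mem_product, Finset.mem_range] at h
        simp only [IsRun] at h
        obtain ⟨⟨-, h1, h2, h3, h4, h5⟩, h6⟩ := h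
        have hat : t ≤ a := by
          by_contra! hlt
          exact h5 t hlt (by omega) hturn
        refine ⟨(a - t, b - t), ?_, ?_⟩
        · simp only [Finset.mem_filter, Finset.mem_product, Finset.mem_range]
          simp only [IsRun, isTurn_suffix ht hturn, Nat.sub_add_cancel hat,
            Nat.sub_add_cancel (show t ≤ b by omega)]
          refine ⟨by omega, by omega, by omega, h3, h4, fun u hu1 hu2 => ?_⟩
          exact h5 _ (by omega) (by omega)
        · simp only [Prod.mk.injEq]; omega
      · rintro ⟨a, b⟩ h
        simp only
        congr 1
        ext v
        simp only [Finset.mem_image, Finset.mem_Icc]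
        constructor
        · rintro ⟨i, hi, rfl⟩
          exact ⟨i + t, by omega, rfl⟩
        · rintro ⟨i, hi, rfl⟩
          exact ⟨i - t, by omega, by rw [Nat.sub_add_cancel (by omega)]⟩
  have hpeaks : ∑ j ∈ (Finset.range n).filter (fun j => IsPeak n D j), γ j (D (j - 1)) (D (j + 1))
      = ∑ j ∈ (Finset.range (t + 1)).filter (fun j => IsPeak (t + 1) D j),
          γ j (D (j - 1)) (D (j + 1)) +
        ∑ j ∈ (Finset.range (n - t)).filter (fun j => IsPeak (n - t) (fun i => D (i + t)) j),
          γ (j + t) (D (j - 1 + t)) (D (j + 1 + t)) +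
        if IsPeak n D t then γ t (D (t - 1)) (D (t + 1)) else 0 := by
    rw [← Finset.sum_filter_add_sum_filter_not _ (fun j : ℕ => j < t), add_assoc]
    congr 1
    · refine Finset.sum_congr ?_ fun _ _ => rfl
      ext j
      simp only [Finset.mem_filter, Finset.mem_range]
      simp only [IsPeak]
      omega
    · rw [← Finset.sum_filter_add_sum_filter_not _ (fun j : ℕ => j ≠ t)]
      congr 1
      · symm
        refine Finset.sum_bij (fun j _ => j + t) ?_ ?_ ?_ ?_
        · intro j h
          simp only [Finset.mem_filter, Finset.mem_range] at h ⊢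
          simp only [IsPeak] at h ⊢
          obtain ⟨-, h1, h2, h3⟩ := h
          rw [show j - 1 + t = j + t - 1 by omega, show j + 1 + t = j + t + 1 by omega] at h3
          refine ⟨⟨⟨?_, ?_, ?_, h3⟩, ?_⟩, ?_⟩ <;> omega
        · intro a _ b _ h
          omega
        · intro j h
          simp only [Finset.mem_filter, Finset.mem_range] at h
          simp only [IsPeak] at h
          obtain ⟨⟨⟨-, h1, h2, h3⟩, h4⟩, h5⟩ := h
          refine ⟨j - t, ?_, by omega⟩
          simp only [Finset.mem_filter, Finset.mem_range]
          simp only [IsPeak]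
          rw [show j - t - 1 + t = j - 1 by omega, show j - t + 1 + t = j + 1 by omega,
            show j - t + t = j by omega]
          refine ⟨?_, ?_, ?_, h3⟩ <;> omega
        · intro j h
          simp only [Finset.mem_filter, Finset.mem_range] at h
          simp only [IsPeak] at h
          rw [show j - 1 + t = j + t - 1 by omega, show j + 1 + t = j + t + 1 by omega]
      · by_cases hp : IsPeak n D t
        · rw [if_pos hp]
          convert Finset.sum_singleton _ t
          ext j
          simp only [Finset.mem_filter, Finset.mem_range, Finset.mem_singleton, not_not]
          constructor
          · exact fun h => h.2
          · rintro rfl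
            exact ⟨⟨⟨ht, hp⟩, lt_irrefl _⟩, rfl⟩
        · rw [if_neg hp]
          convert Finset.sum_empty
          ext j
          simp only [Finset.mem_filter, Finset.mem_range, Finset.notMem_empty, iff_false, not_and]
          rintro ⟨⟨_, h⟩, _⟩ h3
          rw [not_not] at h3
          exact hp (h3 ▸ h)
  rw [hruns, hpeaks]
  ring

theorem runColor_of_no_turn (C : Finset ℕ → ZMod 2) (γ : ℕ → ℕ → ℕ → ZMod 2) {n : ℕ}
    {D : ℕ → ℕ} (hn : 2 ≤ n) (h : ∀ j, 0 < j → j + 1 < n → ¬ IsTurn n D j) :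
    runColor C γ n D = C ((Finset.range n).image D) := by
  classical
  unfold runColor
  have h1 : (Finset.range n ×ˢ Finset.range n).filter (fun p => IsRun n D p.1 p.2)
      = {(0, n - 1)} := by
    ext ⟨a, b⟩
    simp only [Finset.mem_filter, Finset.mem_product, Finset.mem_range, Finset.mem_singleton, Prod.mk.injEq]
    simp only [IsRun]
    constructor
    · rintro ⟨-, h1, h2, h3, h4, -⟩
      constructor
      · by_contra h5
        exact h a (by omega) (by omega) h3
      · by_contra h5
        exact h b (by omega) (by omega) h4
    · rintro ⟨rfl, rfl⟩
      exact ⟨by omega, by omega, by omega, Or.inl rfl, Or.inr (Or.inl (by omega)),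
        fun t h1 h2 => h t h1 (by omega)⟩
  have h2 : (Finset.range n).filter (fun j => IsPeak n D j) = ∅ := by
    rw [Finset.filter_eq_empty_iff]
    exact fun j _ hj => h j hj.1 hj.2.1 hj.isTurn
  rw [h1, h2, Finset.sum_singleton, Finset.sum_empty, add_zero]
  congr 2
  ext i
  simp only [Finset.mem_Icc, Finset.mem_range]
  omega

theorem runColor_of_peak {C : Finset ℕ → ZMod 2} (γ : ℕ → ℕ → ℕ → ZMod 2) {n : ℕ}
    {D : ℕ → ℕ} (hC : ∀ Y : Finset ℕ, Y.card < n → C Y = 0) {p : ℕ} (hp : IsPeak n D p)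
    (huniq : ∀ j, IsPeak n D j → j = p) :
    runColor C γ n D = γ p (D (p - 1)) (D (p + 1)) := by
  classical
  unfold runColor
  have h2 : (Finset.range n).filter (fun j => IsPeak n D j) = {p} := by
    ext j
    simp only [Finset.mem_filter, Finset.mem_range, Finset.mem_singleton]
    constructor
    · exact fun h => huniq j h.2
    · rintro rfl
      exact ⟨by have := hp.2.1; omega, hp⟩
  rw [h2, Finset.sum_singleton, Finset.sum_eq_zero, zero_add]
  rintro ⟨a, b⟩ h
  simp only [Finset.mem_filter, Finset.mem_product, Finset.mem_range] at h
  simp only [IsRun] at h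
  obtain ⟨-, h3, h4, -, -, h5⟩ := h
  apply hC
  refine Finset.card_image_le.trans_lt ?_
  rw [Nat.card_Icc]
  by_contra h6
  exact h5 p (by have := hp.1; omega) (by have := hp.2.1; omega) hp.isTurn

theorem runColor_bump {C : Finset ℕ → ZMod 2} (γ : ℕ → ℕ → ℕ → ZMod 2) {n s p e : ℕ}
    {D : ℕ → ℕ} (hsp : s < p) (hpe : p < e) (hen : e < n)
    (hC : ∀ Y : Finset ℕ, Y.card < e + 1 - s → C Y = 0)
    (hup : ∀ j, s ≤ j → j < p → D j < D (j + 1)) (hdown : ∀ j, p ≤ j → j < e → D (j + 1) < D j)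
    (hs : 0 < s → D s < D (s - 1)) (he : e + 1 < n → D e < D (e + 1)) :
    runColor C γ n D = runColor C γ (s + 1) D + γ p (D (p - 1)) (D (p + 1))
      + runColor C (fun j => γ (j + e)) (n - e) (fun i => D (i + e)) := by
  have h1 := hup s le_rfl hsp
  have h2 := hdown (e - 1) (by omega) (by omega)
  rw [Nat.sub_add_cancel (by omega)] at h2
  have hte : IsTurn n D e := by
    by_cases h : e + 1 = n
    · exact Or.inr (Or.inl h)
    · have := he (by omega); right; right; omega
  have hts : IsTurn (e + 1) D s := by
    rcases Nat.eq_zero_or_pos s with rfl | h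
    · exact Or.inl rfl
    · have := hs h; right; right; omega
  have hpe' : ¬ IsPeak n D e := fun h => by have := h.2.2.1; omega
  have hps : ¬ IsPeak (e + 1) D s := fun h => by have := h.2.2.2; omega
  rw [runColor_split C γ hen hte, if_neg hpe', runColor_split C γ (by omega) hts, if_neg hps,
    add_zero, add_zero]
  congr 2
  have hpk : IsPeak (e + 1 - s) (fun i => D (i + s)) (p - s) := by
    refine ⟨by omega, by omega, ?_, ?_⟩
    · have := hup (p - 1) (by omega) (by omega)
      rw [Nat.sub_add_cancel (by omega)] at this
      simpa only [show p - s - 1 + s = p - 1 by omega, show p - s + s = p by omega] using this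
    · have := hdown p le_rfl hpe
      simpa only [show p - s + 1 + s = p + 1 by omega, show p - s + s = p by omega] using this
  rw [runColor_of_peak _ hC hpk]
  · simp only [show p - s - 1 + s = p - 1 by omega, show p - s + s = p by omega,
      show p - s + 1 + s = p + 1 by omega]
  · rintro j ⟨hj1, hj2, hj3, hj4⟩
    beta_reduce at hj3 hj4
    by_contra hne
    rcases lt_or_gt_of_ne hne with h | h
    · have := hup (j + s) (by omega) (by omega)
      rw [show j + 1 + s = j + s + 1 by omega] at hj4
      omega
    · have := hdown (j - 1 + s) (by omega) (by omega)
      rw [show j - 1 + s + 1 = j + s by omega] at this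
      omega

/-- `D₀` with the entries at positions `s, …, s + r - 1` replaced by `f 0, …, f (r-1)`. -/
def splice (D₀ : ℕ → ℕ) (s r : ℕ) (f : ℕ → ℕ) (j : ℕ) : ℕ :=
  if s ≤ j ∧ j < s + r then f (j - s) else D₀ j

theorem splice_mid {D₀ : ℕ → ℕ} {s r : ℕ} {f : ℕ → ℕ} {j : ℕ} (h1 : s ≤ j) (h2 : j < s + r) :
    splice D₀ s r f j = f (j - s) := if_pos ⟨h1, h2⟩

theorem splice_left {D₀ : ℕ → ℕ} {s r : ℕ} {f : ℕ → ℕ} {j : ℕ} (h1 : j < s) :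
    splice D₀ s r f j = D₀ j := if_neg (by omega)

theorem splice_right {D₀ : ℕ → ℕ} {s r : ℕ} {f : ℕ → ℕ} {j : ℕ} (h1 : s + r ≤ j) :
    splice D₀ s r f j = D₀ j := if_neg (by omega)

open Classical in
theorem runColor_splice (C : Finset ℕ → ZMod 2) (γ : ℕ → ℕ → ℕ → ZMod 2) {n s r : ℕ}
    (hr : 2 ≤ r) (hn : s + r ≤ n) (D₀ : ℕ → ℕ) (𝓕 : Set (ℕ → ℕ)) (T : Set ℕ)
    (hT : ∀ f ∈ 𝓕, ∀ j < n, (IsTurn n (splice D₀ s r f) j ↔ j ∈ T))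
    (h0 : 0 ∈ T) (hlast : n - 1 ∈ T) (hmid : ∀ j, s < j → j + 1 < s + r → j ∉ T)
    (hps : ∀ f ∈ 𝓕, ¬ IsPeak n (splice D₀ s r f) s)
    (hpe : ∀ f ∈ 𝓕, ¬ IsPeak n (splice D₀ s r f) (s + r - 1)) :
    ∃ a b, a ≤ s ∧ s + r - 1 ≤ b ∧ b < n ∧ (∀ j, a < j → j < b → j ∉ T) ∧
      ∃ A B : ℕ → ZMod 2, ∀ f ∈ 𝓕, runColor C γ n (splice D₀ s r f) =
        C ((Finset.Icc a b).image (splice D₀ s r f)) + A (f 0) + B (f (r - 1)) := by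
  obtain ⟨a, ⟨haT, has⟩, hamax⟩ : ∃ a, (a ∈ T ∧ a ≤ s) ∧ ∀ j, a < j → j ≤ s → j ∉ T := by
    have hne : ((Finset.range (s + 1)).filter (· ∈ T)).Nonempty := ⟨0, by simp [h0]⟩
    have := Finset.max'_mem _ hne
    simp only [Finset.mem_filter, Finset.mem_range] at this
    refine ⟨_, ⟨this.2, by omega⟩, fun j hj hjs hjT => ?_⟩
    exact absurd (Finset.le_max' ((Finset.range (s + 1)).filter (· ∈ T)) j
      (by simp [hjT]; omega)) (by omega)
  obtain ⟨b, ⟨hbT, hbs, hbn⟩, hbmin⟩ : ∃ b, (b ∈ T ∧ s + r - 1 ≤ b ∧ b < n) ∧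
      ∀ j, s + r - 1 ≤ j → j < b → j ∉ T := by
    have hex : ∃ b, b ∈ T ∧ s + r - 1 ≤ b ∧ b < n := ⟨n - 1, hlast, by omega, by omega⟩
    exact ⟨Nat.find hex, Nat.find_spec hex, fun j hj hjb hjT =>
      Nat.find_min hex hjb ⟨hjT, hj, hjb.trans (Nat.find_spec hex).2.2⟩⟩
  have hno : ∀ j, a < j → j < b → j ∉ T := by
    intro j h1 h2
    rcases le_or_gt j s with h | h
    · exact hamax j h1 h
    · rcases le_or_gt (s + r - 1) j with h' | h'
      · exact hbmin j h' h2
      · exact hmid j h (by omega)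
  refine ⟨a, b, has, hbs, hbn, hno,
    fun v => runColor C γ (a + 1) (Function.update D₀ s v) +
      if a < s ∧ IsPeak n (Function.update D₀ s v) a then
        γ a (Function.update D₀ s v (a - 1)) (Function.update D₀ s v (a + 1)) else 0,
    fun v => runColor C (fun j => γ (j + b)) (n - b)
        (fun i => Function.update D₀ (s + r - 1) v (i + b)) +
      if s + r - 1 < b ∧ IsPeak n (Function.update D₀ (s + r - 1) v) b then
        γ b (Function.update D₀ (s + r - 1) v (b - 1)) (Function.update D₀ (s + r - 1) v (b + 1))
      else 0, fun f hf => ?_⟩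
  have hl : ∀ j ≤ s, splice D₀ s r f j = Function.update D₀ s (f 0) j := by
    intro j hj
    rcases hj.eq_or_lt with rfl | h
    · rw [splice_mid le_rfl (by omega), Function.update_self, Nat.sub_self]
    · rw [splice_left h, Function.update_of_ne h.ne]
  have hr' : ∀ j, s + r - 1 ≤ j →
      splice D₀ s r f j = Function.update D₀ (s + r - 1) (f (r - 1)) j := by
    intro j hj
    rcases hj.eq_or_lt with rfl | h
    · rw [splice_mid (by omega) (by omega), Function.update_self]
      congr 1; omega
    · rw [splice_right (by omega), Function.update_of_ne h.ne']
  have htb := (hT f hf b hbn).2 hbT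
  have hta := (isTurn_prefix hbn htb (j := a) (by omega)).2 ((hT f hf a (by omega)).2 haT)
  rw [runColor_split C γ hbn htb, runColor_split C γ (by omega) hta]
  have e1 : runColor C γ (a + 1) (splice D₀ s r f)
      = runColor C γ (a + 1) (Function.update D₀ s (f 0)) :=
    runColor_congr fun j hj => hl j (by omega)
  have e2 : runColor C (fun j => γ (j + b)) (n - b) (fun i => splice D₀ s r f (i + b))
      = runColor C (fun j => γ (j + b)) (n - b)
        (fun i => Function.update D₀ (s + r - 1) (f (r - 1)) (i + b)) :=
    runColor_congr fun j hj => hr' _ (by omega)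
  have e3 : runColor C (fun j => γ (j + a)) (b + 1 - a) (fun i => splice D₀ s r f (i + a))
      = C ((Finset.Icc a b).image (splice D₀ s r f)) := by
    rw [runColor_of_no_turn _ _ (by omega)]
    · congr 1
      ext v
      simp only [Finset.mem_image, Finset.mem_range, Finset.mem_Icc]
      constructor
      · rintro ⟨i, hi, rfl⟩
        exact ⟨i + a, by omega, rfl⟩
      · rintro ⟨i, hi, rfl⟩
        exact ⟨i - a, by omega, by rw [Nat.sub_add_cancel (by omega)]⟩
    · intro j hj1 hj2
      rw [isTurn_suffix (by omega) hta, isTurn_prefix hbn htb (by omega),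
        hT f hf _ (by omega)]
      exact hno _ (by omega) (by omega)
  have e4 : (if IsPeak (b + 1) (splice D₀ s r f) a then
      γ a (splice D₀ s r f (a - 1)) (splice D₀ s r f (a + 1)) else 0) =
      if a < s ∧ IsPeak n (Function.update D₀ s (f 0)) a then
        γ a (Function.update D₀ s (f 0) (a - 1)) (Function.update D₀ s (f 0) (a + 1)) else 0 := by
    rcases has.eq_or_lt with rfl | h
    · rw [if_neg, if_neg (by omega)]
      exact fun h => hps f hf ⟨h.1, by omega, h.2.2⟩
    · have : IsPeak (b + 1) (splice D₀ s r f) a ↔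
          (a < s ∧ IsPeak n (Function.update D₀ s (f 0)) a) := by
        unfold IsPeak
        rw [hl _ (show a - 1 ≤ s by omega), hl _ (show a ≤ s by omega),
          hl _ (show a + 1 ≤ s by omega)]
        omega
      rw [hl _ (show a - 1 ≤ s by omega), hl _ (show a + 1 ≤ s by omega)]
      exact if_congr this rfl rfl
  have e5 : (if IsPeak n (splice D₀ s r f) b then
      γ b (splice D₀ s r f (b - 1)) (splice D₀ s r f (b + 1)) else 0) =
      if s + r - 1 < b ∧ IsPeak n (Function.update D₀ (s + r - 1) (f (r - 1))) b then
        γ b (Function.update D₀ (s + r - 1) (f (r - 1)) (b - 1))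
          (Function.update D₀ (s + r - 1) (f (r - 1)) (b + 1)) else 0 := by
    rcases hbs.eq_or_lt with rfl | h
    · rw [if_neg (hpe f hf), if_neg (by omega)]
    · have : IsPeak n (splice D₀ s r f) b ↔
          (s + r - 1 < b ∧ IsPeak n (Function.update D₀ (s + r - 1) (f (r - 1))) b) := by
        unfold IsPeak
        rw [hr' _ (show s + r - 1 ≤ b - 1 by omega), hr' _ (show s + r - 1 ≤ b by omega),
          hr' _ (show s + r - 1 ≤ b + 1 by omega)]
        omega
      rw [hr' _ (show s + r - 1 ≤ b - 1 by omega), hr' _ (show s + r - 1 ≤ b + 1 by omega)]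
      exact if_congr this rfl rfl
  rw [e1, e2, e3, e4, e5]
  ring

theorem isTurn_iff_of_cmp {n : ℕ} {D D' : ℕ → ℕ}
    (h : ∀ j, j + 1 < n → ((D j < D (j + 1) ↔ D' j < D' (j + 1)) ∧
      (D (j + 1) < D j ↔ D' (j + 1) < D' j))) {j : ℕ} (hj : j < n) :
    IsTurn n D j ↔ IsTurn n D' j := by
  unfold IsTurn
  by_cases h1 : j = 0
  · simp [h1]
  · by_cases h2 : j + 1 = n
    · simp [h2]
    · have h3 := h (j - 1) (by omega)
      have h4 := h j (by omega)
      rw [Nat.sub_add_cancel (by omega)] at h3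
      rw [h3.1, h3.2, h4.1, h4.2]

theorem strictAntiOn_of_no_turn {n a b c : ℕ} {D : ℕ → ℕ}
    (h : ∀ j, a < j → j < b → ¬ IsTurn n D j) (hac : a ≤ c) (hcb : c < b) (hc : D (c + 1) < D c) :
    StrictAntiOn D (Set.Icc a b) := by
  have hup : ∀ j, c ≤ j → j < b → D (j + 1) < D j := by
    intro j hcj
    induction j, hcj using Nat.le_induction with
    | base => exact fun _ => hc
    | succ j hj ih =>
      intro hjb
      have := ih (by omega)
      by_contra h'
      apply h (j + 1) (by omega) hjb
      right; right
      rw [Nat.add_sub_cancel]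
      omega
  have hdown : ∀ d, d ≤ c - a → D (c - d + 1) < D (c - d) := by
    intro d
    induction d with
    | zero => exact fun _ => hc
    | succ d ih =>
      intro hd
      have := ih (by omega)
      by_contra h'
      apply h (c - d) (by omega) (by omega)
      right; right
      rw [show c - (d + 1) + 1 = c - d by omega] at h'
      rw [show c - d - 1 = c - (d + 1) by omega]
      omega
  have hall : ∀ j, a ≤ j → j < b → D (j + 1) < D j := by
    intro j hja hjb
    rcases le_total c j with hj | hj
    · exact hup j hj hjb
    · have := hdown (c - j) (by omega)
      rwa [show c - (c - j) = j by omega] at this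
  intro i hi j hj hij
  have key : ∀ j, i + 1 ≤ j → j ≤ b → D j < D i := by
    intro j hj
    induction j, hj using Nat.le_induction with
    | base => exact fun h => hall i hi.1 h
    | succ j hj ih =>
      intro hjb
      exact (hall j (by have := hi.1; omega) hjb).trans (ih (by omega))
  exact key j hij hj.2

theorem strictMonoOn_of_no_turn {n a b c : ℕ} {D : ℕ → ℕ}
    (h : ∀ j, a < j → j < b → ¬ IsTurn n D j) (hac : a ≤ c) (hcb : c < b) (hc : D c < D (c + 1)) :
    StrictMonoOn D (Set.Icc a b) := by
  have hup : ∀ j, c ≤ j → j < b → D j < D (j + 1) := by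
    intro j hcj
    induction j, hcj using Nat.le_induction with
    | base => exact fun _ => hc
    | succ j hj ih =>
      intro hjb
      have := ih (by omega)
      by_contra h'
      apply h (j + 1) (by omega) hjb
      right; right
      rw [Nat.add_sub_cancel]
      omega
  have hdown : ∀ d, d ≤ c - a → D (c - d) < D (c - d + 1) := by
    intro d
    induction d with
    | zero => exact fun _ => hc
    | succ d ih =>
      intro hd
      have := ih (by omega)
      by_contra h'
      apply h (c - d) (by omega) (by omega)
      right; right
      rw [show c - (d + 1) + 1 = c - d by omega] at h'
      rw [show c - d - 1 = c - (d + 1) by omega]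
      omega
  have hall : ∀ j, a ≤ j → j < b → D j < D (j + 1) := by
    intro j hja hjb
    rcases le_total c j with hj | hj
    · exact hup j hj hjb
    · have := hdown (c - j) (by omega)
      rwa [show c - (c - j) = j by omega] at this
  intro i hi j hj hij
  have key : ∀ j, i + 1 ≤ j → j ≤ b → D i < D j := by
    intro j hj
    induction j, hj using Nat.le_induction with
    | base => exact fun h => hall i hi.1 h
    | succ j hj ih =>
      intro hjb
      exact (ih (by omega)).trans (hall j (by have := hi.1; omega) hjb)
  exact key j hij hj.2

theorem image_splice {D₀ : ℕ → ℕ} {s r a b : ℕ} {f : ℕ → ℕ} (has : a ≤ s) (hb : s + r ≤ b + 1) :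
    (Finset.Icc a b).image (splice D₀ s r f) =
      (Finset.Ico a s).image D₀ ∪ (Finset.range r).image f ∪ (Finset.Icc (s + r) b).image D₀ := by
  ext v
  simp only [Finset.mem_image, Finset.mem_union, Finset.mem_Icc, Finset.mem_Ico, Finset.mem_range]
  constructor
  · rintro ⟨i, hi, rfl⟩
    rcases lt_or_ge i s with h | h
    · exact Or.inl (Or.inl ⟨i, by omega, (splice_left h).symm⟩)
    · rcases lt_or_ge i (s + r) with h' | h'
      · exact Or.inl (Or.inr ⟨i - s, by omega, (splice_mid h h').symm⟩)
      · exact Or.inr ⟨i, by omega, (splice_right h').symm⟩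
  · rintro ((⟨i, hi, rfl⟩ | ⟨i, hi, rfl⟩) | ⟨i, hi, rfl⟩)
    · exact ⟨i, by omega, splice_left (by omega)⟩
    · refine ⟨i + s, by omega, ?_⟩
      rw [splice_mid (by omega) (by omega), Nat.add_sub_cancel]
    · exact ⟨i, by omega, splice_right (by omega)⟩

/-- Behaviour of `runColor` when a decreasing block runs over a family of decreasing blocks. -/
theorem runColor_dec (C : Finset ℕ → ZMod 2) (γ : ℕ → ℕ → ℕ → ZMod 2) {n s r : ℕ}
    (hr : 2 ≤ r) (hn : s + r ≤ n) (D₀ : ℕ → ℕ) (Z : Set ℕ)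
    (hleft : 0 < s → ∀ z ∈ Z, z < D₀ (s - 1))
    (hright : s + r < n → (∀ z ∈ Z, D₀ (s + r) < z) ∨ (∀ z ∈ Z, z < D₀ (s + r))) :
    ∃ (Lo Hi : Finset ℕ) (A B : ℕ → ZMod 2),
      (∀ a ∈ Lo, ∀ z ∈ Z, a < z) ∧ (∀ b ∈ Hi, ∀ z ∈ Z, z < b) ∧ Lo.card + Hi.card ≤ n - r ∧
      Lo ∪ Hi ⊆ (Finset.range n).image D₀ ∧
      ∀ f, StrictAntiOn f (Set.Iio r) → (∀ j < r, f j ∈ Z) →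
        runColor C γ n (splice D₀ s r f) =
          C (Lo ∪ (Finset.range r).image f ∪ Hi) + A (f 0) + B (f (r - 1)) := by
  by_cases hex : ∃ f₀, StrictAntiOn f₀ (Set.Iio r) ∧ ∀ j < r, f₀ j ∈ Z
  swap
  · exact ⟨∅, ∅, 0, 0, by simp, by simp, by simp, by simp, fun f h1 h2 => absurd ⟨f, h1, h2⟩ hex⟩
  obtain ⟨f₀, hf₀, hf₀Z⟩ := hex
  have hstep : ∀ f : ℕ → ℕ, StrictAntiOn f (Set.Iio r) → ∀ j, s ≤ j → j + 1 < s + r →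
      splice D₀ s r f (j + 1) < splice D₀ s r f j := by
    intro f hf j h1 h2
    rw [splice_mid h1 (by omega), splice_mid (by omega) h2]
    exact hf (Set.mem_Iio.2 (by omega)) (Set.mem_Iio.2 (by omega)) (by omega)
  have hstepl : ∀ f : ℕ → ℕ, (∀ j < r, f j ∈ Z) → 0 < s →
      splice D₀ s r f s < splice D₀ s r f (s - 1) := by
    intro f hf h
    rw [splice_mid le_rfl (by omega), splice_left (by omega)]
    exact hleft h _ (hf _ (by omega))
  have hT : ∀ f ∈ {f : ℕ → ℕ | StrictAntiOn f (Set.Iio r) ∧ ∀ j < r, f j ∈ Z}, ∀ j < n,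
      (IsTurn n (splice D₀ s r f) j ↔ j ∈ {j | IsTurn n (splice D₀ s r f₀) j}) := by
    rintro f ⟨hf, hfZ⟩ j hj
    refine isTurn_iff_of_cmp (fun j hj => ?_) hj
    have cmp : ∀ {u v u' v' : ℕ}, v < u → v' < u' → (u < v ↔ u' < v') ∧ (v < u ↔ v' < u') := by
      intros; omega
    rcases lt_or_ge (j + 1) s with h | h
    · simp only [splice_left (show j < s by omega), splice_left h, and_self]
    · rcases h.eq_or_lt with h | h
      · have e1 := hstepl f hfZ (by omega)
        have e2 := hstepl f₀ hf₀Z (by omega)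
        obtain rfl : j = s - 1 := by omega
        rw [Nat.sub_add_cancel (by omega)]
        exact cmp e1 e2
      · rcases lt_or_ge (j + 1) (s + r) with h' | h'
        · exact cmp (hstep f hf j (by omega) h') (hstep f₀ hf₀ j (by omega) h')
        · rcases h'.eq_or_lt with h' | h'
          · rw [← h', splice_right le_rfl, splice_right le_rfl, splice_mid (by omega) (by omega),
              splice_mid (by omega) (by omega)]
            have z1 := hfZ (j - s) (by omega)
            have z2 := hf₀Z (j - s) (by omega)
            rcases hright (by omega) with h | h
            · have := h _ z1; have := h _ z2; omega
            · have := h _ z1; have := h _ z2; omega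
          · simp only [splice_right (show s + r ≤ j by omega),
              splice_right (show s + r ≤ j + 1 by omega), and_self]
  have hmid : ∀ j, s < j → j + 1 < s + r → j ∉ {j | IsTurn n (splice D₀ s r f₀) j} := by
    intro j h1 h2 h3
    have e1 := hstep f₀ hf₀ j (by omega) h2
    have e2 := hstep f₀ hf₀ (j - 1) (by omega) (by omega)
    rw [Nat.sub_add_cancel (by omega)] at e2
    rcases h3 with h3 | h3 | h3 <;> omega
  have hps : ∀ f ∈ {f : ℕ → ℕ | StrictAntiOn f (Set.Iio r) ∧ ∀ j < r, f j ∈ Z},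
      ¬ IsPeak n (splice D₀ s r f) s := by
    rintro f ⟨hf, hfZ⟩ ⟨h1, -, h2, -⟩
    have := hstepl f hfZ h1
    omega
  have hpe : ∀ f ∈ {f : ℕ → ℕ | StrictAntiOn f (Set.Iio r) ∧ ∀ j < r, f j ∈ Z},
      ¬ IsPeak n (splice D₀ s r f) (s + r - 1) := by
    rintro f ⟨hf, hfZ⟩ ⟨h1, -, h2, -⟩
    have := hstep f hf (s + r - 2) (by omega) (by omega)
    rw [show s + r - 2 + 1 = s + r - 1 by omega] at this
    rw [show s + r - 1 - 1 = s + r - 2 by omega] at h2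
    omega
  obtain ⟨a, b, has, hbs, hbn, hno, A, B, hF⟩ := runColor_splice C γ hr hn D₀ _ _ hT
    (Or.inl rfl) (Or.inr (Or.inl (by omega))) hmid hps hpe
  have hanti := strictAntiOn_of_no_turn hno has (by omega) (hstep f₀ hf₀ s le_rfl (by omega))
  refine ⟨(Finset.Icc (s + r) b).image D₀, (Finset.Ico a s).image D₀, A, B, ?_, ?_, ?_, ?_, ?_⟩
  · simp only [Finset.mem_image, Finset.mem_Icc]
    rintro _ ⟨i, hi, rfl⟩ z hz
    have h1 : D₀ (s + r) < f₀ (r - 1) := by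
      have := hanti (a := s + r - 1) (b := s + r) ⟨by omega, by omega⟩ ⟨by omega, by omega⟩
        (by omega)
      rwa [splice_right le_rfl, splice_mid (by omega) (by omega),
        show s + r - 1 - s = r - 1 by omega] at this
    have h2 : D₀ (s + r) < z := by
      rcases hright (by omega) with h | h
      · exact h z hz
      · exact absurd (h _ (hf₀Z (r - 1) (by omega))) (by omega)
    have h3 := hanti.antitoneOn (a := s + r) (b := i) ⟨by omega, by omega⟩ ⟨by omega, by omega⟩
      (by omega)
    rw [splice_right (by omega), splice_right (by omega)] at h3
    omega
  · simp only [Finset.mem_image, Finset.mem_Ico]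
    rintro _ ⟨i, hi, rfl⟩ z hz
    have h2 := hleft (by omega) z hz
    have h3 := hanti.antitoneOn (a := i) (b := s - 1) ⟨by omega, by omega⟩ ⟨by omega, by omega⟩
      (by omega)
    rw [splice_left (by omega), splice_left (by omega)] at h3
    omega
  · have h1 := Finset.card_image_le (s := Finset.Icc (s + r) b) (f := D₀)
    have h2 := Finset.card_image_le (s := Finset.Ico a s) (f := D₀)
    rw [Nat.card_Icc] at h1
    rw [Nat.card_Ico] at h2
    omega
  · rw [← Finset.image_union]
    apply Finset.image_subset_image
    intro i
    simp only [Finset.mem_union, Finset.mem_Icc, Finset.mem_Ico, Finset.mem_range]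
    omega
  · intro f h1 h2
    rw [hF f ⟨h1, h2⟩, image_splice has (by omega)]
    congr 3
    ext v
    simp only [Finset.mem_union]
    tauto

/-- Behaviour of `runColor` when an increasing block runs over a family of increasing blocks. -/
theorem runColor_inc (C : Finset ℕ → ZMod 2) (γ : ℕ → ℕ → ℕ → ZMod 2) {n s r : ℕ}
    (hr : 2 ≤ r) (hn : s + r ≤ n) (D₀ : ℕ → ℕ) (Z : Set ℕ)
    (hright : s + r < n → ∀ z ∈ Z, z < D₀ (s + r))
    (hleft : 0 < s → (∀ z ∈ Z, D₀ (s - 1) < z) ∨ (∀ z ∈ Z, z < D₀ (s - 1))) :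
    ∃ (Lo Hi : Finset ℕ) (A B : ℕ → ZMod 2),
      (∀ a ∈ Lo, ∀ z ∈ Z, a < z) ∧ (∀ b ∈ Hi, ∀ z ∈ Z, z < b) ∧ Lo.card + Hi.card ≤ n - r ∧
      Lo ∪ Hi ⊆ (Finset.range n).image D₀ ∧
      ∀ f, StrictMonoOn f (Set.Iio r) → (∀ j < r, f j ∈ Z) →
        runColor C γ n (splice D₀ s r f) =
          C (Lo ∪ (Finset.range r).image f ∪ Hi) + A (f 0) + B (f (r - 1)) := by
  by_cases hex : ∃ f₀, StrictMonoOn f₀ (Set.Iio r) ∧ ∀ j < r, f₀ j ∈ Z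
  swap
  · exact ⟨∅, ∅, 0, 0, by simp, by simp, by simp, by simp, fun f h1 h2 => absurd ⟨f, h1, h2⟩ hex⟩
  obtain ⟨f₀, hf₀, hf₀Z⟩ := hex
  have hstep : ∀ f : ℕ → ℕ, StrictMonoOn f (Set.Iio r) → ∀ j, s ≤ j → j + 1 < s + r →
      splice D₀ s r f j < splice D₀ s r f (j + 1) := by
    intro f hf j h1 h2
    rw [splice_mid h1 (by omega), splice_mid (by omega) h2]
    exact hf (Set.mem_Iio.2 (by omega)) (Set.mem_Iio.2 (by omega)) (by omega)
  have hstepr : ∀ f : ℕ → ℕ, (∀ j < r, f j ∈ Z) → s + r < n →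
      splice D₀ s r f (s + r - 1) < splice D₀ s r f (s + r) := by
    intro f hf h
    rw [splice_mid (by omega) (by omega), splice_right le_rfl]
    exact hright h _ (hf _ (by omega))
  have hT : ∀ f ∈ {f : ℕ → ℕ | StrictMonoOn f (Set.Iio r) ∧ ∀ j < r, f j ∈ Z}, ∀ j < n,
      (IsTurn n (splice D₀ s r f) j ↔ j ∈ {j | IsTurn n (splice D₀ s r f₀) j}) := by
    rintro f ⟨hf, hfZ⟩ j hj
    refine isTurn_iff_of_cmp (fun j hj => ?_) hj
    have cmp : ∀ {u v u' v' : ℕ}, u < v → u' < v' → (u < v ↔ u' < v') ∧ (v < u ↔ v' < u') := by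
      intros; omega
    rcases lt_or_ge (j + 1) s with h | h
    · simp only [splice_left (show j < s by omega), splice_left h, and_self]
    · rcases h.eq_or_lt with h | h
      · obtain rfl : j = s - 1 := by omega
        rw [Nat.sub_add_cancel (by omega)]
        simp only [splice_left (show s - 1 < s by omega), splice_mid le_rfl (show s < s + r by omega)]
        have z1 := hfZ (s - s) (by omega)
        have z2 := hf₀Z (s - s) (by omega)
        rcases hleft (by omega) with h | h
        · have := h _ z1; have := h _ z2; omega
        · have := h _ z1; have := h _ z2; omega
      · rcases lt_or_ge (j + 1) (s + r) with h' | h'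
        · exact cmp (hstep f hf j (by omega) h') (hstep f₀ hf₀ j (by omega) h')
        · rcases h'.eq_or_lt with h' | h'
          · obtain rfl : j = s + r - 1 := by omega
            rw [← h']
            exact cmp (hstepr f hfZ (by omega)) (hstepr f₀ hf₀Z (by omega))
          · simp only [splice_right (show s + r ≤ j by omega),
              splice_right (show s + r ≤ j + 1 by omega), and_self]
  have hmid : ∀ j, s < j → j + 1 < s + r → j ∉ {j | IsTurn n (splice D₀ s r f₀) j} := by
    intro j h1 h2 h3
    have e1 := hstep f₀ hf₀ j (by omega) h2
    have e2 := hstep f₀ hf₀ (j - 1) (by omega) (by omega)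
    rw [Nat.sub_add_cancel (by omega)] at e2
    rcases h3 with h3 | h3 | h3 <;> omega
  have hps : ∀ f ∈ {f : ℕ → ℕ | StrictMonoOn f (Set.Iio r) ∧ ∀ j < r, f j ∈ Z},
      ¬ IsPeak n (splice D₀ s r f) s := by
    rintro f ⟨hf, hfZ⟩ ⟨h1, -, -, h2⟩
    have := hstep f hf s le_rfl (by omega)
    omega
  have hpe : ∀ f ∈ {f : ℕ → ℕ | StrictMonoOn f (Set.Iio r) ∧ ∀ j < r, f j ∈ Z},
      ¬ IsPeak n (splice D₀ s r f) (s + r - 1) := by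
    rintro f ⟨hf, hfZ⟩ ⟨h1, h3, -, h2⟩
    rw [Nat.sub_add_cancel (by omega)] at h2 h3
    have := hstepr f hfZ h3
    omega
  obtain ⟨a, b, has, hbs, hbn, hno, A, B, hF⟩ := runColor_splice C γ hr hn D₀ _ _ hT
    (Or.inl rfl) (Or.inr (Or.inl (by omega))) hmid hps hpe
  have hmono := strictMonoOn_of_no_turn hno has (by omega) (hstep f₀ hf₀ s le_rfl (by omega))
  refine ⟨(Finset.Ico a s).image D₀, (Finset.Icc (s + r) b).image D₀, A, B, ?_, ?_, ?_, ?_, ?_⟩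
  · simp only [Finset.mem_image, Finset.mem_Ico]
    rintro _ ⟨i, hi, rfl⟩ z hz
    have h1 : D₀ (s - 1) < f₀ 0 := by
      have := hmono (a := s - 1) (b := s) ⟨by omega, by omega⟩ ⟨by omega, by omega⟩ (by omega)
      rwa [splice_left (by omega), splice_mid le_rfl (by omega), Nat.sub_self] at this
    have h2 : D₀ (s - 1) < z := by
      rcases hleft (by omega) with h | h
      · exact h z hz
      · exact absurd (h _ (hf₀Z 0 (by omega))) (by omega)
    have h3 := hmono.monotoneOn (a := i) (b := s - 1) ⟨by omega, by omega⟩ ⟨by omega, by omega⟩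
      (by omega)
    rw [splice_left (by omega), splice_left (by omega)] at h3
    omega
  · simp only [Finset.mem_image, Finset.mem_Icc]
    rintro _ ⟨i, hi, rfl⟩ z hz
    have h2 := hright (by omega) z hz
    have h3 := hmono.monotoneOn (a := s + r) (b := i) ⟨by omega, by omega⟩ ⟨by omega, by omega⟩
      (by omega)
    rw [splice_right (by omega), splice_right (by omega)] at h3
    omega
  · have h1 := Finset.card_image_le (s := Finset.Icc (s + r) b) (f := D₀)
    have h2 := Finset.card_image_le (s := Finset.Ico a s) (f := D₀)
    rw [Nat.card_Icc] at h1
    rw [Nat.card_Ico] at h2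
    omega
  · rw [← Finset.image_union]
    apply Finset.image_subset_image
    intro i
    simp only [Finset.mem_union, Finset.mem_Icc, Finset.mem_Ico, Finset.mem_range]
    omega
  · intro f h1 h2
    rw [hF f ⟨h1, h2⟩, image_splice has (by omega)]

/-- The stepping-up coloring of `C`: color a set by the levels between consecutive elements. -/
noncomputable def stepColor (C : Finset ℕ → ZMod 2) (γ : ℕ → ℕ → ℕ → ZMod 2) (r : ℕ)
    (X : Finset ℕ) : ZMod 2 :=
  if X.card < r + 1 then 0
  else runColor C γ (X.card - 1) fun j => lev (enumNat X j) (enumNat X (j + 1))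

/-- The increasing list of `L`, then `x (φ 0), …, x (φ (p-1))`, then `R`. -/
noncomputable def joined (L R : Finset ℕ) (x : ℕ → ℕ) (p : ℕ) (φ : ℕ → ℕ) : ℕ → ℕ :=
  splice (fun j => if j < L.card then enumNat L j else enumNat R (j - (L.card + p))) L.card p (x ∘ φ)

theorem joined_left {L R : Finset ℕ} {x : ℕ → ℕ} {p : ℕ} {φ : ℕ → ℕ} {j : ℕ} (h : j < L.card) :
    joined L R x p φ j = enumNat L j := by
  rw [joined, splice_left h, if_pos h]

theorem joined_mid {L R : Finset ℕ} {x : ℕ → ℕ} {p : ℕ} {φ : ℕ → ℕ} {j : ℕ} (h : L.card ≤ j)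
    (h' : j < L.card + p) : joined L R x p φ j = x (φ (j - L.card)) := by
  rw [joined, splice_mid h h']; rfl

theorem joined_right {L R : Finset ℕ} {x : ℕ → ℕ} {p : ℕ} {φ : ℕ → ℕ} {j : ℕ}
    (h : L.card + p ≤ j) : joined L R x p φ j = enumNat R (j - (L.card + p)) := by
  rw [joined, splice_right h, if_neg (by omega)]

/-- The levels between consecutive points of `joined`. -/
noncomputable def jlev (L R : Finset ℕ) (x : ℕ → ℕ) (p : ℕ) (φ : ℕ → ℕ) (j : ℕ) : ℕ :=
  lev (joined L R x p φ j) (joined L R x p φ (j + 1))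

namespace IsSimpleKernel

variable {m k N : ℕ} {L R : Finset ℕ} {x : ℕ → ℕ}

theorem strictMonoOn_joined (h : IsSimpleKernel m k N L R x) {p : ℕ} {φ : ℕ → ℕ}
    (hφ : IsSel p m φ) :
    StrictMonoOn (joined L R x p φ) (Set.Iio (L.card + p + R.card)) := by
  intro i hi j hj hij
  rw [Set.mem_Iio] at hi hj
  rcases lt_or_ge i L.card with h1 | h1
  · rw [joined_left h1]
    rcases lt_or_ge j L.card with h2 | h2
    · rw [joined_left h2]
      exact strictMonoOn_enumNat L h1 h2 hij
    · rcases lt_or_ge j (L.card + p) with h3 | h3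
      · rw [joined_mid h2 h3]
        exact h.left_lt _ (enumNat_mem h1) _ (hφ.2 _ (by omega))
      · rw [joined_right h3]
        exact h.left_lt_right _ (enumNat_mem h1) _ (enumNat_mem (by omega))
  · rcases lt_or_ge i (L.card + p) with h2 | h2
    · rw [joined_mid h1 h2]
      rcases lt_or_ge j (L.card + p) with h3 | h3
      · rw [joined_mid (by omega) h3]
        exact h.strictMonoOn (hφ.2 _ (by omega)) (hφ.2 _ (by omega))
          (hφ.1 (Set.mem_Iio.2 (by omega)) (Set.mem_Iio.2 (by omega)) (by omega))
      · rw [joined_right h3]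
        exact h.lt_right _ (enumNat_mem (by omega)) _ (hφ.2 _ (by omega))
    · rw [joined_right h2, joined_right (by omega)]
      exact strictMonoOn_enumNat R (Set.mem_Iio.2 (by omega)) (Set.mem_Iio.2 (by omega)) (by omega)

theorem joined_lt (h : IsSimpleKernel m k N L R x) {p : ℕ} {φ : ℕ → ℕ}
    (hφ : IsSel p m φ) {j : ℕ} (hj : j < L.card + p + R.card) : joined L R x p φ j < N := by
  rcases lt_or_ge j L.card with h2 | h2
  · rw [joined_left h2]
    exact h.left_bound _ (enumNat_mem h2)
  · rcases lt_or_ge j (L.card + p) with h3 | h3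
    · rw [joined_mid h2 h3]
      exact h.lt_bound _ (hφ.2 _ (by omega))
    · rw [joined_right h3]
      exact h.right_bound _ (enumNat_mem (by omega))

theorem jlev_lt (h : IsSimpleKernel m k (2 ^ N) L R x) (hN : 0 < N) {p : ℕ} {φ : ℕ → ℕ}
    (hφ : IsSel p m φ) {j : ℕ} (hj : j + 1 < L.card + p + R.card) : jlev L R x p φ j < N :=
  lev_lt hN (h.joined_lt hφ (by omega)) (h.joined_lt hφ hj)

theorem comp_sel (h : IsSimpleKernel m k N L R x) {q : ℕ} {w : ℕ → ℕ} (hw : IsSel q m w) :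
    IsSimpleKernel q k N L R (x ∘ w) where
  card_le := h.card_le
  strictMonoOn := h.strictMonoOn.comp hw.1 fun i hi => hw.2 i hi
  lt_bound i hi := h.lt_bound _ (hw.2 i hi)
  left_lt a ha i hi := h.left_lt a ha _ (hw.2 i hi)
  lt_right a ha i hi := h.lt_right a ha _ (hw.2 i hi)
  left_lt_right := h.left_lt_right
  left_bound := h.left_bound
  right_bound := h.right_bound

end IsSimpleKernel

theorem image_joined (L R : Finset ℕ) (x : ℕ → ℕ) (p : ℕ) (φ : ℕ → ℕ) :
    (Finset.range (L.card + p + R.card)).image (joined L R x p φ) =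
      L ∪ (Finset.range p).image (x ∘ φ) ∪ R := by
  conv_rhs => rw [← image_enumNat L, ← image_enumNat R]
  ext v
  simp only [Finset.mem_image, Finset.mem_union, Finset.mem_range, Function.comp]
  constructor
  · rintro ⟨j, hj, rfl⟩
    rcases lt_or_ge j L.card with h2 | h2
    · exact Or.inl (Or.inl ⟨j, h2, (joined_left h2).symm⟩)
    · rcases lt_or_ge j (L.card + p) with h3 | h3
      · exact Or.inl (Or.inr ⟨j - L.card, by omega, (joined_mid h2 h3).symm⟩)
      · exact Or.inr ⟨j - (L.card + p), by omega, (joined_right h3).symm⟩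
  · rintro ((⟨j, hj, rfl⟩ | ⟨j, hj, rfl⟩) | ⟨j, hj, rfl⟩)
    · exact ⟨j, by omega, joined_left hj⟩
    · refine ⟨j + L.card, by omega, ?_⟩
      rw [joined_mid (by omega) (by omega), Nat.add_sub_cancel]
    · refine ⟨j + (L.card + p), by omega, ?_⟩
      rw [joined_right (by omega), Nat.add_sub_cancel]

theorem IsSimpleKernel.stepColor_eq {m k N : ℕ} {L R : Finset ℕ} {x : ℕ → ℕ}
    (h : IsSimpleKernel m k N L R x) (C : Finset ℕ → ZMod 2) (γ : ℕ → ℕ → ℕ → ZMod 2) {r : ℕ}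
    {φ : ℕ → ℕ} (hφ : IsSel (r + 1) m φ) :
    stepColor C γ r (L ∪ (Finset.range (r + 1)).image (x ∘ φ) ∪ R) =
      runColor C γ (L.card + r + R.card) (jlev L R x (r + 1) φ) := by
  have hm := h.strictMonoOn_joined hφ
  rw [← image_joined, stepColor, card_image_of_strictMonoOn hm, if_neg (by omega),
    show L.card + (r + 1) + R.card - 1 = L.card + r + R.card by omega]
  refine runColor_congr fun j hj => ?_
  rw [enumNat_image hm (by omega), enumNat_image hm (by omega)]
  rfl

/-- The coloring `c` on the simple daisy `(L, R, x)` splits as `A (min) + B (max)`. -/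
structure IsBad (c : Finset ℕ → ZMod 2) (r m k N : ℕ) (L R : Finset ℕ) (x : ℕ → ℕ)
    (A B : ℕ → ZMod 2) : Prop extends IsSimpleKernel m k N L R x where
  eq_add : ∀ φ, IsSel r m φ →
    c (L ∪ (Finset.range r).image (x ∘ φ) ∪ R) = A (φ 0) + B (φ (r - 1))

theorem IsSel.comp {p q m : ℕ} {w φ : ℕ → ℕ} (hw : IsSel q m w) (hφ : IsSel p q φ) :
    IsSel p m (w ∘ φ) :=
  ⟨hw.1.comp hφ.1 fun i hi => hφ.2 i hi, fun i hi => hw.2 _ (hφ.2 i hi)⟩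

theorem IsBad.comp_sel {c : Finset ℕ → ZMod 2} {r m k N : ℕ} {L R : Finset ℕ} {x : ℕ → ℕ}
    {A B : ℕ → ZMod 2} (h : IsBad c r m k N L R x A B) {q : ℕ} {w : ℕ → ℕ} (hw : IsSel q m w) :
    IsBad c r q k N L R (x ∘ w) (A ∘ w) (B ∘ w) where
  toIsSimpleKernel := h.toIsSimpleKernel.comp_sel hw
  eq_add _ hφ := h.eq_add _ (hw.comp hφ)

theorem isDaisyGood_of_forall_not_isBad {c : Finset ℕ → ZMod 2} {r m k N : ℕ}
    (h : ∀ L R x A B, ¬ IsBad c r m k N L R x A B) : IsDaisyGood c r m k N := by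
  intro L R x hx A B
  by_contra! hcon
  exact h L R x A B ⟨hx, hcon⟩

theorem lev_mono_seq {x : ℕ → ℕ} {m : ℕ} (hx : StrictMonoOn x (Set.Iio m)) {a b a' b' : ℕ}
    (h1 : a ≤ a') (h2 : a' ≤ b') (h3 : b' ≤ b) (h4 : b < m) :
    lev (x a') (x b') ≤ lev (x a) (x b) := by
  have hm := hx.monotoneOn
  have e1 : x a ≤ x a' := hm (Set.mem_Iio.2 (by omega)) (Set.mem_Iio.2 (by omega)) h1
  have e2 : x a' ≤ x b' := hm (Set.mem_Iio.2 (by omega)) (Set.mem_Iio.2 (by omega)) h2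
  have e3 : x b' ≤ x b := hm (Set.mem_Iio.2 (by omega)) (Set.mem_Iio.2 (by omega)) h3
  rw [lev_eq_max e1 (e2.trans e3), lev_eq_max e2 e3]
  omega

theorem exists_lev_eq {x : ℕ → ℕ} {m : ℕ} (hx : StrictMonoOn x (Set.Iio m)) {a b : ℕ}
    (hab : a < b) (hb : b < m) : ∃ i, a ≤ i ∧ i < b ∧ lev (x a) (x b) = lev (x i) (x (i + 1)) := by
  induction b, hab using Nat.le_induction with
  | base => exact ⟨a, le_rfl, by omega, rfl⟩
  | succ b hab ih =>
    obtain ⟨i, h1, h2, h3⟩ := ih (by omega)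
    have hm := hx.monotoneOn
    rw [lev_eq_max (hm (a := a) (b := b) (Set.mem_Iio.2 (by omega)) (Set.mem_Iio.2 (by omega))
      (by omega)) (hm (a := b) (b := b + 1) (Set.mem_Iio.2 (by omega)) (Set.mem_Iio.2 (by omega))
      (by omega))]
    rcases max_cases (lev (x a) (x b)) (lev (x b) (x (b + 1))) with ⟨h, -⟩ | ⟨h, -⟩
    · exact ⟨i, h1, by omega, by rw [h, h3]⟩
    · exact ⟨b, by omega, by omega, h⟩

theorem IsSel.lt {r m : ℕ} {φ : ℕ → ℕ} (h : IsSel r m φ) {i j : ℕ} (hij : i < j) (hj : j < r) :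
    φ i < φ j :=
  h.1 (Set.mem_Iio.2 (hij.trans hj)) (Set.mem_Iio.2 hj) hij

section jlev

variable {L R : Finset ℕ} {x : ℕ → ℕ} {p : ℕ} {φ φ' : ℕ → ℕ} {j : ℕ}

theorem jlev_left (h : j + 1 < L.card) :
    jlev L R x p φ j = lev (enumNat L j) (enumNat L (j + 1)) := by
  rw [jlev, joined_left (by omega), joined_left h]

theorem jlev_left_end (h : j + 1 = L.card) (hp : 0 < p) :
    jlev L R x p φ j = lev (enumNat L j) (x (φ 0)) := by
  rw [jlev, joined_left (by omega), joined_mid (by omega) (by omega), h, Nat.sub_self]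

theorem jlev_mid (h : L.card ≤ j) (h' : j + 1 < L.card + p) :
    jlev L R x p φ j = lev (x (φ (j - L.card))) (x (φ (j - L.card + 1))) := by
  rw [jlev, joined_mid (by omega) (by omega), joined_mid (by omega) (by omega),
    Nat.sub_add_comm h]

theorem jlev_right_end (h : j + 1 = L.card + p) (hp : 0 < p) :
    jlev L R x p φ j = lev (x (φ (p - 1))) (enumNat R 0) := by
  rw [jlev, joined_mid (by omega) (by omega), joined_right (by omega), h, Nat.sub_self]
  congr 3; omega

theorem jlev_right (h : L.card + p ≤ j) :
    jlev L R x p φ j =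
      lev (enumNat R (j - (L.card + p))) (enumNat R (j + 1 - (L.card + p))) := by
  rw [jlev, joined_right h, joined_right (by omega)]

theorem jlev_congr_left (h : j < L.card) (hp : 0 < p)
    (hl : 0 < L.card → lev (enumNat L (L.card - 1)) (x (φ 0)) =
      lev (enumNat L (L.card - 1)) (x (φ' 0))) : jlev L R x p φ j = jlev L R x p φ' j := by
  rcases Nat.lt_or_ge (j + 1) L.card with h1 | h1
  · rw [jlev_left h1, jlev_left h1]
  · rw [jlev_left_end (by omega) hp, jlev_left_end (by omega) hp]
    have := hl (by omega)
    rwa [show L.card - 1 = j by omega] at this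

theorem jlev_congr_right (h : L.card + p ≤ j + 1) (hp : 0 < p)
    (hr : j + 1 = L.card + p → lev (x (φ (p - 1))) (enumNat R 0) =
      lev (x (φ' (p - 1))) (enumNat R 0)) : jlev L R x p φ j = jlev L R x p φ' j := by
  rcases Nat.lt_or_ge j (L.card + p) with h1 | h1
  · rw [jlev_right_end (by omega) hp, jlev_right_end (by omega) hp]
    exact hr (by omega)
  · rw [jlev_right h1, jlev_right h1]

end jlev

/-- A petal of a daisy with `N`-bounded points, all of whose consecutive levels are decreasing,
reduces the stepped-up coloring to the original one. -/
theorem IsDaisyGood.not_isBad_of_strictAntiOn {C : Finset ℕ → ZMod 2} {γ : ℕ → ℕ → ℕ → ZMod 2}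
    {r p m k N : ℕ} (hG : IsDaisyGood C r p k N) (hr : 2 ≤ r) (hp : 1 ≤ p) (hN : 0 < N)
    {L R : Finset ℕ} {x A B : ℕ → _} (h : IsBad (stepColor C γ r) (r + 1) m k (2 ^ N) L R x A B)
    (hm : 2 * p < m)
    (hd : StrictAntiOn (fun i => lev (x i) (x (i + 1))) (Set.Iio (2 * p))) : False := by
  set d : ℕ → ℕ := fun i => lev (x i) (x (i + 1)) with hddef
  have hx := h.strictMonoOn
  have hlev : ∀ a b, a < b → b ≤ 2 * p → lev (x a) (x b) = d a := by
    intro a b hab hb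
    obtain ⟨i, h1, h2, h3⟩ := exists_lev_eq hx hab (by omega)
    have h4 := lev_mono_seq hx (le_refl a) (show a ≤ a + 1 by omega) (show a + 1 ≤ b by omega)
      (by omega)
    have h5 : d i ≤ d a := hd.antitoneOn (Set.mem_Iio.2 (by omega)) (Set.mem_Iio.2 (by omega)) h1
    change d a ≤ _ at h4
    change _ = d i at h3
    omega
  have hdN : ∀ a, a < 2 * p → d a < N := fun a ha =>
    lev_lt hN (h.lt_bound _ (by omega)) (h.lt_bound _ (by omega))
  have hlt : ∀ a b, a < b → b < 2 * p → d b < d a := fun a b h1 h2 =>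
    hd (Set.mem_Iio.2 (by omega)) (Set.mem_Iio.2 h2) h1
  have hle : ∀ a b, a ≤ b → b < 2 * p → d b ≤ d a := fun a b h1 h2 =>
    hd.antitoneOn (Set.mem_Iio.2 (by omega)) (Set.mem_Iio.2 h2) h1
  obtain ⟨o, ho1, ho2, ho⟩ : ∃ o, 1 ≤ o ∧ o + p ≤ 2 * p ∧
      ((0 < R.card → ∀ a, o ≤ a → a < o + p → lev (x (2 * p)) (enumNat R 0) < d a) ∨
       (0 < R.card → ∀ a, o ≤ a → a < o + p → d a < lev (x (2 * p)) (enumNat R 0))) := by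
    rcases Nat.eq_zero_or_pos R.card with h0 | h0
    · exact ⟨1, le_rfl, by omega, Or.inl fun h => by omega⟩
    rcases lt_or_ge (lev (x (2 * p)) (enumNat R 0)) (d p) with h1 | h1
    · exact ⟨1, le_rfl, by omega, Or.inl fun _ a ha ha' =>
        h1.trans_le (hle _ _ (by omega) (by omega))⟩
    · refine ⟨p, hp, by omega, Or.inr fun _ a ha ha' => ?_⟩
      have h2 := hle p a ha (by omega)
      have h3 : lev (x a) (x (2 * p)) ≠ lev (x (2 * p)) (enumNat R 0) :=
        lev_ne (hx (Set.mem_Iio.2 (by omega)) (Set.mem_Iio.2 hm) (by omega))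
          (h.lt_right _ (enumNat_mem h0) _ hm)
      rw [hlev a _ (by omega) le_rfl] at h3
      omega
  set z : ℕ → ℕ := fun i => d (o + p - 1 - i) with hz
  have hzmono : StrictMonoOn z (Set.Iio p) := by
    intro i hi j hj hij
    rw [Set.mem_Iio] at hi hj
    exact hlt _ _ (by omega) (by omega)
  -- the selection of points attached to a selection of levels
  set sel : (ℕ → ℕ) → ℕ → ℕ := fun ψ t =>
    if t < r then o + p - 1 - ψ (r - 1 - t) else 2 * p with hsel
  have hselsel : ∀ ψ, IsSel r p ψ → IsSel (r + 1) m (sel ψ) := by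
    intro ψ hψ
    refine ⟨fun i hi j hj hij => ?_, fun i hi => ?_⟩
    · rw [Set.mem_Iio] at hi hj
      have e1 : sel ψ i = o + p - 1 - ψ (r - 1 - i) := if_pos (by omega)
      have b1 := hψ.2 (r - 1 - i) (by omega)
      rcases Nat.lt_or_ge j r with h1 | h1
      · have e2 : sel ψ j = o + p - 1 - ψ (r - 1 - j) := if_pos h1
        have := hψ.lt (show r - 1 - j < r - 1 - i by omega) (by omega)
        omega
      · have e2 : sel ψ j = 2 * p := if_neg (by omega)
        omega
    · simp only [hsel]
      split_ifs <;> omega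
  have hsel0 : ∀ ψ, IsSel r p ψ → o ≤ sel ψ 0 ∧ sel ψ 0 < o + p := by
    intro ψ hψ
    have e1 : sel ψ 0 = o + p - 1 - ψ (r - 1 - 0) := if_pos (by omega)
    have b1 := hψ.2 (r - 1 - 0) (by omega)
    omega
  have hselr : ∀ ψ, sel ψ (r + 1 - 1) = 2 * p := fun ψ => if_neg (by omega)
  have hleft : 0 < L.card → ∀ ψ, IsSel r p ψ → lev (enumNat L (L.card - 1)) (x (sel ψ 0)) =
      max (lev (enumNat L (L.card - 1)) (x 0)) (d 0) := by
    intro hL ψ hψ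
    have := hsel0 ψ hψ
    rw [lev_eq_max (h.left_lt _ (enumNat_mem (by omega)) 0 (by omega)).le
      (hx.monotoneOn (Set.mem_Iio.2 (by omega)) (Set.mem_Iio.2 (by omega)) (Nat.zero_le _)),
      hlev 0 (sel ψ 0) (by omega) (by omega)]
  obtain ⟨φ₀, hφ₀, -⟩ := hG ∅ ∅ z ⟨by simp, hzmono, fun i hi => hdN _ (by omega), by simp,
    by simp, by simp, by simp, by simp⟩ 0 0
  obtain ⟨Lo, Hi, A', B', hLo, hHi, hcard, hsub, hC⟩ := runColor_dec C γ (s := L.card)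
    (n := L.card + r + R.card) hr (by omega) (jlev L R x (r + 1) (sel φ₀))
    {v | ∃ a, o ≤ a ∧ a < o + p ∧ v = d a}
    (by
      rintro hL _ ⟨a, h1, h2, rfl⟩
      rw [jlev_left_end (by omega) (by omega), hleft hL _ hφ₀]
      have := hlt 0 a (by omega) (by omega)
      omega)
    (by
      have key : L.card + r < L.card + r + R.card →
          jlev L R x (r + 1) (sel φ₀) (L.card + r) = lev (x (2 * p)) (enumNat R 0) := by
        intro _
        rw [jlev_right_end (by omega) (by omega), hselr]
      intro hR
      rw [key hR]
      rcases ho with ho | ho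
      · left
        rintro _ ⟨a, h1, h2, rfl⟩
        exact ho (by omega) a h1 h2
      · right
        rintro _ ⟨a, h1, h2, rfl⟩
        exact ho (by omega) a h1 h2)
  have hbd : ∀ v ∈ Lo ∪ Hi, v < N := by
    intro v hv
    obtain ⟨j, hj, rfl⟩ := Finset.mem_image.1 (hsub hv)
    rw [Finset.mem_range] at hj
    exact h.jlev_lt hN (hselsel _ hφ₀) (by omega)
  have hzZ : ∀ i < p, z i ∈ {v | ∃ a, o ≤ a ∧ a < o + p ∧ v = d a} := fun i hi =>
    ⟨o + p - 1 - i, by omega, by omega, rfl⟩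
  have hker : IsSimpleKernel p k N Lo Hi z :=
    { card_le := by have := h.card_le; omega
      strictMonoOn := hzmono
      lt_bound := fun i hi => hdN _ (by omega)
      left_lt := fun a ha i hi => hLo a ha _ (hzZ i hi)
      lt_right := fun b hb i hi => hHi b hb _ (hzZ i hi)
      left_lt_right := fun a ha b hb => (hLo a ha _ (hzZ 0 hp)).trans (hHi b hb _ (hzZ 0 hp))
      left_bound := fun a ha => hbd a (Finset.mem_union_left _ ha)
      right_bound := fun a ha => hbd a (Finset.mem_union_right _ ha) }
  obtain ⟨ψ, hψ, hne⟩ := hG Lo Hi z hker (fun u => B (2 * p) - B' (z u))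
    (fun u => A (o + p - 1 - u) - A' (z u))
  apply hne
  set f : ℕ → ℕ := fun t => z (ψ (r - 1 - t)) with hf
  have hfeq : ∀ t < r, f t = d (sel ψ t) := by
    intro t ht
    have e1 : sel ψ t = o + p - 1 - ψ (r - 1 - t) := if_pos ht
    rw [e1]
  have hCf := hC f
    (by
      intro i hi j hj hij
      rw [Set.mem_Iio] at hi hj
      exact hzmono (hψ.2 _ (by omega)) (hψ.2 _ (by omega))
        (hψ.1 (Set.mem_Iio.2 (by omega)) (Set.mem_Iio.2 (by omega)) (by omega)))
    (fun j hj => hzZ _ (hψ.2 _ (by omega)))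
  have himg : (Finset.range r).image f = (Finset.range r).image (z ∘ ψ) := by
    ext v
    simp only [Finset.mem_image, Finset.mem_range]
    constructor
    · rintro ⟨t, ht, rfl⟩
      exact ⟨r - 1 - t, by omega, rfl⟩
    · rintro ⟨t, ht, rfl⟩
      refine ⟨r - 1 - t, by omega, ?_⟩
      simp only [hf, Function.comp]
      congr 2; omega
  have hrun : runColor C γ (L.card + r + R.card) (jlev L R x (r + 1) (sel ψ)) =
      runColor C γ (L.card + r + R.card)
        (splice (jlev L R x (r + 1) (sel φ₀)) L.card r f) := by
    refine runColor_congr fun j hj => ?_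
    rcases Nat.lt_or_ge j L.card with h1 | h1
    · rw [splice_left h1]
      exact jlev_congr_left h1 (by omega) fun hL => by rw [hleft hL _ hψ, hleft hL _ hφ₀]
    rcases Nat.lt_or_ge j (L.card + r) with h2 | h2
    · rw [splice_mid h1 h2, jlev_mid h1 (by omega), hfeq _ (by omega)]
      have hs := hselsel ψ hψ
      have hs1 := hs.lt (show j - L.card < j - L.card + 1 by omega) (by omega)
      refine hlev _ _ hs1 ?_
      simp only [hsel]
      split_ifs <;> omega
    · rw [splice_right h2]
      exact jlev_congr_right (by omega) (by omega) fun _ => by rw [hselr, hselr]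
  have hbad := h.eq_add _ (hselsel ψ hψ)
  rw [h.stepColor_eq C γ (hselsel ψ hψ), hrun, hCf, himg, hselr] at hbad
  have e0 : sel ψ 0 = o + p - 1 - ψ (r - 1) := if_pos (by omega)
  have e1 : f 0 = z (ψ (r - 1)) := rfl
  have e2 : f (r - 1) = z (ψ 0) := by simp only [hf, Nat.sub_self]
  rw [e0, e1, e2] at hbad
  linear_combination hbad

/-- The analogue of `IsDaisyGood.not_isBad_of_strictAntiOn` for increasing levels. -/
theorem IsDaisyGood.not_isBad_of_strictMonoOn {C : Finset ℕ → ZMod 2} {γ : ℕ → ℕ → ℕ → ZMod 2}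
    {r p m k N : ℕ} (hG : IsDaisyGood C r p k N) (hr : 2 ≤ r) (hp : 1 ≤ p) (hN : 0 < N)
    {L R : Finset ℕ} {x A B : ℕ → _} (h : IsBad (stepColor C γ r) (r + 1) m k (2 ^ N) L R x A B)
    (hm : 2 * p < m)
    (hd : StrictMonoOn (fun i => lev (x i) (x (i + 1))) (Set.Iio (2 * p))) : False := by
  set d : ℕ → ℕ := fun i => lev (x i) (x (i + 1)) with hddef
  have hx := h.strictMonoOn
  have hlev : ∀ a b, a ≤ b → b < 2 * p → lev (x a) (x (b + 1)) = d b := by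
    intro a b hab hb
    obtain ⟨i, h1, h2, h3⟩ := exists_lev_eq hx (show a < b + 1 by omega) (by omega)
    have h4 := lev_mono_seq hx hab (show b ≤ b + 1 by omega) (show b + 1 ≤ b + 1 by omega)
      (by omega)
    have h5 : d i ≤ d b := hd.monotoneOn (Set.mem_Iio.2 (by omega)) (Set.mem_Iio.2 (by omega))
      (by omega)
    change d b ≤ _ at h4
    change _ = d i at h3
    omega
  have hdN : ∀ a, a < 2 * p → d a < N := fun a ha =>
    lev_lt hN (h.lt_bound _ (by omega)) (h.lt_bound _ (by omega))
  have hlt : ∀ a b, a < b → b < 2 * p → d a < d b := fun a b h1 h2 =>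
    hd (Set.mem_Iio.2 (by omega)) (Set.mem_Iio.2 h2) h1
  have hle : ∀ a b, a ≤ b → b < 2 * p → d a ≤ d b := fun a b h1 h2 =>
    hd.monotoneOn (Set.mem_Iio.2 (by omega)) (Set.mem_Iio.2 h2) h1
  obtain ⟨o, ho2, ho⟩ : ∃ o, o + p + 1 ≤ 2 * p ∧
      ((0 < L.card → ∀ a, o ≤ a → a < o + p → lev (enumNat L (L.card - 1)) (x 0) < d a) ∨
       (0 < L.card → ∀ a, o ≤ a → a < o + p → d a < lev (enumNat L (L.card - 1)) (x 0))) := by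
    rcases Nat.eq_zero_or_pos L.card with h0 | h0
    · exact ⟨0, by omega, Or.inl fun h => by omega⟩
    rcases lt_or_ge (lev (enumNat L (L.card - 1)) (x 0)) (d (p - 1)) with h1 | h1
    · exact ⟨p - 1, by omega, Or.inl fun _ a ha ha' =>
        h1.trans_le (hle _ _ (by omega) (by omega))⟩
    · refine ⟨0, by omega, Or.inr fun _ a ha ha' => ?_⟩
      have h2 := hle a (p - 1) (by omega) (by omega)
      have h3 : lev (enumNat L (L.card - 1)) (x 0) ≠ lev (x 0) (x (a + 1)) :=
        lev_ne (h.left_lt _ (enumNat_mem (by omega)) _ (by omega))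
          (hx (Set.mem_Iio.2 (by omega)) (Set.mem_Iio.2 (by omega)) (by omega))
      rw [hlev 0 a (by omega) (by omega)] at h3
      omega
  set z : ℕ → ℕ := fun i => d (o + i) with hz
  have hzmono : StrictMonoOn z (Set.Iio p) := by
    intro i hi j hj hij
    rw [Set.mem_Iio] at hi hj
    exact hlt _ _ (by omega) (by omega)
  -- the selection of points attached to a selection of levels
  set sel : (ℕ → ℕ) → ℕ → ℕ := fun ψ t => if t = 0 then 0 else o + ψ (t - 1) + 1 with hsel
  have hsel0 : ∀ ψ, sel ψ 0 = 0 := fun ψ => if_pos rfl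
  have hselS : ∀ ψ t, sel ψ (t + 1) = o + ψ t + 1 := fun ψ t => by
    simp only [hsel, Nat.add_sub_cancel]
    exact if_neg (by omega)
  have hselsel : ∀ ψ, IsSel r p ψ → IsSel (r + 1) m (sel ψ) := by
    intro ψ hψ
    refine ⟨fun i hi j hj hij => ?_, fun i hi => ?_⟩
    · rw [Set.mem_Iio] at hi hj
      obtain ⟨j, rfl⟩ : ∃ j', j = j' + 1 := ⟨j - 1, by omega⟩
      rw [hselS]
      rcases Nat.eq_zero_or_pos i with rfl | hi0
      · rw [hsel0]; omega
      · obtain ⟨i, rfl⟩ : ∃ i', i = i' + 1 := ⟨i - 1, by omega⟩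
        rw [hselS]
        have := hψ.lt (show i < j by omega) (by omega)
        omega
    · rcases Nat.eq_zero_or_pos i with rfl | hi0
      · rw [hsel0]; omega
      · obtain ⟨i, rfl⟩ : ∃ i', i = i' + 1 := ⟨i - 1, by omega⟩
        rw [hselS]
        have := hψ.2 i (by omega)
        omega
  have hselr : ∀ ψ, sel ψ (r + 1 - 1) = o + ψ (r - 1) + 1 := fun ψ => by
    rw [show r + 1 - 1 = (r - 1) + 1 by omega, hselS]
  have hright : 0 < R.card → ∀ ψ, IsSel r p ψ → lev (x (sel ψ (r + 1 - 1))) (enumNat R 0) =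
      max (d (2 * p - 1)) (lev (x (2 * p)) (enumNat R 0)) := by
    intro hR ψ hψ
    have := hψ.2 (r - 1) (by omega)
    rw [hselr, lev_eq_max (hx.monotoneOn (a := o + ψ (r - 1) + 1) (b := 2 * p)
      (Set.mem_Iio.2 (by omega)) (Set.mem_Iio.2 (by omega)) (by omega))
      (h.lt_right _ (enumNat_mem (by omega)) _ (by omega)).le]
    have h2 := hlev (o + ψ (r - 1) + 1) (2 * p - 1) (by omega) (by omega)
    rw [show 2 * p - 1 + 1 = 2 * p by omega] at h2
    rw [h2]
  obtain ⟨φ₀, hφ₀, -⟩ := hG ∅ ∅ z ⟨by simp, hzmono, fun i hi => hdN _ (by omega), by simp,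
    by simp, by simp, by simp, by simp⟩ 0 0
  obtain ⟨Lo, Hi, A', B', hLo, hHi, hcard, hsub, hC⟩ := runColor_inc C γ (s := L.card)
    (n := L.card + r + R.card) hr (by omega) (jlev L R x (r + 1) (sel φ₀))
    {v | ∃ a, o ≤ a ∧ a < o + p ∧ v = d a}
    (by
      rintro hR _ ⟨a, h1, h2, rfl⟩
      rw [jlev_right_end (by omega) (by omega), hright (by omega) _ hφ₀]
      have := hlt a (2 * p - 1) (by omega) (by omega)
      omega)
    (by
      intro hL
      rw [jlev_left_end (by omega) (by omega), hsel0]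
      rcases ho with ho | ho
      · left
        rintro _ ⟨a, h1, h2, rfl⟩
        exact ho (by omega) a h1 h2
      · right
        rintro _ ⟨a, h1, h2, rfl⟩
        exact ho (by omega) a h1 h2)
  have hbd : ∀ v ∈ Lo ∪ Hi, v < N := by
    intro v hv
    obtain ⟨j, hj, rfl⟩ := Finset.mem_image.1 (hsub hv)
    rw [Finset.mem_range] at hj
    exact h.jlev_lt hN (hselsel _ hφ₀) (by omega)
  have hzZ : ∀ i < p, z i ∈ {v | ∃ a, o ≤ a ∧ a < o + p ∧ v = d a} := fun i hi =>
    ⟨o + i, by omega, by omega, rfl⟩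
  have hker : IsSimpleKernel p k N Lo Hi z :=
    { card_le := by have := h.card_le; omega
      strictMonoOn := hzmono
      lt_bound := fun i hi => hdN _ (by omega)
      left_lt := fun a ha i hi => hLo a ha _ (hzZ i hi)
      lt_right := fun b hb i hi => hHi b hb _ (hzZ i hi)
      left_lt_right := fun a ha b hb => (hLo a ha _ (hzZ 0 hp)).trans (hHi b hb _ (hzZ 0 hp))
      left_bound := fun a ha => hbd a (Finset.mem_union_left _ ha)
      right_bound := fun a ha => hbd a (Finset.mem_union_right _ ha) }
  obtain ⟨ψ, hψ, hne⟩ := hG Lo Hi z hker (fun u => A 0 - A' (z u))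
    (fun u => B (o + u + 1) - B' (z u))
  apply hne
  have hCf := hC (z ∘ ψ)
    (by
      intro i hi j hj hij
      exact hzmono (hψ.2 _ hi) (hψ.2 _ hj) (hψ.1 hi hj hij))
    (fun j hj => hzZ _ (hψ.2 _ (by omega)))
  have hrun : runColor C γ (L.card + r + R.card) (jlev L R x (r + 1) (sel ψ)) =
      runColor C γ (L.card + r + R.card)
        (splice (jlev L R x (r + 1) (sel φ₀)) L.card r (z ∘ ψ)) := by
    refine runColor_congr fun j hj => ?_
    rcases Nat.lt_or_ge j L.card with h1 | h1
    · rw [splice_left h1]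
      exact jlev_congr_left h1 (by omega) fun hL => by rw [hsel0, hsel0]
    rcases Nat.lt_or_ge j (L.card + r) with h2 | h2
    · rw [splice_mid h1 h2, jlev_mid h1 (by omega), hselS]
      have hs := hselsel ψ hψ
      have hs1 := hs.lt (show j - L.card < j - L.card + 1 by omega) (by omega)
      rw [hselS] at hs1
      have := hψ.2 (j - L.card) (by omega)
      exact hlev _ _ (by omega) (by omega)
    · rw [splice_right h2]
      exact jlev_congr_right (by omega) (by omega) fun hj' => by
        rw [hright (by omega) _ hψ, hright (by omega) _ hφ₀]
  have hbad := h.eq_add _ (hselsel ψ hψ)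
  rw [h.stepColor_eq C γ (hselsel ψ hψ), hrun, hCf, hselr, hsel0] at hbad
  change _ + A' (z (ψ 0)) + B' (z (ψ (r - 1))) = _ at hbad
  linear_combination hbad

/-- The sequence `d 0, …, d (n-1)` behaves like the levels of an increasing sequence of points:
between equal terms there is a larger one, and it has no long comb of record values. -/
structure IsTame (n q : ℕ) (d : ℕ → ℕ) : Prop where
  exists_between : ∀ i j, i < j → j < n → d i = d j → ∃ t, i < t ∧ t < j ∧ d i < d t
  card_lt_of_dec : ∀ I ⊆ Finset.range n,
    (∀ i ∈ I, ∀ j ∈ I, ∀ t, i < t → t ≤ j → d t < d i) → I.card < q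
  card_lt_of_inc : ∀ I ⊆ Finset.range n,
    (∀ i ∈ I, ∀ j ∈ I, ∀ t, i ≤ t → t < j → d t < d j) → I.card < q

theorem IsDaisyGood.isTame {C : Finset ℕ → ZMod 2} {γ : ℕ → ℕ → ℕ → ZMod 2}
    {r p m k N : ℕ} (hG : IsDaisyGood C r p k N) (hr : 2 ≤ r) (hp : 1 ≤ p) (hN : 0 < N)
    {L R : Finset ℕ} {x A B : ℕ → _} (h : IsBad (stepColor C γ r) (r + 1) m k (2 ^ N) L R x A B)
    {n : ℕ} (hn : n < m) : IsTame n (2 * p) fun i => lev (x i) (x (i + 1)) := by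
  have hx := h.strictMonoOn
  refine ⟨fun i j hij hj hd => ?_, fun I hI hdec => ?_, fun I hI hinc => ?_⟩
  · by_contra! hcon
    obtain ⟨u, h1, h2, h3⟩ := exists_lev_eq hx hij (by omega)
    have h4 := lev_mono_seq hx (le_refl i) (show i ≤ i + 1 by omega) (show i + 1 ≤ j by omega)
      (by omega)
    have h5 : lev (x u) (x (u + 1)) ≤ lev (x i) (x (i + 1)) := by
      rcases h1.eq_or_lt with rfl | h1
      · exact le_rfl
      · exact hcon u h1 h2
    have h6 : lev (x i) (x j) ≠ lev (x j) (x (j + 1)) :=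
      lev_ne (hx (Set.mem_Iio.2 (by omega)) (Set.mem_Iio.2 (by omega)) hij)
        (hx (Set.mem_Iio.2 (by omega)) (Set.mem_Iio.2 (by omega)) (by omega))
    omega
  · by_contra! hcard
    have hI' : ∀ a, a < 2 * p → enumNat I a < n := fun a ha =>
      Finset.mem_range.1 (hI (enumNat_mem (by omega)))
    have hmono := strictMonoOn_enumNat I
    set w : ℕ → ℕ := fun a => if a < 2 * p then enumNat I a else enumNat I (2 * p - 1) + 1 with hw
    have hw1 : ∀ a, a < 2 * p → w a = enumNat I a := fun a ha => if_pos ha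
    have hw2 : w (2 * p) = enumNat I (2 * p - 1) + 1 := if_neg (by omega)
    have hsel : IsSel (2 * p + 1) m w := by
      refine ⟨fun a ha b hb hab => ?_, fun a ha => ?_⟩
      · rw [Set.mem_Iio] at ha hb
        rw [hw1 a (by omega)]
        rcases Nat.lt_or_ge b (2 * p) with h1 | h1
        · rw [hw1 b h1]
          exact hmono (Set.mem_Iio.2 (by omega)) (Set.mem_Iio.2 (by omega)) hab
        · rw [show b = 2 * p by omega, hw2]
          have := hmono.monotoneOn (a := a) (b := 2 * p - 1) (Set.mem_Iio.2 (by omega))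
            (Set.mem_Iio.2 (by omega)) (by omega)
          omega
      · rcases Nat.lt_or_ge a (2 * p) with h1 | h1
        · rw [hw1 a h1]
          have := hI' a h1
          omega
        · rw [show a = 2 * p by omega, hw2]
          have := hI' (2 * p - 1) (by omega)
          omega
    have hval : ∀ a, a < 2 * p → lev (x (w a)) (x (w (a + 1))) =
        lev (x (enumNat I a)) (x (enumNat I a + 1)) := by
      intro a ha
      rcases Nat.lt_or_ge (a + 1) (2 * p) with h1 | h1
      · rw [hw1 a ha, hw1 _ h1]
        have hlt : enumNat I a < enumNat I (a + 1) :=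
          hmono (Set.mem_Iio.2 (by omega)) (Set.mem_Iio.2 (by omega)) (by omega)
        have hb := hI' _ h1
        obtain ⟨u, h2, h3, h4⟩ := exists_lev_eq hx hlt (by omega)
        have h5 := lev_mono_seq hx (le_refl (enumNat I a))
          (show enumNat I a ≤ enumNat I a + 1 by omega) hlt (by omega)
        rcases h2.eq_or_lt with rfl | h2
        · exact h4
        · have := hdec _ (enumNat_mem (S := I) (i := a) (by omega)) _
            (enumNat_mem (S := I) (i := a + 1) (by omega)) u h2 h3.le
          omega
      · rw [hw1 a ha, show a + 1 = 2 * p by omega, hw2, show 2 * p - 1 = a by omega]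
    refine hG.not_isBad_of_strictAntiOn hr hp hN (h.comp_sel hsel) (by omega) ?_
    intro a ha b hb hab
    rw [Set.mem_Iio] at ha hb
    change lev (x (w b)) (x (w (b + 1))) < lev (x (w a)) (x (w (a + 1)))
    rw [hval a ha, hval b hb]
    exact hdec _ (enumNat_mem (by omega)) _ (enumNat_mem (S := I) (i := b) (by omega)) _
      (hmono (Set.mem_Iio.2 (by omega)) (Set.mem_Iio.2 (by omega)) hab) le_rfl
  · by_contra! hcard
    have hI' : ∀ a, a < 2 * p → enumNat I a < n := fun a ha =>
      Finset.mem_range.1 (hI (enumNat_mem (by omega)))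
    have hmono := strictMonoOn_enumNat I
    set w : ℕ → ℕ := fun a => if a = 0 then enumNat I 0 else enumNat I (a - 1) + 1 with hw
    have hw1 : w 0 = enumNat I 0 := if_pos rfl
    have hw2 : ∀ a, w (a + 1) = enumNat I a + 1 := fun a => by
      rw [hw]
      simp
    have hsel : IsSel (2 * p + 1) m w := by
      refine ⟨fun a ha b hb hab => ?_, fun a ha => ?_⟩
      · rw [Set.mem_Iio] at ha hb
        obtain ⟨b, rfl⟩ : ∃ b', b = b' + 1 := ⟨b - 1, by omega⟩
        rw [hw2]
        rcases Nat.eq_zero_or_pos a with rfl | h1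
        · rw [hw1]
          have := hmono.monotoneOn (a := 0) (b := b) (Set.mem_Iio.2 (by omega))
            (Set.mem_Iio.2 (by omega)) (by omega)
          omega
        · obtain ⟨a, rfl⟩ : ∃ a', a = a' + 1 := ⟨a - 1, by omega⟩
          rw [hw2]
          have := hmono (a := a) (b := b) (Set.mem_Iio.2 (by omega))
            (Set.mem_Iio.2 (by omega)) (by omega)
          omega
      · rcases Nat.eq_zero_or_pos a with rfl | h1
        · rw [hw1]
          have := hI' 0 (by omega)
          omega
        · obtain ⟨a, rfl⟩ : ∃ a', a = a' + 1 := ⟨a - 1, by omega⟩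
          rw [hw2]
          have := hI' a (by omega)
          omega
    have hval : ∀ a, a < 2 * p → lev (x (w a)) (x (w (a + 1))) =
        lev (x (enumNat I a)) (x (enumNat I a + 1)) := by
      intro a ha
      rcases Nat.eq_zero_or_pos a with rfl | h1
      · rw [hw1, hw2]
      · obtain ⟨a, rfl⟩ : ∃ a', a = a' + 1 := ⟨a - 1, by omega⟩
        rw [hw2, hw2]
        have hlt : enumNat I a < enumNat I (a + 1) :=
          hmono (Set.mem_Iio.2 (by omega)) (Set.mem_Iio.2 (by omega)) (by omega)
        have hb := hI' _ ha
        obtain ⟨u, h2, h3, h4⟩ := exists_lev_eq hx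
          (show enumNat I a + 1 < enumNat I (a + 1) + 1 by omega) (by omega)
        have h5 := lev_mono_seq hx (show enumNat I a + 1 ≤ enumNat I (a + 1) by omega)
          (show enumNat I (a + 1) ≤ enumNat I (a + 1) + 1 by omega) le_rfl (by omega)
        rcases (Nat.lt_succ_iff.1 h3).eq_or_lt with rfl | h3
        · exact h4
        · have := hinc _ (enumNat_mem (S := I) (i := a) (by omega)) _
            (enumNat_mem (S := I) (i := a + 1) (by omega)) u (by omega) h3
          omega
    refine hG.not_isBad_of_strictMonoOn hr hp hN (h.comp_sel hsel) (by omega) ?_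
    intro a ha b hb hab
    rw [Set.mem_Iio] at ha hb
    change lev (x (w a)) (x (w (a + 1))) < lev (x (w b)) (x (w (b + 1)))
    rw [hval a ha, hval b hb]
    exact hinc _ (enumNat_mem (by omega)) _ (enumNat_mem (S := I) (i := b) (by omega)) _ le_rfl
      (hmono (Set.mem_Iio.2 (by omega)) (Set.mem_Iio.2 (by omega)) hab)

namespace IsTame

variable {n q : ℕ} {d : ℕ → ℕ}

theorem ne_succ (h : IsTame n q d) {i : ℕ} (hi : i + 1 < n) : d i ≠ d (i + 1) := by
  intro he
  obtain ⟨t, h1, h2, -⟩ := h.exists_between i (i + 1) (by omega) hi he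
  omega

/-- A large set of indices contains two with a larger term in between. -/
theorem exists_gt_between (h : IsTame n q d) {S : Finset ℕ} (hS : S ⊆ Finset.range n)
    (hcard : 2 * q ≤ S.card) :
    ∃ a ∈ S, ∃ b ∈ S, ∃ t, a < t ∧ t < b ∧ d a < d t ∧ d b < d t := by
  by_contra! hcon
  rcases S.eq_empty_or_nonempty with rfl | hne
  · have := h.card_lt_of_dec ∅ (by simp) (by simp)
    simp at hcard
    omega
  obtain ⟨a, haS, hmin⟩ := S.exists_min_image d hne
  have hdec := h.card_lt_of_dec (S.filter (· ≤ a))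
    ((Finset.filter_subset _ _).trans hS) (by
      intro i hi j hj t hit htj
      rw [Finset.mem_filter] at hi hj
      have han := Finset.mem_range.1 (hS haS)
      have hmi := hmin i hi.1
      have key : ∀ u, i < u → u ≤ a → d u ≤ d i := by
        intro u h1 h2
        rcases h2.eq_or_lt with rfl | h2
        · exact hmi
        · by_contra! h3
          have := hcon i hi.1 a haS u h1 h2 h3
          omega
      refine lt_of_le_of_ne (key t hit (by omega)) fun he => ?_
      obtain ⟨u, h1, h2, h3⟩ := h.exists_between i t hit (by omega) he.symm
      have := key u h1 (by omega)
      omega)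
  have hinc := h.card_lt_of_inc (S.filter (a ≤ ·))
    ((Finset.filter_subset _ _).trans hS) (by
      intro i hi j hj t hit htj
      rw [Finset.mem_filter] at hi hj
      have hjn := Finset.mem_range.1 (hS hj.1)
      have hmj := hmin j hj.1
      have key : ∀ u, a ≤ u → u < j → d u ≤ d j := by
        intro u h1 h2
        rcases h1.eq_or_lt with rfl | h1
        · exact hmj
        · by_contra! h3
          have := hcon a haS j hj.1 u h1 h2 (by omega)
          omega
      refine lt_of_le_of_ne (key t (by omega) htj) fun he => ?_
      obtain ⟨u, h1, h2, h3⟩ := h.exists_between t j htj hjn he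
      have := key u (by omega) h2
      omega)
  have hun : S.card ≤ (S.filter (· ≤ a)).card + (S.filter (a ≤ ·)).card := by
    refine le_trans (Finset.card_le_card fun s hs => ?_) (Finset.card_union_le _ _)
    rw [Finset.mem_union, Finset.mem_filter, Finset.mem_filter]
    rcases le_total s a with h | h
    · exact Or.inl ⟨hs, h⟩
    · exact Or.inr ⟨hs, h⟩
  omega

theorem exists_isPeak_of_between (h : IsTame n q d) {i t j : ℕ} (hit : i < t) (htj : t < j)
    (hj : j < n) (h1 : d i < d t) (h2 : d j < d t) :
    ∃ c, i < c ∧ c < j ∧ d t ≤ d c ∧ (∀ u, i < u → u < j → d u ≤ d c) ∧ IsPeak n d c := by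
  obtain ⟨c, hc, hmax⟩ := (Finset.Ioo i j).exists_max_image d ⟨t, Finset.mem_Ioo.2 ⟨hit, htj⟩⟩
  rw [Finset.mem_Ioo] at hc
  have hmax' : ∀ u, i < u → u < j → d u ≤ d c := fun u h3 h4 =>
    hmax u (Finset.mem_Ioo.2 ⟨h3, h4⟩)
  have htc := hmax' t hit htj
  refine ⟨c, hc.1, hc.2, htc, hmax', by omega, by omega, ?_, ?_⟩
  · rcases Nat.lt_or_ge i (c - 1) with h3 | h3
    · have := hmax' (c - 1) h3 (by omega)
      have hne := h.ne_succ (i := c - 1) (by omega)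
      rw [show c - 1 + 1 = c by omega] at hne
      omega
    · rw [show c - 1 = i by omega]
      omega
  · rcases Nat.lt_or_ge (c + 1) j with h3 | h3
    · have := hmax' (c + 1) (by omega) h3
      have hne := h.ne_succ (i := c) (by omega)
      omega
    · rw [show c + 1 = j by omega]
      omega

theorem exists_isPeak_window (h : IsTame n q d) {a : ℕ} (ha : a + 2 * q ≤ n) :
    ∃ c, a < c ∧ c + 1 < a + 2 * q ∧ IsPeak n d c := by
  obtain ⟨u, hu, v, hv, t, h1, h2, h3, h4⟩ := h.exists_gt_between
    (S := Finset.Ico a (a + 2 * q))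
    (fun s hs => Finset.mem_range.2 (by rw [Finset.mem_Ico] at hs; omega)) (by simp)
  rw [Finset.mem_Ico] at hu hv
  obtain ⟨c, h5, h6, -, -, h7⟩ := h.exists_isPeak_of_between h1 h2 (by omega) h3 h4
  exact ⟨c, by omega, by omega, h7⟩

theorem exists_valley_left (h : IsTame n q d) {a : ℕ} (ha : d (a + 1) < d a) {c : ℕ}
    (hac : a < c) (hcn : c < n) (hc : d (c - 1) < d c) :
    ∃ i, a < i ∧ i < c ∧ d i < d (i - 1) ∧ d i < d (i + 1) ∧ d (i + 1) ≤ d c := by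
  induction c, hac using Nat.le_induction with
  | base => exact absurd ha (lt_asymm hc)
  | succ c hac ih =>
    rw [Nat.add_sub_cancel] at hc
    rcases lt_or_ge (d c) (d (c - 1)) with h1 | h1
    · exact ⟨c, by omega, by omega, h1, hc, le_rfl⟩
    · have hne := h.ne_succ (i := c - 1) (by omega)
      rw [show c - 1 + 1 = c by omega] at hne
      obtain ⟨i, h2, h3, h4, h5, h6⟩ := ih (by omega) (by omega)
      exact ⟨i, h2, by omega, h4, h5, by omega⟩

theorem exists_valley_right (h : IsTame n q d) {b : ℕ} (hb : d (b - 1) < d b) (hbn : b < n)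
    (l c : ℕ) (hbc : c + l + 1 = b) (hc : d (c + 1) < d c) :
    ∃ j, c < j ∧ j < b ∧ d j < d (j - 1) ∧ d j < d (j + 1) ∧ d (j - 1) ≤ d c := by
  induction l generalizing c with
  | zero => subst hbc; exact absurd hc (lt_asymm hb)
  | succ l ih =>
    rcases lt_or_ge (d (c + 1)) (d (c + 1 + 1)) with h1 | h1
    · exact ⟨c + 1, by omega, by omega, hc, h1, le_rfl⟩
    · have hne := h.ne_succ (i := c + 1) (by omega)
      obtain ⟨j, h2, h3, h4, h5, h6⟩ := ih (c + 1) (by omega) (by omega)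
      exact ⟨j, by omega, h3, h4, h5, by omega⟩

/-- A long tame sequence contains two valleys `i < j` with a high term in between. -/
theorem exists_two_valleys (h : IsTame n q d) (hn : (2 * q + 2) * (2 * q) ≤ n) :
    ∃ i c j, 0 < i ∧ i + 2 ≤ c ∧ c + 2 ≤ j ∧ j + 1 < n ∧ d i < d (i - 1) ∧ d i < d (i + 1) ∧
      d (i + 1) < d c ∧ d (j - 1) < d c ∧ d j < d (j - 1) ∧ d j < d (j + 1) := by
  have hwin : ∀ w : ℕ, w < 2 * q + 2 →
      ∃ c, 2 * q * w < c ∧ c + 1 < 2 * q * w + 2 * q ∧ IsPeak n d c := fun w hw => by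
    refine h.exists_isPeak_window (le_trans ?_ hn)
    nlinarith
  choose! P hP1 hP2 hP3 using hwin
  have hPmono : ∀ u v, u < v → v < 2 * q + 2 → P u + 1 < P v := by
    intro u v huv hv
    have h1 := hP2 u (by omega)
    have h2 := hP1 v hv
    have h3 : 2 * q * (u + 1) ≤ 2 * q * v := Nat.mul_le_mul_left _ huv
    rw [mul_add, mul_one] at h3
    omega
  have hPle : ∀ u, u < 2 * q + 2 → P u + 1 < n := fun u hu => (hP3 u hu).2.1
  obtain ⟨a, ha, b, hb, c, hac, hcb, h1, h2⟩ := h.exists_gt_between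
    (S := (Finset.range (2 * q)).image fun u => P (u + 1))
    (by
      intro s hs
      obtain ⟨u, hu, rfl⟩ := Finset.mem_image.1 hs
      rw [Finset.mem_range] at hu
      have := hPle (u + 1) (by omega)
      exact Finset.mem_range.2 (by omega))
    (by
      rw [card_image_of_strictMonoOn]
      intro u _ v hv huv
      rw [Set.mem_Iio] at hv
      have := hPmono (u + 1) (v + 1) (by omega) (by omega)
      change P (u + 1) < P (v + 1)
      omega)
  obtain ⟨u, hu, rfl⟩ := Finset.mem_image.1 ha
  obtain ⟨v, hv, rfl⟩ := Finset.mem_image.1 hb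
  rw [Finset.mem_range] at hu hv
  have hl := hPmono 0 (u + 1) (by omega) (by omega)
  have hr := hPmono (v + 1) (2 * q + 1) (by omega) (by omega)
  have hrn := hPle (2 * q + 1) (by omega)
  obtain ⟨i, i1, i2, i3, i4, i5⟩ := h.exists_valley_left (hP3 0 (by omega)).2.2.2
    (show P 0 < P (u + 1) by omega) (by omega) (hP3 (u + 1) (by omega)).2.2.1
  obtain ⟨j, j1, j2, j3, j4, j5⟩ := h.exists_valley_right (hP3 (2 * q + 1) (by omega)).2.2.1
    (by omega) (P (2 * q + 1) - P (v + 1) - 1) (P (v + 1)) (by omega)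
    (hP3 (v + 1) (by omega)).2.2.2
  exact ⟨i, c, j, by omega, by omega, by omega, by omega, i3, i4, by omega, by omega, j3, j4⟩

end IsTame

/-- The effect of a peak of the levels, at the position of the third or fourth petal point. -/
theorem IsSimpleKernel.stepColor_eq_bump {m k N : ℕ} {L R : Finset ℕ} {x : ℕ → ℕ}
    (h : IsSimpleKernel m k N L R x) {C : Finset ℕ → ZMod 2} (γ : ℕ → ℕ → ℕ → ZMod 2)
    {r u l : ℕ} {φ : ℕ → ℕ} (hφ : IsSel (r + 1) m φ) (hu : 0 < u) (hul : u < l) (hl : l < r)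
    (hC : ∀ Y : Finset ℕ, Y.card < l + 1 → C Y = 0) {e : ℕ → ℕ}
    (he : ∀ t, t ≤ l → lev (x (φ t)) (x (φ (t + 1))) = e t)
    (hup : ∀ t, t < u → e t < e (t + 1)) (hdown : ∀ t, u ≤ t → t < l → e (t + 1) < e t)
    (hfirst : ∃ a, a < φ 0 ∧ e 0 < lev (x a) (x (φ 0)))
    (hlast : ∃ b, φ (l + 1) < b ∧ b < m ∧ (l + 1 < r → b ≤ φ (l + 1 + 1)) ∧
      e l < lev (x (φ (l + 1))) (x b)) :
    stepColor C γ r (L ∪ (Finset.range (r + 1)).image (x ∘ φ) ∪ R) =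
      runColor C γ (L.card + 1) (jlev L R x (r + 1) φ) + γ (L.card + u) (e (u - 1)) (e (u + 1)) +
        runColor C (fun j => γ (j + (L.card + l))) (r - l + R.card)
          (fun i => jlev L R x (r + 1) φ (i + (L.card + l))) := by
  have hx := h.strictMonoOn
  obtain ⟨a, ha, hea⟩ := hfirst
  obtain ⟨b, hb, hbm, hbr, heb⟩ := hlast
  have hmid : ∀ t, t ≤ l → jlev L R x (r + 1) φ (L.card + t) = e t := by
    intro t ht
    rw [jlev_mid (by omega) (by omega), Nat.add_sub_cancel_left, he t ht]
  rw [h.stepColor_eq C γ hφ, runColor_bump γ (s := L.card) (p := L.card + u) (e := L.card + l)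
    (by omega) (by omega) (by omega) (fun Y hY => hC Y (by omega))]
  · have e1 : jlev L R x (r + 1) φ (L.card + u - 1) = e (u - 1) := by
      rw [show L.card + u - 1 = L.card + (u - 1) by omega, hmid _ (by omega)]
    have e2 : jlev L R x (r + 1) φ (L.card + u + 1) = e (u + 1) := by
      rw [add_assoc, hmid _ (by omega)]
    rw [e1, e2, show L.card + r + R.card - (L.card + l) = r - l + R.card by omega]
  · intro j h1 h2
    obtain ⟨t, rfl⟩ := Nat.exists_eq_add_of_le h1
    rw [add_assoc, hmid _ (by omega), hmid _ (by omega)]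
    exact hup t (by omega)
  · intro j h1 h2
    obtain ⟨t, rfl⟩ := Nat.exists_eq_add_of_le (show L.card ≤ j by omega)
    rw [add_assoc, hmid _ (by omega), hmid _ (by omega)]
    exact hdown t (by omega) (by omega)
  · intro hL
    have h0 := hmid 0 (by omega)
    rw [add_zero] at h0
    have hφ0 := hφ.2 0 (by omega)
    rw [h0, jlev_left_end (by omega) (by omega),
      lev_eq_max (y := x a) (h.left_lt _ (enumNat_mem (by omega)) _ (by omega)).le
        (hx.monotoneOn (Set.mem_Iio.2 (by omega)) (Set.mem_Iio.2 hφ0) (by omega))]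
    exact lt_max_of_lt_right hea
  · intro hn
    rw [hmid l le_rfl]
    rcases Nat.lt_or_ge (l + 1) r with h1 | h1
    · have h2 := hφ.lt (show l + 1 < l + 1 + 1 by omega) (by omega)
      rw [jlev_mid (by omega) (by omega), show L.card + l + 1 - L.card = l + 1 by omega]
      exact heb.trans_le (lev_mono_seq hx le_rfl hb.le (hbr h1) (hφ.2 _ (by omega)))
    · rw [jlev_right_end (by omega) (by omega), show r + 1 - 1 = l + 1 by omega,
        lev_eq_max (y := x b)
        (hx.monotoneOn (Set.mem_Iio.2 (by omega)) (Set.mem_Iio.2 hbm) hb.le)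
        (h.lt_right _ (enumNat_mem (by omega)) _ hbm).le]
      exact lt_max_of_lt_left heb

theorem lev_eq_of_forall_le {x : ℕ → ℕ} {m : ℕ} (hx : StrictMonoOn x (Set.Iio m)) {a b c : ℕ}
    (hac : a ≤ c) (hcb : c < b) (hb : b < m)
    (hmax : ∀ u, a ≤ u → u < b → lev (x u) (x (u + 1)) ≤ lev (x c) (x (c + 1))) :
    lev (x a) (x b) = lev (x c) (x (c + 1)) := by
  obtain ⟨u, h1, h2, h3⟩ := exists_lev_eq hx (show a < b by omega) hb
  have h4 := lev_mono_seq hx hac (show c ≤ c + 1 by omega) hcb hb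
  have := hmax u h1 h2
  omega

/-- The stepping-up lemma for uniformities `r ≥ 4`. -/
theorem IsDaisyGood.stepColor {C : Finset ℕ → ZMod 2} {r p m k N : ℕ}
    (hG : IsDaisyGood C r p k N) (hr : 4 ≤ r) (hp : 1 ≤ p) (hN : 0 < N)
    (hC : ∀ Y : Finset ℕ, Y.card < r → C Y = 0) (hm : (4 * p + 2) * (4 * p) + r ≤ m) :
    IsDaisyGood (stepColor C (fun j _ _ => (j : ZMod 2)) r) (r + 1) m k (2 ^ N) := by
  refine isDaisyGood_of_forall_not_isBad fun L R x A B h => ?_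
  set n := (4 * p + 2) * (4 * p) with hn
  have hx := h.strictMonoOn
  set d : ℕ → ℕ := fun i => lev (x i) (x (i + 1)) with hd
  have htame : IsTame n (2 * p) d := hG.isTame (by omega) hp hN h (n := n) (by omega)
  obtain ⟨i, c₀, j, hi0, hic, hcj, hjn, h1, h2, h3, h4, h5, h6⟩ :=
    htame.exists_two_valleys (by rw [hn]; apply le_of_eq; ring)
  -- the largest term strictly between the valleys
  obtain ⟨c, hc, hcmax⟩ := (Finset.Ico (i + 2) (j - 1)).exists_max_image d
    ⟨c₀, Finset.mem_Ico.2 ⟨hic, by omega⟩⟩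
  rw [Finset.mem_Ico] at hc
  have hc₀ := hcmax c₀ (Finset.mem_Ico.2 ⟨hic, by omega⟩)
  have hmax : ∀ u, i + 1 ≤ u → u < j → d u ≤ d c := by
    intro u hu1 hu2
    rcases hu1.eq_or_lt with rfl | hu1
    · omega
    rcases Nat.lt_or_ge u (j - 1) with hu3 | hu3
    · exact hcmax u (Finset.mem_Ico.2 ⟨hu1, hu3⟩)
    · rw [show u = j - 1 by omega]; omega
  set φ : ℕ → ℕ := fun t => if t < 3 then i + t else j + t - 3 with hφdef
  set φ' : ℕ → ℕ := fun t => if t < 2 then i + t else j + t - 3 with hφ'def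
  have hφ : IsSel (r + 1) m φ := by
    refine ⟨fun a ha b hb hab => ?_, fun a ha => ?_⟩
    · simp only [hφdef]; split_ifs <;> omega
    · simp only [hφdef]; split_ifs <;> omega
  have hφ' : IsSel (r + 1) m φ' := by
    refine ⟨fun a ha b hb hab => ?_, fun a ha => ?_⟩
    · simp only [hφ'def]; split_ifs <;> omega
    · simp only [hφ'def]; split_ifs <;> omega
  have hp0 : φ 0 = i := rfl
  have hp1 : φ 1 = i + 1 := rfl
  have hp2 : φ 2 = i + 2 := rfl
  have hp3 : φ 3 = j := rfl
  have hp4 : φ 4 = j + 1 := rfl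
  have hq0 : φ' 0 = i := rfl
  have hq1 : φ' 1 = i + 1 := rfl
  have hq2 : φ' 2 = j - 1 := rfl
  have hq3 : φ' 3 = j := rfl
  have hq4 : φ' 4 = j + 1 := rfl
  have hqp : ∀ t, 3 ≤ t → φ' t = φ t := fun t ht => by
    simp only [hφdef, hφ'def]; rw [if_neg (by omega), if_neg (by omega)]
  have hj1 : j - 1 + 1 = j := by omega
  have hi1 : i - 1 + 1 = i := by omega
  have hdi : lev (x (i - 1)) (x i) = d (i - 1) := by simp only [hd, hi1]
  have hfirst : d i < lev (x (i - 1)) (x i) := by rw [hdi]; exact h1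
  have Q1 : lev (x (i + 2)) (x j) = d c :=
    lev_eq_of_forall_le hx hc.1 (by omega) (by omega) fun u hu1 hu2 => hmax u (by omega) hu2
  have Q2 : lev (x (i + 1)) (x (j - 1)) = d c :=
    lev_eq_of_forall_le hx (by omega) hc.2 (by omega) fun u hu1 hu2 => hmax u hu1 (by omega)
  have E1 := h.stepColor_eq_bump (C := C) (fun j _ _ => (j : ZMod 2)) (u := 2) (l := 3) hφ
    (by omega) (by omega) (by omega) (fun Y hY => hC Y (by omega))
    (e := fun t => if t = 0 then d i else if t = 1 then d (i + 1) else if t = 2 then d c else d j)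
    (by
      intro t ht
      interval_cases t
      · rfl
      · rfl
      · exact Q1
      · rfl)
    (by
      intro t ht
      interval_cases t
      · exact h2
      · change d (i + 1) < d c; omega)
    (by
      intro t ht ht'
      interval_cases t
      change d j < d c; omega)
    ⟨i - 1, by omega, hfirst⟩
    ⟨j + 2, (by show j + 1 < j + 2; omega), by omega, fun _ => le_rfl, h6⟩
  have E2 := h.stepColor_eq_bump (C := C) (fun j _ _ => (j : ZMod 2)) (u := 1) (l := 3) hφ'
    (by omega) (by omega) (by omega) (fun Y hY => hC Y (by omega))
    (e := fun t => if t = 0 then d i else if t = 1 then d c else if t = 2 then d (j - 1) else d j)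
    (by
      intro t ht
      interval_cases t
      · rfl
      · exact Q2
      · change lev (x (j - 1)) (x j) = d (j - 1)
        simp only [hd, hj1]
      · rfl)
    (by
      intro t ht
      interval_cases t
      change d i < d c; omega)
    (by
      intro t ht ht'
      interval_cases t
      · change d (j - 1) < d c; omega
      · exact h5)
    ⟨i - 1, by omega, hfirst⟩
    ⟨j + 2, (by show j + 1 < j + 2; omega), by omega, fun _ => le_rfl, h6⟩
  have R1 : runColor C (fun j _ _ => (j : ZMod 2)) (L.card + 1) (jlev L R x (r + 1) φ) =
      runColor C (fun j _ _ => (j : ZMod 2)) (L.card + 1) (jlev L R x (r + 1) φ') := by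
    refine runColor_congr fun t ht => ?_
    rcases Nat.lt_or_ge t L.card with ht' | ht'
    · exact jlev_congr_left ht' (by omega) fun _ => by rw [hp0, hq0]
    · rw [jlev_mid ht' (by omega), jlev_mid ht' (by omega), show t - L.card = 0 by omega, hp0,
        hq0, zero_add, hp1, hq1]
  have R2 : (fun i => jlev L R x (r + 1) φ (i + (L.card + 3))) =
      fun i => jlev L R x (r + 1) φ' (i + (L.card + 3)) := by
    funext t
    rcases Nat.lt_or_ge (t + (L.card + 3) + 1) (L.card + (r + 1)) with ht' | ht'
    · rw [jlev_mid (by omega) ht', jlev_mid (by omega) ht', hqp _ (by omega), hqp _ (by omega)]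
    · exact jlev_congr_right ht' (by omega) fun _ => by rw [hqp _ (by omega)]
  have F1 := h.eq_add φ hφ
  have F2 := h.eq_add φ' hφ'
  rw [hqp (r + 1 - 1) (by omega), hq0] at F2
  rw [hp0] at F1
  rw [F1, R1, R2] at E1
  rw [F2, E1] at E2
  have : ((L.card + 2 : ℕ) : ZMod 2) = ((L.card + 1 : ℕ) : ZMod 2) := by
    linear_combination E2
  push_cast at this
  have h10 : (1 : ZMod 2) = 0 := by linear_combination this
  exact one_ne_zero h10

theorem stepColor_eq_zero (C : Finset ℕ → ZMod 2) (γ : ℕ → ℕ → ℕ → ZMod 2) {r : ℕ}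
    {X : Finset ℕ} (hX : X.card < r + 1) : stepColor C γ r X = 0 := if_pos hX

open Classical in
/-- The indices `i < n` that have a larger term both before and after them. -/
noncomputable def innerIndices (n : ℕ) (d : ℕ → ℕ) : Finset ℕ :=
  (Finset.range n).filter fun i => (∃ a < i, d i < d a) ∧ ∃ b < n, i < b ∧ d i < d b

open Classical in
/-- The inner indices whose value is not repeated at a later inner index. -/
noncomputable def lastInner (n : ℕ) (d : ℕ → ℕ) : Finset ℕ :=
  (innerIndices n d).filter fun i => ∀ j ∈ innerIndices n d, i < j → d j ≠ d i

open Classical in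
/-- The pairs of indices in `lastInner` that have a larger term in between. -/
noncomputable def goodPairs (n : ℕ) (d : ℕ → ℕ) : Finset (ℕ × ℕ) :=
  (lastInner n d ×ˢ lastInner n d).filter fun e =>
    ∃ c, e.1 < c ∧ c < e.2 ∧ d e.1 < d c ∧ d e.2 < d c

/-- On pairs of inner indices with a larger term in between, `ρ` splits as a sum. -/
def SplitsOn (ρ : ℕ → ℕ → ZMod 2) (n : ℕ) (d : ℕ → ℕ) (u v : ℕ → ZMod 2) : Prop :=
  ∀ i ∈ innerIndices n d, ∀ j ∈ innerIndices n d, ∀ c, i < c → c < j → d i < d c → d j < d c →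
    ρ (d i) (d j) = u i + v j

theorem lastInner_subset (n : ℕ) (d : ℕ → ℕ) : lastInner n d ⊆ innerIndices n d :=
  Finset.filter_subset _ _

theorem innerIndices_subset (n : ℕ) (d : ℕ → ℕ) : innerIndices n d ⊆ Finset.range n :=
  Finset.filter_subset _ _

theorem injOn_lastInner (n : ℕ) (d : ℕ → ℕ) : Set.InjOn d (lastInner n d) := by
  intro i hi j hj hij
  by_contra hne
  rcases lt_or_gt_of_ne hne with h | h
  · exact (Finset.mem_filter.1 (Finset.mem_coe.1 hi)).2 j (lastInner_subset _ _ hj) h hij.symm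
  · exact (Finset.mem_filter.1 (Finset.mem_coe.1 hj)).2 i (lastInner_subset _ _ hi) h hij

theorem innerIndices_congr {n : ℕ} {d d' : ℕ → ℕ} (h : ∀ i < n, d i = d' i) :
    innerIndices n d = innerIndices n d' := by
  classical
  refine Finset.filter_congr fun i hi => ?_
  rw [Finset.mem_range] at hi
  refine and_congr ⟨?_, ?_⟩ ⟨?_, ?_⟩
  · rintro ⟨a, h1, h2⟩
    exact ⟨a, h1, by rwa [← h i hi, ← h a (by omega)]⟩
  · rintro ⟨a, h1, h2⟩
    exact ⟨a, h1, by rwa [h i hi, h a (by omega)]⟩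
  · rintro ⟨a, h1, h2, h3⟩
    exact ⟨a, h1, h2, by rwa [← h i hi, ← h a h1]⟩
  · rintro ⟨a, h1, h2, h3⟩
    exact ⟨a, h1, h2, by rwa [h i hi, h a h1]⟩

theorem goodPairs_congr {n : ℕ} {d d' : ℕ → ℕ} (h : ∀ i < n, d i = d' i) :
    goodPairs n d = goodPairs n d' := by
  classical
  have h1 : lastInner n d = lastInner n d' := by
    unfold lastInner
    rw [innerIndices_congr h]
    refine Finset.filter_congr fun i hi => ?_
    have hi' := Finset.mem_range.1 (innerIndices_subset _ _ hi)
    refine forall₂_congr fun j hj => ?_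
    have hj' := Finset.mem_range.1 (innerIndices_subset _ _ hj)
    rw [h i hi', h j hj']
  unfold goodPairs
  rw [h1]
  refine Finset.filter_congr fun e he => ?_
  rw [Finset.mem_product] at he
  have hi := Finset.mem_range.1 (innerIndices_subset _ _ (lastInner_subset _ _ he.1))
  have hj := Finset.mem_range.1 (innerIndices_subset _ _ (lastInner_subset _ _ he.2))
  rw [h _ hi, h _ hj]
  refine exists_congr fun c => and_congr_right fun _ => and_congr_right fun h3 => ?_
  rw [h c (by omega)]

theorem two_mul_card_filter_lt (I : Finset ℕ) :
    I.card * (I.card - 1) = 2 * ((I ×ˢ I).filter fun e => e.1 < e.2).card := by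
  have h1 : I.offDiag = ((I ×ˢ I).filter fun e => e.1 < e.2) ∪
      ((I ×ˢ I).filter fun e => e.1 < e.2).image Prod.swap := by
    ext ⟨a, b⟩
    simp only [Finset.mem_offDiag, Finset.mem_union, Finset.mem_filter, Finset.mem_product,
      Finset.mem_image, Prod.exists, Prod.swap_prod_mk, Prod.mk.injEq]
    constructor
    · rintro ⟨ha, hb, hne⟩
      rcases lt_or_gt_of_ne hne with h | h
      · exact Or.inl ⟨⟨ha, hb⟩, h⟩
      · exact Or.inr ⟨b, a, ⟨⟨hb, ha⟩, h⟩, rfl, rfl⟩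
    · rintro (⟨⟨ha, hb⟩, h⟩ | ⟨a', b', ⟨⟨ha, hb⟩, h⟩, rfl, rfl⟩)
      · exact ⟨ha, hb, h.ne⟩
      · exact ⟨hb, ha, h.ne'⟩
  have h2 := congrArg Finset.card h1
  rw [Finset.offDiag_card, Finset.card_union_of_disjoint, Finset.card_image_of_injective _
    Prod.swap_injective] at h2
  · rw [Nat.mul_sub, mul_one, h2]
    ring
  · rw [Finset.disjoint_left]
    rintro ⟨a, b⟩ h3 h4
    simp only [Finset.mem_filter, Finset.mem_product,
      Finset.mem_image, Prod.exists, Prod.swap_prod_mk, Prod.mk.injEq] at h3 h4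
    obtain ⟨a', b', ⟨-, h⟩, rfl, rfl⟩ := h4
    omega

theorem two_mul_card_le_of_isPeak {n : ℕ} {d : ℕ → ℕ} {P : Finset ℕ}
    (hP : ∀ c ∈ P, IsPeak n d c) : 2 * P.card ≤ n := by
  have h1 : (P.image fun c => c - 1).card = P.card := by
    refine Finset.card_image_of_injOn fun a ha b hb hab => ?_
    have := (hP a ha).1
    have := (hP b hb).1
    omega
  have h2 : Disjoint P (P.image fun c => c - 1) := by
    rw [Finset.disjoint_left]
    intro a ha ha'
    obtain ⟨b, hb, rfl⟩ := Finset.mem_image.1 ha'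
    have h3 := (hP b hb)
    have h4 := (hP _ ha)
    have h5 := h4.2.2.2
    rw [Nat.sub_add_cancel h3.1] at h5
    have := h3.2.2.1
    omega
  have h3 : P ∪ (P.image fun c => c - 1) ⊆ Finset.range n := by
    intro a ha
    rw [Finset.mem_range]
    rcases Finset.mem_union.1 ha with ha | ha
    · have := (hP a ha).2.1
      omega
    · obtain ⟨b, hb, rfl⟩ := Finset.mem_image.1 ha
      have := (hP b hb).2.1
      omega
  have h4 := Finset.card_le_card h3
  rw [Finset.card_union_of_disjoint h2, h1, Finset.card_range] at h4
  omega

namespace IsTame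

variable {n q : ℕ} {d : ℕ → ℕ}

theorem card_lt_of_dec' (h : IsTame n q d) {I : Finset ℕ} (hI : I ⊆ Finset.range n)
    (hd : ∀ i ∈ I, ∀ j ∈ I, ∀ t, i < t → t ≤ j → d t ≤ d i) : I.card < q := by
  refine h.card_lt_of_dec I hI fun i hi j hj t h1 h2 => ?_
  refine lt_of_le_of_ne (hd i hi j hj t h1 h2) fun he => ?_
  have hjn := Finset.mem_range.1 (hI hj)
  obtain ⟨u, h3, h4, h5⟩ := h.exists_between i t h1 (by omega) he.symm
  have := hd i hi j hj u h3 (by omega)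
  omega

theorem card_lt_of_inc' (h : IsTame n q d) {I : Finset ℕ} (hI : I ⊆ Finset.range n)
    (hd : ∀ i ∈ I, ∀ j ∈ I, ∀ t, i ≤ t → t < j → d t ≤ d j) : I.card < q := by
  refine h.card_lt_of_inc I hI fun i hi j hj t h1 h2 => ?_
  refine lt_of_le_of_ne (hd i hi j hj t h1 h2) fun he => ?_
  have hjn := Finset.mem_range.1 (hI hj)
  obtain ⟨u, h3, h4, h5⟩ := h.exists_between t j h2 hjn he
  have := hd i hi j hj u (by omega) h4
  omega

theorem le_card_innerIndices (h : IsTame n q d) : n ≤ (innerIndices n d).card + 2 * q := by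
  classical
  have h1 := h.card_lt_of_inc' (I := (Finset.range n).filter fun i => ∀ a < i, d a ≤ d i)
    (Finset.filter_subset _ _) (by
      intro i _ j hj t _ h2
      exact (Finset.mem_filter.1 hj).2 t h2)
  have h2 := h.card_lt_of_dec' (I := (Finset.range n).filter fun i => ∀ b < n, i < b → d b ≤ d i)
    (Finset.filter_subset _ _) (by
      intro i hi j hj t h1 h2
      have := Finset.mem_range.1 (Finset.mem_filter.1 hj).1
      exact (Finset.mem_filter.1 hi).2 t (by omega) h1)
  have h3 : Finset.range n ⊆ innerIndices n d ∪
      (((Finset.range n).filter fun i => ∀ a < i, d a ≤ d i) ∪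
      ((Finset.range n).filter fun i => ∀ b < n, i < b → d b ≤ d i)) := by
    intro i hi
    simp only [Finset.mem_union, innerIndices, Finset.mem_filter]
    by_cases c1 : ∀ a < i, d a ≤ d i
    · exact Or.inr (Or.inl ⟨hi, c1⟩)
    by_cases c2 : ∀ b < n, i < b → d b ≤ d i
    · exact Or.inr (Or.inr ⟨hi, c2⟩)
    push Not at c1 c2
    exact Or.inl ⟨hi, c1, c2⟩
  have h4 := (Finset.card_le_card h3).trans ((Finset.card_union_le _ _).trans
    (Nat.add_le_add_left (Finset.card_union_le _ _) _))
  rw [Finset.card_range] at h4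
  omega

theorem two_mul_card_sdiff_lastInner (h : IsTame n q d) {ρ : ℕ → ℕ → ZMod 2} {u v : ℕ → ZMod 2}
    (hρ : SplitsOn ρ n d u v) (hself : ∀ i < n, ρ (d i) (d i) = 0)
    (hpair : ∀ i < n, ∀ j < n, d i ≠ d j → ρ (d i) (d j) + ρ (d j) (d i) = 1) :
    2 * (innerIndices n d \ lastInner n d).card ≤ n := by
  classical
  have key : ∀ i ∈ innerIndices n d \ lastInner n d, ∃ j c, j ∈ innerIndices n d ∧ d j = d i ∧
      i < c ∧ c < j ∧ d i < d c ∧ IsPeak n d c ∧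
      ∀ j' ∈ innerIndices n d, i < j' → d j' = d i → j ≤ j' := by
    intro i hi
    rw [Finset.mem_sdiff] at hi
    have hex : ∃ j, j ∈ innerIndices n d ∧ i < j ∧ d j = d i := by
      by_contra! hcon
      exact hi.2 (Finset.mem_filter.2 ⟨hi.1, hcon⟩)
    obtain ⟨h1, h2, h3⟩ := Nat.find_spec hex
    have hjn := Finset.mem_range.1 (innerIndices_subset _ _ h1)
    obtain ⟨t, h4, h5, h6⟩ := h.exists_between i _ h2 hjn h3.symm
    obtain ⟨c, h7, h8, h9, -, h10⟩ := h.exists_isPeak_of_between h4 h5 hjn h6 (by omega)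
    exact ⟨_, c, h1, h3, h7, h8, by omega, h10, fun j' a1 a2 a3 => Nat.find_min' hex ⟨a1, a2, a3⟩⟩
  choose! J P hJ hJd hiP hPJ hdP hpeak hmin using key
  have haux : ∀ a ∈ innerIndices n d \ lastInner n d, ∀ b ∈ innerIndices n d \ lastInner n d,
      a < b → P a ≠ P b := by
    intro a ha b hb hab hP
    have ha' := (Finset.mem_sdiff.1 ha).1
    have hb' := (Finset.mem_sdiff.1 hb).1
    have hne : d a ≠ d b := fun he => by
      have h1 := hmin a ha b hb' hab he.symm
      have h2 := hPJ a ha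
      have h3 := hiP b hb
      omega
    have e1 := hρ a ha' (J a) (hJ a ha) (P a) (hiP a ha) (hPJ a ha) (hdP a ha)
      (by rw [hJd a ha]; exact hdP a ha)
    have e2 := hρ b hb' (J b) (hJ b hb) (P b) (hiP b hb) (hPJ b hb) (hdP b hb)
      (by rw [hJd b hb]; exact hdP b hb)
    have e3 := hρ a ha' (J b) (hJ b hb) (P a) (hiP a ha) (by rw [hP]; exact hPJ b hb) (hdP a ha)
      (by rw [hJd b hb, hP]; exact hdP b hb)
    have e4 := hρ b hb' (J a) (hJ a ha) (P b) (hiP b hb) (by rw [← hP]; exact hPJ a ha)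
      (hdP b hb) (by rw [hJd a ha, ← hP]; exact hdP a ha)
    have han := Finset.mem_range.1 (innerIndices_subset _ _ ha')
    have hbn := Finset.mem_range.1 (innerIndices_subset _ _ hb')
    rw [hJd a ha, hself a han] at e1
    rw [hJd b hb, hself b hbn] at e2
    rw [hJd b hb] at e3
    rw [hJd a ha] at e4
    have e5 := hpair a han b hbn hne
    have : (1 : ZMod 2) = 0 := by linear_combination e3 + e4 - e5 - e1 - e2
    exact one_ne_zero this
  have hinj : Set.InjOn P (innerIndices n d \ lastInner n d : Finset ℕ) := by
    intro a ha b hb hab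
    by_contra hne
    rcases lt_or_gt_of_ne hne with h1 | h1
    · exact haux a ha b hb h1 hab
    · exact haux b hb a ha h1 hab.symm
  rw [← Finset.card_image_of_injOn hinj]
  refine two_mul_card_le_of_isPeak (d := d) fun c hc => ?_
  obtain ⟨i, hi, rfl⟩ := Finset.mem_image.1 hc
  exact hpeak i hi

theorem le_card_goodPairs (h : IsTame n q d) :
    (lastInner n d).card * ((lastInner n d).card - 1) ≤
      2 * (goodPairs n d).card + 4 * (n * q) := by
  classical
  have hsub : lastInner n d ⊆ Finset.range n :=
    (lastInner_subset _ _).trans (innerIndices_subset _ _)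
  set X : ℕ → Finset ℕ := fun j => (lastInner n d).filter fun i => i < j ∧
    ∀ c, i < c → c < j → d c ≤ d i with hX
  set Y : ℕ → Finset ℕ := fun i => (lastInner n d).filter fun j => i < j ∧
    ∀ c, i < c → c < j → d c ≤ d j with hY
  have hXq : ∀ j, (X j).card ≤ q := fun j => (h.card_lt_of_dec'
    ((Finset.filter_subset _ _).trans hsub) (by
      intro a ha b hb t h1 h2
      exact (Finset.mem_filter.1 ha).2.2 t h1 (by
        have := (Finset.mem_filter.1 hb).2.1
        omega))).le
  have hYq : ∀ j, (Y j).card ≤ q := fun j => (h.card_lt_of_inc'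
    ((Finset.filter_subset _ _).trans hsub) (by
      intro a ha b hb t h1 h2
      exact (Finset.mem_filter.1 hb).2.2 t (by
        have := (Finset.mem_filter.1 ha).2.1
        omega) h2)).le
  have hcov : ((lastInner n d ×ˢ lastInner n d).filter fun e => e.1 < e.2) ⊆
      goodPairs n d ∪ (((Finset.range n).sigma X).image (fun s => (s.2, s.1)) ∪
        ((Finset.range n).sigma Y).image (fun s => (s.1, s.2))) := by
    rintro ⟨i, j⟩ he
    rw [Finset.mem_filter, Finset.mem_product] at he
    obtain ⟨⟨hi, hj⟩, hij⟩ := he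
    simp only at hi hj hij
    by_cases hg : ∃ c, i < c ∧ c < j ∧ d i < d c ∧ d j < d c
    · exact Finset.mem_union_left _ (Finset.mem_filter.2 ⟨Finset.mem_product.2 ⟨hi, hj⟩, hg⟩)
    push Not at hg
    refine Finset.mem_union_right _ (Finset.mem_union.2 ?_)
    rcases le_total (d j) (d i) with h1 | h1
    · left
      have h2 : ∀ c, i < c → c < j → d c ≤ d i := fun c h2 h3 => by
        by_contra! h4
        have := hg c h2 h3 h4
        omega
      exact Finset.mem_image.2 ⟨⟨j, i⟩, Finset.mem_sigma.2 ⟨hsub hj,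
        Finset.mem_filter.2 ⟨hi, hij, h2⟩⟩, rfl⟩
    · right
      have h2 : ∀ c, i < c → c < j → d c ≤ d j := fun c h2 h3 => by
        by_contra! h4
        have := hg c h2 h3 (by omega)
        omega
      exact Finset.mem_image.2 ⟨⟨i, j⟩, Finset.mem_sigma.2 ⟨hsub hi,
        Finset.mem_filter.2 ⟨hj, hij, h2⟩⟩, rfl⟩
  have hc := (Finset.card_le_card hcov).trans ((Finset.card_union_le _ _).trans
    (Nat.add_le_add_left (Finset.card_union_le _ _) _))
  have hcX : (((Finset.range n).sigma X).image (fun s => (s.2, s.1))).card ≤ n * q := by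
    refine Finset.card_image_le.trans ?_
    rw [Finset.card_sigma]
    refine (Finset.sum_le_card_nsmul _ _ q fun j _ => hXq j).trans ?_
    rw [Finset.card_range, smul_eq_mul]
  have hcY : (((Finset.range n).sigma Y).image (fun s => (s.1, s.2))).card ≤ n * q := by
    refine Finset.card_image_le.trans ?_
    rw [Finset.card_sigma]
    refine (Finset.sum_le_card_nsmul _ _ q fun j _ => hYq j).trans ?_
    rw [Finset.card_range, smul_eq_mul]
  rw [two_mul_card_filter_lt]
  omega

end IsTame

theorem IsBad.exists_splitsOn {C : Finset ℕ → ZMod 2} {ρ : ℕ → ℕ → ZMod 2} {m k N n : ℕ}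
    {L R : Finset ℕ} {x : ℕ → ℕ} {A B : ℕ → ZMod 2}
    (h : IsBad (stepColor C (fun _ a b => ρ a b) 3) 4 m k N L R x A B)
    (hC : ∀ Y : Finset ℕ, Y.card < 3 → C Y = 0) (hn : n < m) :
    ∃ u v, SplitsOn ρ n (fun i => lev (x i) (x (i + 1))) u v := by
  set d : ℕ → ℕ := fun i => lev (x i) (x (i + 1)) with hd
  have hx := h.strictMonoOn
  refine ⟨fun i => A i - runColor C (fun _ a b => ρ a b) (L.card + 1)
      (jlev L R x 4 fun t => i + t),
    fun j => B (j + 1) - runColor C (fun _ a b => ρ a b) (1 + R.card)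
      (fun s => jlev L R x 4 (fun t => j - 2 + t) (s + (L.card + 2))), ?_⟩
  intro i hi j hj c₀ hic₀ hcj₀ h1 h2
  obtain ⟨hin, ⟨a, ha, hda⟩, -⟩ := Finset.mem_filter.1 hi
  obtain ⟨hjn, -, b, hb, hjb, hdb⟩ := Finset.mem_filter.1 hj
  rw [Finset.mem_range] at hin hjn
  obtain ⟨c, hc, hcmax⟩ := (Finset.Ico (i + 1) j).exists_max_image d
    ⟨c₀, Finset.mem_Ico.2 ⟨hic₀, hcj₀⟩⟩
  rw [Finset.mem_Ico] at hc
  have hc₀ := hcmax c₀ (Finset.mem_Ico.2 ⟨hic₀, hcj₀⟩)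
  set φ : ℕ → ℕ := fun t => if t < 2 then i + t else j + t - 2 with hφdef
  have hφ : IsSel 4 m φ := by
    refine ⟨fun a ha b hb hab => ?_, fun a ha => ?_⟩
    · rw [Set.mem_Iio] at ha hb
      simp only [hφdef]; split_ifs <;> omega
    · simp only [hφdef]; split_ifs <;> omega
  have hp0 : φ 0 = i := rfl
  have hp1 : φ 1 = i + 1 := rfl
  have hp2 : φ 2 = j := rfl
  have hp3 : φ 3 = j + 1 := rfl
  have hlev : lev (x (i + 1)) (x j) = d c :=
    lev_eq_of_forall_le hx hc.1 hc.2 (by omega) fun u hu1 hu2 =>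
      hcmax u (Finset.mem_Ico.2 ⟨hu1, hu2⟩)
  have E := h.stepColor_eq_bump (C := C) (fun _ a b => ρ a b) (u := 1) (l := 2) hφ
    (by omega) (by omega) (by omega) hC
    (e := fun t => if t = 0 then d i else if t = 1 then d c else d j)
    (by
      intro t ht
      interval_cases t
      · rfl
      · exact hlev
      · rfl)
    (by
      intro t ht
      interval_cases t
      change d i < d c; omega)
    (by
      intro t ht ht'
      interval_cases t
      change d j < d c; omega)
    ⟨a, ha, lt_of_lt_of_le hda (lev_mono_seq hx le_rfl (by omega) (by omega) (by omega))⟩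
    ⟨b + 1, (by show j + 1 < b + 1; omega), by omega, fun h' => absurd h' (by omega),
      lt_of_lt_of_le hdb (lev_mono_seq hx (by rw [hp3]; omega) (by omega) le_rfl (by omega))⟩
  rw [h.eq_add φ hφ] at E
  have R1 : runColor C (fun _ a b => ρ a b) (L.card + 1) (jlev L R x 4 φ) =
      runColor C (fun _ a b => ρ a b) (L.card + 1) (jlev L R x 4 fun t => i + t) := by
    refine runColor_congr fun t ht => ?_
    rcases Nat.lt_or_ge t L.card with ht' | ht'
    · exact jlev_congr_left ht' (by omega) fun _ => by rw [hp0, add_zero]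
    · rw [jlev_mid ht' (by omega), jlev_mid ht' (by omega), show t - L.card = 0 by omega, hp0,
        zero_add, hp1, add_zero]
  have hq2 : j - 2 + 2 = j := by omega
  have hq3 : j - 2 + 3 = j + 1 := by omega
  have R2 : (fun s => jlev L R x 4 φ (s + (L.card + 2))) =
      fun s => jlev L R x 4 (fun t => j - 2 + t) (s + (L.card + 2)) := by
    funext t
    rcases Nat.lt_or_ge (t + (L.card + 2) + 1) (L.card + 4) with ht' | ht'
    · rw [jlev_mid (by omega) ht', jlev_mid (by omega) ht',
        show t + (L.card + 2) - L.card = 2 by omega, hp2, hq2, hq3, hp3]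
    · exact jlev_congr_right ht' (by omega) fun _ => by
        show lev (x (φ 3)) _ = lev (x (j - 2 + 3)) _
        rw [hq3, hp3]
  rw [R1] at E
  change A i + B (j + 1) = _ + ρ (d i) (d j) + runColor C (fun _ a b => ρ a b) (1 + R.card)
    (fun s => jlev L R x 4 φ (s + (L.card + 2))) at E
  rw [R2] at E
  change ρ (d i) (d j) = _ - _ + (_ - _)
  linear_combination -E

/-- The skew-symmetrization of a coloring of pairs. -/
def skewColor (ω : ℕ → ℕ → ZMod 2) (a b : ℕ) : ZMod 2 :=
  if a < b then ω a b else if b < a then ω b a + 1 else 0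

theorem skewColor_self (ω : ℕ → ℕ → ZMod 2) (a : ℕ) : skewColor ω a a = 0 := by
  simp [skewColor]

theorem skewColor_add_swap (ω : ℕ → ℕ → ZMod 2) {a b : ℕ} (h : a ≠ b) :
    skewColor ω a b + skewColor ω b a = 1 := by
  have h2 : ∀ z : ZMod 2, z + z = 0 := by decide
  unfold skewColor
  rcases lt_or_gt_of_ne h with h | h
  · rw [if_pos h, if_neg (by omega), if_pos h, ← add_assoc, h2, zero_add]
  · rw [if_neg (by omega), if_pos h, if_pos h, add_right_comm, h2, zero_add]

theorem skewColor_eq (ω : ℕ → ℕ → ZMod 2) {a b : ℕ} (h : a ≠ b) :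
    skewColor ω a b = ω (min a b) (max a b) + if a < b then 0 else 1 := by
  unfold skewColor
  rcases lt_or_gt_of_ne h with h | h
  · rw [if_pos h, if_pos h, min_eq_left h.le, max_eq_right h.le, add_zero]
  · rw [if_neg (by omega), if_pos h, if_neg (by omega), min_eq_right h.le, max_eq_left h.le]

theorem injOn_goodPairs (n : ℕ) (d : ℕ → ℕ) :
    Set.InjOn (fun e : ℕ × ℕ => (min (d e.1) (d e.2), max (d e.1) (d e.2))) (goodPairs n d) := by
  classical
  rintro ⟨i, j⟩ he ⟨i', j'⟩ he' hee
  obtain ⟨h1, c, h2, h3, -⟩ := Finset.mem_filter.1 (Finset.mem_coe.1 he)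
  obtain ⟨h1', c', h2', h3', -⟩ := Finset.mem_filter.1 (Finset.mem_coe.1 he')
  rw [Finset.mem_product] at h1 h1'
  simp only [Prod.mk.injEq] at h1 h1' h2 h2' h3 h3' hee ⊢
  have hI := injOn_lastInner n d
  have hcase : (d i = d i' ∧ d j = d j') ∨ (d i = d j' ∧ d j = d i') := by omega
  rcases hcase with ⟨h4, h5⟩ | ⟨h4, h5⟩
  · exact ⟨hI h1.1 h1'.1 h4, hI h1.2 h1'.2 h5⟩
  · have := hI h1.1 h1'.2 h4
    have := hI h1.2 h1'.1 h5
    omega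

/-- A coloring of pairs that splits on no level sequence with many good pairs. -/
theorem exists_forall_not_splitsOn {n N T : ℕ} (hN : 0 < N)
    (hT : (N * 4) ^ n < 2 ^ T) :
    ∃ ω : ℕ → ℕ → ZMod 2, ∀ d : ℕ → ℕ, (∀ i < n, d i < N) → T ≤ (goodPairs n d).card →
      ∀ u v, ¬ SplitsOn (skewColor ω) n d u v := by
  classical
  have : NeZero N := ⟨hN.ne'⟩
  set D : (Fin n → Fin N) → ℕ → ℕ := fun f => extendFin 0 fun i => (f i : ℕ) with hD
  have hcard : Fintype.card ((Fin n → Fin N) × (Fin n → ZMod 2) × (Fin n → ZMod 2)) < 2 ^ T := by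
    refine lt_of_eq_of_lt ?_ hT
    simp only [Fintype.card_prod, Fintype.card_fun, Fintype.card_fin, ZMod.card]
    rw [← mul_pow, ← mul_pow]
    norm_num
  obtain ⟨ω, hω⟩ := exists_forall_exists_ne (Ω := Fin N × Fin N) (ι := ℕ × ℕ) hcard
    (fun κ => goodPairs n (D κ.1))
    (fun κ e => (Fin.ofNat N (min (D κ.1 e.1) (D κ.1 e.2)),
      Fin.ofNat N (max (D κ.1 e.1) (D κ.1 e.2))))
    (fun κ e => extendFin 0 κ.2.1 e.1 + extendFin 0 κ.2.2 e.2 -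
      if D κ.1 e.1 < D κ.1 e.2 then 0 else 1)
  refine ⟨fun a b => ω (Fin.ofNat N a, Fin.ofNat N b), fun d hd hcd u v hs => ?_⟩
  set f : Fin n → Fin N := fun i => ⟨d i, hd i i.2⟩ with hf
  have hdf : ∀ i < n, D f i = d i := fun i hi => by
    rw [hD]; dsimp only; rw [extendFin_of_lt _ _ hi]
  have hgp := goodPairs_congr hdf
  have hlt : ∀ e ∈ goodPairs n d, e.1 < n ∧ e.2 < n := fun e he => by
    have h1 := Finset.mem_product.1 (Finset.mem_filter.1 he).1
    exact ⟨Finset.mem_range.1 (innerIndices_subset _ _ (lastInner_subset _ _ h1.1)),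
      Finset.mem_range.1 (innerIndices_subset _ _ (lastInner_subset _ _ h1.2))⟩
  obtain ⟨e, he, hne⟩ := hω (f, (fun i => u i), fun i => v i) (by rwa [hgp]) (by
    dsimp only
    rw [hgp]
    intro e he e' he' hee
    have h1 := hlt e he
    have h2 := hlt e' he'
    refine injOn_goodPairs n d he he' ?_
    simp only [hdf _ h1.1, hdf _ h1.2, hdf _ h2.1, hdf _ h2.2, Prod.mk.injEq, Fin.ext_iff,
      Fin.val_ofNat] at hee ⊢
    have := hd _ h1.1
    have := hd _ h1.2
    have := hd _ h2.1
    have := hd _ h2.2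
    rwa [Nat.mod_eq_of_lt (by omega), Nat.mod_eq_of_lt (by omega), Nat.mod_eq_of_lt (by omega),
      Nat.mod_eq_of_lt (by omega)] at hee)
  dsimp only at he hne
  rw [hgp] at he
  have h1 := hlt e he
  rw [hdf _ h1.1, hdf _ h1.2, extendFin_of_lt _ _ h1.1, extendFin_of_lt _ _ h1.2] at hne
  obtain ⟨h2, c, h3, h4, h5, h6⟩ := Finset.mem_filter.1 he
  rw [Finset.mem_product] at h2
  have h7 := hs _ (lastInner_subset _ _ h2.1) _ (lastInner_subset _ _ h2.2) c h3 h4 h5 h6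
  have h8 : d e.1 ≠ d e.2 := fun h => by
    have := injOn_lastInner n d h2.1 h2.2 h
    omega
  rw [skewColor_eq _ h8] at h7
  exact hne (by rw [← h7]; ring)

/-- The case of uniformity `4`. -/
theorem exists_isDaisyGood_four {k t : ℕ} (ht : 4000 ≤ t) (hk : 4 * k + 4 ≤ t) :
    ∃ C : Finset ℕ → ZMod 2, (∀ Y : Finset ℕ, Y.card < 4 → C Y = 0) ∧
      IsDaisyGood C 4 (100 * t) k (2 ^ 2 ^ t) := by
  set q := t / 4 with hq
  obtain ⟨C, hC, hG⟩ := exists_isDaisyGood_three (q := q) (k := k) (t := t) (by omega) (by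
    have h1 : t ≤ 4 * q + 3 := by omega
    have h2 : 1000 ≤ q := by omega
    obtain ⟨s, hs⟩ := Nat.exists_eq_add_of_le h2
    rw [hs] at h1 ⊢
    rw [show 1000 + s - 1 = 999 + s by omega, show 1000 + s - 2 = 998 + s by omega]
    nlinarith)
  set n := 100 * t - 1 with hn
  obtain ⟨ω, hω⟩ := exists_forall_not_splitsOn (n := n) (N := 2 ^ t) (T := 1000 * t ^ 2)
    (by positivity) (by
      rw [show 2 ^ t * 4 = 2 ^ (t + 2) by ring, ← pow_mul]
      refine Nat.pow_lt_pow_right (by norm_num) ?_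
      have : (t + 2) * n ≤ (t + 2) * (100 * t) := Nat.mul_le_mul_left _ (by omega)
      nlinarith)
  refine ⟨stepColor C (fun _ a b => skewColor ω a b) 3, fun Y hY => stepColor_eq_zero _ _ hY, ?_⟩
  refine isDaisyGood_of_forall_not_isBad fun L R x A B h => ?_
  have hnm : n < 100 * t := by omega
  obtain ⟨u, v, hs⟩ := h.exists_splitsOn hC hnm
  have htame : IsTame n (2 * q) fun i => lev (x i) (x (i + 1)) :=
    hG.isTame (by omega) (by omega) (by positivity) h hnm
  refine hω _ (fun i hi => lev_lt (by positivity) (h.lt_bound _ (by omega))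
    (h.lt_bound _ (by omega))) ?_ u v hs
  have c1 := htame.le_card_innerIndices
  have c2 := htame.two_mul_card_sdiff_lastInner hs (fun i _ => skewColor_self _ _)
    fun i _ j _ hij => skewColor_add_swap _ hij
  have c3 := htame.le_card_goodPairs
  have c4 := Finset.card_sdiff_add_card_eq_card (lastInner_subset n fun i => lev (x i) (x (i + 1)))
  set l := (lastInner n fun i => lev (x i) (x (i + 1))).card
  have h1 : 49 * t - 1 ≤ l := by omega
  have h2 : (49 * t - 1) * (49 * t - 2) ≤ l * (l - 1) := Nat.mul_le_mul h1 (by omega)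
  have h3 : n * (2 * q) * 2 ≤ 100 * t * t := by
    have : n * (2 * q * 2) ≤ 100 * t * t := Nat.mul_le_mul (by omega) (by omega)
    nlinarith
  have h4 : (49 * t - 1) * (49 * t - 2) + 200 * t ≥ 2401 * t ^ 2 := by
    obtain ⟨s, rfl⟩ := Nat.exists_eq_add_of_le ht
    rw [show 49 * (4000 + s) - 1 = 49 * s + 195999 by omega,
      show 49 * (4000 + s) - 2 = 49 * s + 195998 by omega]
    nlinarith
  nlinarith

/-- The petal size needed for uniformity `s + 4` at level `t`. -/
def petalSize (t : ℕ) : ℕ → ℕ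
  | 0 => 100 * t
  | s + 1 => 20 * petalSize t s ^ 2

/-- The tower function on the natural numbers. -/
def natTower (t : ℕ) : ℕ → ℕ
  | 0 => t
  | i + 1 => 2 ^ natTower t i

theorem le_petalSize {t : ℕ} (ht : 1 ≤ t) (s : ℕ) : 100 * t ≤ petalSize t s := by
  induction s with
  | zero => exact le_rfl
  | succ s ih => rw [petalSize]; nlinarith

theorem petalSize_eq (t s : ℕ) : 20 * petalSize t s = (2000 * t) ^ 2 ^ s := by
  induction s with
  | zero => rw [petalSize]; ring
  | succ s ih => rw [petalSize, pow_succ 2 s, pow_mul, ← ih]; ring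

theorem exists_isDaisyGood {k t : ℕ} (ht : 4000 ≤ t) (hk : 4 * k + 4 ≤ t) {s : ℕ} (hs : s ≤ t) :
    ∃ C : Finset ℕ → ZMod 2, (∀ Y : Finset ℕ, Y.card < s + 4 → C Y = 0) ∧
      IsDaisyGood C (s + 4) (petalSize t s) k (natTower t (s + 2)) := by
  induction s with
  | zero => exact exists_isDaisyGood_four ht hk
  | succ s ih =>
    obtain ⟨C, hC, hG⟩ := ih (by omega)
    have hp := le_petalSize (t := t) (by omega) s
    refine ⟨_, fun Y hY => stepColor_eq_zero _ _ (by omega), hG.stepColor (by omega) (by omega)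
      (Nat.two_pow_pos _) hC ?_⟩
    rw [petalSize]
    nlinarith

theorem natTower_eq (t i : ℕ) : (natTower t i : ℝ) = tower i t := by
  induction i with
  | zero => rfl
  | succ i ih => rw [natTower, tower, ← ih, Real.rpow_natCast]; norm_num

theorem tower_mono {x y : ℝ} (h : x ≤ y) (i : ℕ) : tower i x ≤ tower i y := by
  induction i with
  | zero => exact h
  | succ i ih => exact Real.rpow_le_rpow_of_exponent_le (by norm_num) ih

theorem daisyRamsey_three_lower {k m : ℕ} (hk : 1 ≤ k) (hm : 200 * k ^ 2 ≤ m) :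
    tower 1 (1 / 4000 * (k : ℝ) ^ (-(2 : ℝ)) * (m : ℝ) ^ (2 : ℝ)) ≤ (daisyRamsey 3 m k : ℝ) := by
  set x := 1 / 4000 * (k : ℝ) ^ (-(2 : ℝ)) * (m : ℝ) ^ (2 : ℝ) with hx
  have hk' : (1 : ℝ) ≤ k := by exact_mod_cast hk
  have hm' : (200 : ℝ) * k ^ 2 ≤ m := by exact_mod_cast hm
  set z : ℝ := m / (2 * k) with hz
  have hxz : x = z ^ 2 / 1000 := by
    rw [hx, hz, Real.rpow_neg (by positivity), Real.rpow_two, Real.rpow_two]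
    field_simp
    ring
  have hz100 : 100 ≤ z := by
    rw [hz, le_div_iff₀ (by positivity)]
    nlinarith
  set t := ⌈x⌉₊ with ht
  have ht1 : (t : ℝ) < x + 1 := Nat.ceil_lt_add_one (by rw [hxz]; positivity)
  set q := m / (k + 1) with hq
  have hq1 : (k + 1) * q ≤ m := Nat.mul_div_le _ _
  have hkq : k ≤ q := (Nat.le_div_iff_mul_le (by omega)).2 (by nlinarith)
  have hq2 : z - 1 ≤ q := by
    have h1 : m < (k + 1) * (q + 1) := Nat.lt_mul_div_succ _ (by omega)
    have h2 : (m : ℝ) < (k + 1) * (q + 1) := by exact_mod_cast h1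
    have h3 : z ≤ q + 1 := by
      rw [hz, div_le_iff₀ (by positivity)]
      have : (0 : ℝ) ≤ q := by positivity
      nlinarith
    linarith
  have hq3 : 2 ≤ q := by
    have : (2 : ℝ) ≤ q := by linarith
    exact_mod_cast this
  obtain ⟨C, -, hG⟩ := exists_isDaisyGood_three (q := q) (k := k) (t := t) hkq (by
    have h1 : (12 : ℝ) * (t + 2) < (q - 1) * (q - 2) := by
      have h2 : (z - 2) * (z - 3) ≤ ((q : ℝ) - 1) * (q - 2) :=
        mul_le_mul (by linarith) (by linarith) (by linarith) (by linarith)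
      nlinarith
    have h3 : ((12 * (t + 2) : ℕ) : ℝ) < (((q - 1) * (q - 2) : ℕ) : ℝ) := by
      push_cast [Nat.cast_sub (show 1 ≤ q by omega), Nat.cast_sub hq3]
      exact h1
    exact_mod_cast h3)
  have h := hG.le_daisyRamsey (by omega) hq1
  calc tower 1 x ≤ tower 1 t := tower_mono (Nat.le_ceil x) 1
    _ = (natTower t 1 : ℝ) := (natTower_eq t 1).symm
    _ ≤ _ := by exact_mod_cast h

theorem mul_petalSize_le {k m s : ℕ} (hk : 1 ≤ k) {t : ℕ}
    (ht : (t : ℝ) ≤ 2 * (1 / 4000 * (k : ℝ) ^ (-(2 : ℝ)) * (m : ℝ) ^ (((2 : ℝ) ^ s)⁻¹))) :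
    (k + 1) * petalSize t s ≤ m := by
  have hk' : (1 : ℝ) ≤ k := by exact_mod_cast hk
  have hM : ((m : ℝ) ^ (((2 : ℝ) ^ s)⁻¹)) ^ 2 ^ s = m := by
    have := Real.rpow_inv_natCast_pow (x := (m : ℝ)) (n := 2 ^ s) (by positivity) (by positivity)
    push_cast at this
    exact this
  have h1 : (2000 * t : ℝ) ≤ ((k : ℝ) ^ 2)⁻¹ * (m : ℝ) ^ (((2 : ℝ) ^ s)⁻¹) := by
    rw [Real.rpow_neg (by positivity), Real.rpow_two] at ht
    linarith
  have h2 : (2000 * t : ℝ) ^ 2 ^ s ≤ ((k : ℝ) ^ 2)⁻¹ * m := by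
    refine (pow_le_pow_left₀ (by positivity) h1 _).trans ?_
    rw [mul_pow, hM]
    refine mul_le_mul_of_nonneg_right ?_ (by positivity)
    exact pow_le_of_le_one (by positivity) (inv_le_one_of_one_le₀ (by nlinarith)) (by positivity)
  have h3 : (20 * petalSize t s : ℝ) ≤ ((k : ℝ) ^ 2)⁻¹ * m := by
    have := petalSize_eq t s
    have h : (20 * petalSize t s : ℝ) = (2000 * t) ^ 2 ^ s := by exact_mod_cast this
    rw [h]
    exact h2
  have h4 : (k : ℝ) ^ 2 * (20 * petalSize t s) ≤ m := by
    have := mul_le_mul_of_nonneg_left h3 (show (0 : ℝ) ≤ (k : ℝ) ^ 2 by positivity)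
    rwa [← mul_assoc _ _ (m : ℝ), mul_inv_cancel₀ (by positivity), one_mul] at this
  have h5 : k ^ 2 * (20 * petalSize t s) ≤ m := by exact_mod_cast h4
  calc (k + 1) * petalSize t s ≤ (k ^ 2 * 20) * petalSize t s :=
        Nat.mul_le_mul_right _ (by nlinarith)
    _ ≤ m := by rwa [mul_assoc]

theorem daisyRamsey_four_lower {k s : ℕ} (hk : 1 ≤ k) :
    ∃ m₀ : ℕ, ∀ m : ℕ, m₀ ≤ m →
      tower (s + 2) (1 / 4000 * (k : ℝ) ^ (-(2 : ℝ)) * (m : ℝ) ^ (((2 : ℝ) ^ s)⁻¹)) ≤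
        (daisyRamsey (s + 4) m k : ℝ) := by
  have hk' : (0 : ℝ) < k := by exact_mod_cast hk
  have htend : Filter.Tendsto
      (fun m : ℕ => 1 / 4000 * (k : ℝ) ^ (-(2 : ℝ)) * (m : ℝ) ^ (((2 : ℝ) ^ s)⁻¹))
      Filter.atTop Filter.atTop :=
    ((tendsto_rpow_atTop (by positivity)).comp tendsto_natCast_atTop_atTop).const_mul_atTop
      (by positivity)
  obtain ⟨m₀, hm₀⟩ := Filter.eventually_atTop.1
    (htend.eventually_ge_atTop ((4004 + 4 * k + s : ℕ) : ℝ))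
  refine ⟨m₀, fun m hm => ?_⟩
  have hxm := hm₀ m hm
  set x := 1 / 4000 * (k : ℝ) ^ (-(2 : ℝ)) * (m : ℝ) ^ (((2 : ℝ) ^ s)⁻¹) with hx
  set t := ⌈x⌉₊ with ht
  have htK : 4004 + 4 * k + s ≤ t := by
    have : ((4004 + 4 * k + s : ℕ) : ℝ) ≤ t := hxm.trans (Nat.le_ceil x)
    exact_mod_cast this
  have hx1 : 1 ≤ x := le_trans (by exact_mod_cast (by omega : 1 ≤ 4004 + 4 * k + s)) hxm
  have ht2 : (t : ℝ) ≤ 2 * x := by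
    have : (t : ℝ) < x + 1 := Nat.ceil_lt_add_one (by linarith)
    linarith
  obtain ⟨C, -, hG⟩ := exists_isDaisyGood (k := k) (t := t) (s := s) (by omega) (by omega)
    (by omega)
  have h := hG.le_daisyRamsey (by have := le_petalSize (t := t) (by omega) s; omega)
    (mul_petalSize_le hk ht2)
  calc tower (s + 2) x ≤ tower (s + 2) t := tower_mono (Nat.le_ceil x) _
    _ = (natTower t (s + 2) : ℝ) := (natTower_eq t _).symm
    _ ≤ _ := by exact_mod_cast h

/-- Main theorem: there is an absolute constant `c > 0` such that for all `r ≥ 3`,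
`k ≥ 1` there is `m₀ = m₀(r,k)` with
`D_r(m,k) ≥ t_{r-2}(c · k^{-2} · m^{2^{4-r}})` for all `m ≥ m₀`. -/
theorem daisyRamsey_lower : ∃ c : ℝ, 0 < c ∧
    ∀ r k : ℕ, 3 ≤ r → 1 ≤ k → ∃ m₀ : ℕ, ∀ m : ℕ, m₀ ≤ m →
      tower (r - 2)
        (c * (k : ℝ) ^ (-(2 : ℝ)) * (m : ℝ) ^ ((2 : ℝ) ^ ((4 : ℝ) - (r : ℝ))))
        ≤ (daisyRamsey r m k : ℝ) := by
  refine ⟨1 / 4000, by norm_num, fun r k hr hk => ?_⟩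
  rcases hr.eq_or_lt with rfl | hr
  · refine ⟨200 * k ^ 2, fun m hm => ?_⟩
    have h := daisyRamsey_three_lower hk hm
    have e : (2 : ℝ) ^ ((4 : ℝ) - ((3 : ℕ) : ℝ)) = 2 := by norm_num
    rw [e]
    exact h
  · obtain ⟨s, rfl⟩ := Nat.exists_eq_add_of_le' (show 4 ≤ r by omega)
    obtain ⟨m₀, h⟩ := daisyRamsey_four_lower (s := s) hk
    refine ⟨m₀, fun m hm => ?_⟩
    have e : (2 : ℝ) ^ ((4 : ℝ) - ((s + 4 : ℕ) : ℝ)) = ((2 : ℝ) ^ s)⁻¹ := by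
      rw [← Real.rpow_natCast, ← Real.rpow_neg (by norm_num)]
      congr 1
      push_cast
      ring
    rw [e]
    exact h m hm
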